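/- arXiv:2603.25182 — 9 statements merged into one kernel-verified Lean document; each statement's English description precedes it below -/
import Mathlib

section
/- Let K ⊆ H be a nonempty closed convex set and let F : H → ℝ be lower semicontinuous (for the norm topology) and λ-convex on K for some λ ∈ ℝ. Let S ∈ K and let τ > 0 satisfy 1/τ + λ > 0. Then the functional T ↦ F(T) + ‖T − S‖²/(2τ) admits a unique minimizer over K. -/
open MeasureTheory
open scoped RealInnerProductSpace

variable {H : Type*} [NormedAddCommGroup H] [InnerProductSpace ℝ H] [CompleteSpace H]

/-- `F` is `λ`-convex on the convex set `K`. -/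
def LambdaConvexOn (lam : ℝ) (K : Set H) (F : H → ℝ) : Prop :=
  ∀ T ∈ K, ∀ S ∈ K, ∀ s : ℝ, 0 ≤ s → s ≤ 1 →
    F ((1 - s) • T + s • S) ≤
      (1 - s) * F T + s * F S - lam / 2 * s * (1 - s) * ‖T - S‖ ^ 2

/-- The defect identity for the squared distance to a point. -/
lemma sq_dist_comb (T U S : H) (s : ℝ) :
    ‖(1 - s) • T + s • U - S‖ ^ 2 =
      (1 - s) * ‖T - S‖ ^ 2 + s * ‖U - S‖ ^ 2 - s * (1 - s) * ‖T - U‖ ^ 2 := by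
  have h1 : (1 - s) • T + s • U - S = (1 - s) • (T - S) + s • (U - S) := by module
  have h2 : T - U = (T - S) - (U - S) := by abel
  rw [h1, h2, norm_add_sq_real, norm_sub_sq_real (T - S), norm_smul, norm_smul, mul_pow, mul_pow,
    inner_smul_left, inner_smul_right, Real.norm_eq_abs, Real.norm_eq_abs, sq_abs, sq_abs]
  simp only [conj_trivial]
  ring

/-- A lower semicontinuous strongly convex function is bounded below. -/
lemma bddBelow_of_strong {K : Set H} (hKconv : Convex ℝ K) {G : H → ℝ}
    (hlsc : LowerSemicontinuous G) {mu : ℝ} (hmu : 0 < mu) (hG : LambdaConvexOn mu K G)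
    {S : H} (hS : S ∈ K) : BddBelow (G '' K) := by
  have h := hlsc S (G S - 1) (by linarith)
  obtain ⟨d, hd, hball⟩ := Metric.eventually_nhds_iff.1 h
  refine ⟨G S - 1 - 4 / (mu * d ^ 2), ?_⟩
  rintro _ ⟨T, hT, rfl⟩
  have hpos : 0 < 4 / (mu * d ^ 2) := by positivity
  by_cases hr : ‖S - T‖ < d
  · have := hball (y := T) (by rwa [dist_comm, dist_eq_norm])
    linarith
  push Not at hr
  set r := ‖S - T‖ with hrdef
  have hr0 : 0 < r := by linarith
  set s := d / (2 * r) with hs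
  have hs0 : 0 < s := by positivity
  have hs1 : s ≤ 1 / 2 := by
    rw [hs, div_le_div_iff₀ (by positivity) (by norm_num)]; linarith
  have hsr : s * r = d / 2 := by rw [hs]; field_simp
  have h1 := hG S hS T hT s hs0.le (by linarith)
  have h2 := hball (y := (1 - s) • S + s • T) (by
    have : (1 - s) • S + s • T - S = s • (T - S) := by module
    rw [dist_eq_norm, this, norm_smul, Real.norm_eq_abs, abs_of_pos hs0, norm_sub_rev, ← hrdef, hsr]
    linarith)
  rw [← hrdef] at h1
  have h3 : mu / 4 * s * r ^ 2 ≤ mu / 2 * s * (1 - s) * r ^ 2 := by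
    have : 0 ≤ mu / 2 * s * r ^ 2 * (1 / 2 - s) :=
      mul_nonneg (by positivity) (by linarith)
    nlinarith
  have h4 : 0 < s * (G T - G S) + 1 - mu / 4 * s * r ^ 2 := by nlinarith
  have h5 : s * (2 * r / d) = 1 := by rw [hs]; field_simp
  have h6 : 0 < s * ((G T - G S) + 2 * r / d - mu / 4 * r ^ 2) := by nlinarith
  have h7 := (mul_pos_iff_of_pos_left hs0).1 h6
  have h8 : mu / 4 * r ^ 2 - 2 * r / d + 4 / (mu * d ^ 2) = mu / 4 * (r - 4 / (mu * d)) ^ 2 := by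
    field_simp; ring
  have h9 : 0 ≤ mu / 4 * (r - 4 / (mu * d)) ^ 2 := by positivity
  linarith

/-- Midpoint form of strong convexity. -/
lemma midpoint_strong {K : Set H} {G : H → ℝ} (hKconv : Convex ℝ K)
    {mu : ℝ} (hG : LambdaConvexOn mu K G) {I : ℝ} (hI : ∀ T ∈ K, I ≤ G T)
    {x y : H} (hx : x ∈ K) (hy : y ∈ K) :
    mu / 8 * ‖x - y‖ ^ 2 ≤ (G x + G y) / 2 - I := by
  have h1 := hG x hx y hy (1 / 2) (by norm_num) (by norm_num)
  have h2 := hI _ (hKconv hx hy (a := 1 - 1 / 2) (b := 1 / 2) (by norm_num) (by norm_num)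
    (by norm_num))
  linarith

lemma exists_min_of_strong {K : Set H} (hKcl : IsClosed K) (hKconv : Convex ℝ K) {G : H → ℝ}
    (hlsc : LowerSemicontinuous G) {mu : ℝ} (hmu : 0 < mu) (hG : LambdaConvexOn mu K G)
    {S : H} (hS : S ∈ K) : ∃ m ∈ K, ∀ U ∈ K, G m ≤ G U := by
  have hb := bddBelow_of_strong hKconv hlsc hmu hG hS
  set I := sInf (G '' K) with hIdef
  have hI : ∀ T ∈ K, I ≤ G T := fun T hT => csInf_le hb ⟨T, hT, rfl⟩
  have hex : ∀ n : ℕ, ∃ x ∈ K, G x < I + 1 / ((n : ℝ) + 1) := by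
    intro n
    have hp : 0 < 1 / ((n : ℝ) + 1) := by positivity
    obtain ⟨_, ⟨x, hx, rfl⟩, hlt⟩ :=
      exists_lt_of_csInf_lt (s := G '' K) ⟨_, S, hS, rfl⟩ (lt_add_of_pos_right I hp)
    exact ⟨x, hx, hlt⟩
  choose x hxK hx using hex
  have hlim : Filter.Tendsto (fun n : ℕ => 1 / ((n : ℝ) + 1)) Filter.atTop (nhds 0) :=
    tendsto_one_div_add_atTop_nhds_zero_nat
  have hc : CauchySeq x := by
    refine cauchySeq_of_le_tendsto_0 (fun n : ℕ => Real.sqrt (8 / mu * (1 / ((n : ℝ) + 1)))) ?_ ?_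
    · intro n m N hn hm
      have e1 : 1 / ((n : ℝ) + 1) ≤ 1 / ((N : ℝ) + 1) := by gcongr
      have e2 : 1 / ((m : ℝ) + 1) ≤ 1 / ((N : ℝ) + 1) := by gcongr
      have h := midpoint_strong hKconv hG hI (hxK n) (hxK m)
      rw [dist_eq_norm]
      apply Real.le_sqrt_of_sq_le
      have hh : mu / 8 * ‖x n - x m‖ ^ 2 ≤ 1 / ((N : ℝ) + 1) := by
        linarith [hx n, hx m]
      calc ‖x n - x m‖ ^ 2 = 8 / mu * (mu / 8 * ‖x n - x m‖ ^ 2) := by field_simp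
        _ ≤ _ := by gcongr
    · have := (hlim.const_mul (8 / mu)).sqrt
      simpa using this
  obtain ⟨m, hm⟩ := cauchySeq_tendsto_of_complete hc
  have hmK : m ∈ K := hKcl.mem_of_tendsto hm (Filter.Eventually.of_forall hxK)
  refine ⟨m, hmK, fun U hU => le_trans ?_ (hI U hU)⟩
  refine le_of_forall_lt fun c hcm => ?_
  obtain ⟨cc, hc1, hc2⟩ := exists_between hcm
  refine lt_of_lt_of_le hc1 ?_
  have hev := hm.eventually (hlsc m cc hc2)
  have hlim2 : Filter.Tendsto (fun n : ℕ => I + 1 / ((n : ℝ) + 1)) Filter.atTop (nhds I) := by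
    simpa using hlim.const_add I
  refine ge_of_tendsto hlim2 (hev.mono fun n hn => (hn.trans (hx n)).le)

/-- For a lower semicontinuous, `λ`-convex `F` and `1/τ + λ > 0`, the proximal functional
`T ↦ F(T) + ‖T − S‖²/(2τ)` admits a unique minimizer over `K`. -/
theorem prox_exists_unique_minimizer (K : Set H) (hKne : K.Nonempty)
    (hKcl : IsClosed K) (hKconv : Convex ℝ K)
    (F : H → ℝ) (hlsc : LowerSemicontinuous F)
    (lam : ℝ) (hconv : LambdaConvexOn lam K F)
    (S : H) (hS : S ∈ K) (τ : ℝ) (hτ : 0 < τ) (hτlam : 1 / τ + lam > 0) :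
    ∃! m : H, m ∈ K ∧
      ∀ U ∈ K, F m + ‖m - S‖ ^ 2 / (2 * τ) ≤ F U + ‖U - S‖ ^ 2 / (2 * τ) := by
  have hmu : 0 < 1 / τ + lam := hτlam
  have hG : LambdaConvexOn (1 / τ + lam) K (fun T => F T + ‖T - S‖ ^ 2 / (2 * τ)) := by
    intro T hT U hU s hs0 hs1
    have h := hconv T hT U hU s hs0 hs1
    simp only [sq_dist_comb]
    have e : ((1 - s) * ‖T - S‖ ^ 2 + s * ‖U - S‖ ^ 2 - s * (1 - s) * ‖T - U‖ ^ 2) / (2 * τ)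
        = (1 - s) * (‖T - S‖ ^ 2 / (2 * τ)) + s * (‖U - S‖ ^ 2 / (2 * τ))
          - (1 / τ) / 2 * s * (1 - s) * ‖T - U‖ ^ 2 := by
      field_simp
    rw [e]
    linarith
  have hl : LowerSemicontinuous (fun T => F T + ‖T - S‖ ^ 2 / (2 * τ)) :=
    hlsc.add (Continuous.lowerSemicontinuous (by fun_prop))
  obtain ⟨m, hmK, hm⟩ := exists_min_of_strong hKcl hKconv hl hmu hG hS
  refine ⟨m, ⟨hmK, hm⟩, ?_⟩
  rintro y ⟨hyK, hy⟩
  have h := midpoint_strong hKconv hG hm hyK hmK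
  have h2 := hy m hmK
  have h3 : (1 / τ + lam) / 8 * ‖y - m‖ ^ 2 ≤ 0 := by linarith
  have h4 : ‖y - m‖ ^ 2 ≤ 0 := by
    by_contra hcon
    push Not at hcon
    have : 0 < (1 / τ + lam) / 8 * ‖y - m‖ ^ 2 := by positivity
    linarith
  have h5 : ‖y - m‖ = 0 := by
    have := le_antisymm h4 (sq_nonneg _)
    exact pow_eq_zero_iff (by norm_num) |>.1 this
  exact sub_eq_zero.1 (norm_eq_zero.1 h5)
end

section
/- Let K ⊆ H be a nonempty closed convex set and let F : H → ℝ be bounded from below, lower semicontinuous (for the norm topology), Fréchet differentiable with gradient ∇F, and λ-convex on K for some λ ∈ ℝ. Let T₀ ∈ K. Then for every t_max > 0 there exists a locally absolutely continuous curve T : [0, t_max] → H with T(0) = T₀ and T(t) ∈ K for all t, such that for almost every t ∈ (0, t_max) the derivative T'(t) exists and equals proj_{Tan_{T(t)} K}(−∇F(T(t))). -/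
open MeasureTheory
open scoped RealInnerProductSpace

variable {H : Type*} [NormedAddCommGroup H] [InnerProductSpace ℝ H] [CompleteSpace H]

/-- The tangent cone of a convex set `K` at a point `T ∈ K`. -/
def tanCone (K : Set H) (T : H) : Set H :=
  closure {w : H | ∃ t : ℝ, 0 < t ∧ T + t • w ∈ K}

/-- `w` is the metric projection of `v` onto the set `C`. -/
def IsProjOn (C : Set H) (v w : H) : Prop :=
  w ∈ C ∧ ∀ u ∈ C, ‖v - w‖ ≤ ‖v - u‖

/-- One step of the implicit Euler scheme, in its variational-inequality form. -/
def EStep (om : ℝ) (K : Set H) (F : H → ℝ) (h : ℝ) (x x' : H) : Prop :=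
  x' ∈ K ∧ ∀ v ∈ K, ‖v - x'‖ ^ 2 - ‖v - x‖ ^ 2 + ‖x' - x‖ ^ 2
    ≤ 2 * h * (F v - F x') + h * om * ‖v - x'‖ ^ 2

omit [CompleteSpace H] in
lemma conv_sq (x v y : H) (s : ℝ) :
    ‖(1 - s) • x + s • v - y‖ ^ 2 =
      (1 - s) * ‖x - y‖ ^ 2 + s * ‖v - y‖ ^ 2 - s * (1 - s) * ‖x - v‖ ^ 2 := by
  have e : (1 - s) • x + s • v - y = (1 - s) • (x - y) + s • (v - y) := by module
  have e2 : x - v = (x - y) - (v - y) := by abel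
  rw [e, e2, norm_add_sq_real, norm_sub_sq_real (x - y), norm_smul, norm_smul, mul_pow, mul_pow,
    inner_smul_left, inner_smul_right]
  simp only [Real.norm_eq_abs, sq_abs, conj_trivial]
  ring

omit [CompleteSpace H] in
lemma fcomb_mem {K : Set H} (hK : Convex ℝ K) {x v : H} (hx : x ∈ K) (hv : v ∈ K) {s : ℝ}
    (h0 : 0 ≤ s) (h1 : s ≤ 1) : (1 - s) • x + s • v ∈ K :=
  hK hx hv (by linarith) h0 (by ring)

lemma exists_step {om : ℝ} {K : Set H} {F : H → ℝ} (hKne : K.Nonempty)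
    (hKcl : IsClosed K) (hKconv : Convex ℝ K) (hbdd : BddBelow (Set.range F))
    (hF : Continuous F) (hc : LambdaConvexOn (-om) K F) {h : ℝ} (hh : 0 < h)
    (hom : h * om < 1) (y : H) : ∃ x', EStep om K F h y x' := by
  set f : H → ℝ := fun x => 2 * h * F x + ‖x - y‖ ^ 2 with hf
  have hfc : Continuous f := by fun_prop
  have hconv : ∀ x ∈ K, ∀ v ∈ K, ∀ s : ℝ, 0 ≤ s → s ≤ 1 → f ((1 - s) • x + s • v) ≤
      (1 - s) * f x + s * f v - (1 - h * om) * (s * (1 - s)) * ‖x - v‖ ^ 2 := by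
    intro x hx v hv s h0 h1
    have := hc x hx v hv s h0 h1
    have := mul_le_mul_of_nonneg_left this (by linarith : 0 ≤ 2 * h)
    simp only [hf]
    rw [conv_sq]
    nlinarith
  have hfb : BddBelow (f '' K) := by
    obtain ⟨c, hcb⟩ := hbdd
    refine ⟨2 * h * c, ?_⟩
    rintro _ ⟨x, -, rfl⟩
    have : c ≤ F x := hcb ⟨x, rfl⟩
    have := mul_le_mul_of_nonneg_left this (by linarith : 0 ≤ 2 * h)
    simp only [hf]; nlinarith [sq_nonneg ‖x - y‖]
  have hne : (f '' K).Nonempty := hKne.image f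
  set I := sInf (f '' K) with hI
  have hIle : ∀ v ∈ K, I ≤ f v := fun v hv => csInf_le hfb ⟨v, hv, rfl⟩
  have hex : ∀ n : ℕ, ∃ x ∈ K, f x < I + 1 / ((n : ℝ) + 1) := by
    intro n
    obtain ⟨_, ⟨x, hx, rfl⟩, hlt⟩ := Real.lt_sInf_add_pos hne (Nat.one_div_pos_of_nat (α := ℝ) (n := n))
    exact ⟨x, hx, hlt⟩
  choose x hxK hxI using hex
  have hmid : ∀ n m, (1 - h * om) * ‖x n - x m‖ ^ 2 ≤
      2 * (1 / ((n : ℝ) + 1) + 1 / ((m : ℝ) + 1)) := by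
    intro n m
    have h1 := hconv _ (hxK n) _ (hxK m) (1/2) (by norm_num) (by norm_num)
    have h2 := hIle _ (fcomb_mem hKconv (hxK n) (hxK m) (s := 1/2) (by norm_num) (by norm_num))
    have := hxI n
    have := hxI m
    linarith
  have hcau : CauchySeq x := by
    rw [Metric.cauchySeq_iff']
    intro ε hε
    have hk : 0 < 1 - h * om := by linarith
    obtain ⟨N, hN⟩ := exists_nat_one_div_lt (show 0 < (1 - h * om) * ε ^ 2 / 4 by positivity)
    refine ⟨N, fun n hn => ?_⟩
    rw [dist_eq_norm]
    have h1 := hmid n N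
    have h2 : 1 / ((n : ℝ) + 1) ≤ 1 / ((N : ℝ) + 1) := Nat.one_div_le_one_div hn
    have h3 : (1 - h * om) * ‖x n - x N‖ ^ 2 < (1 - h * om) * ε ^ 2 := by linarith
    have h4 := lt_of_mul_lt_mul_left h3 hk.le
    exact lt_of_pow_lt_pow_left₀ 2 hε.le h4
  obtain ⟨z, hz⟩ := cauchySeq_tendsto_of_complete hcau
  have hzK : z ∈ K := hKcl.mem_of_tendsto hz (Filter.Eventually.of_forall hxK)
  have hzI : f z ≤ I := by
    have t1 := (hfc.tendsto z).comp hz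
    have t2 : Filter.Tendsto (fun n : ℕ => I + 1 / ((n : ℝ) + 1)) Filter.atTop (nhds (I + 0)) :=
      tendsto_const_nhds.add tendsto_one_div_add_atTop_nhds_zero_nat
    rw [add_zero] at t2
    exact le_of_tendsto_of_tendsto' t1 t2 (fun n => (hxI n).le)
  refine ⟨z, hzK, fun v hv => ?_⟩
  have key : ∀ s : ℝ, 0 < s → s ≤ 1 → f z ≤ f v - (1 - h * om) * (1 - s) * ‖z - v‖ ^ 2 := by
    intro s h0 h1
    have a1 := hconv z hzK v hv s h0.le h1
    have a2 := hIle _ (fcomb_mem hKconv hzK hv h0.le h1)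
    have : s * f z ≤ s * (f v - (1 - h * om) * (1 - s) * ‖z - v‖ ^ 2) := by nlinarith
    exact le_of_mul_le_mul_left this h0
  have lim : f z ≤ f v - (1 - h * om) * (1 - 0) * ‖z - v‖ ^ 2 := by
    have t : Filter.Tendsto (fun s : ℝ => f v - (1 - h * om) * (1 - s) * ‖z - v‖ ^ 2)
        (nhdsWithin 0 (Set.Ioi 0)) (nhds (f v - (1 - h * om) * (1 - 0) * ‖z - v‖ ^ 2)) := by
      apply Filter.Tendsto.mono_left _ nhdsWithin_le_nhds
      apply Continuous.tendsto (by fun_prop)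
    refine ge_of_tendsto t ?_
    filter_upwards [Ioo_mem_nhdsGT (show (0:ℝ) < 1 by norm_num)] with s hs
    exact key s hs.1 hs.2.le
  simp only [hf] at lim
  rw [norm_sub_rev v z]
  nlinarith

lemma subgrad {om : ℝ} {K : Set H} {F : H → ℝ} {g p x : H}
    (hg : HasGradientAt F g p) (hc : LambdaConvexOn (-om) K F) (hp : p ∈ K) (hx : x ∈ K) :
    F p + inner ℝ g (x - p) - om / 2 * ‖x - p‖ ^ 2 ≤ F x := by
  have hl : HasDerivAt (fun s : ℝ => F (p + s • (x - p))) (inner ℝ g (x - p)) 0 := by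
    have h1 : HasDerivAt (fun s : ℝ => p + s • (x - p)) (x - p) 0 := by
      simpa using ((hasDerivAt_id (0:ℝ)).smul_const (x - p)).const_add p
    have h2 : HasFDerivAt F (InnerProductSpace.toDual ℝ H g) (p + (0:ℝ) • (x - p)) := by
      simpa using hg.hasFDerivAt
    have h3 := h2.comp_hasDerivAt (0:ℝ) h1
    rw [InnerProductSpace.toDual_apply_apply] at h3
    exact h3
  have t := (hasDerivWithinAt_iff_tendsto_slope' (s := Set.Ioi (0:ℝ)) (by simp)).1
    (hl.hasDerivWithinAt (s := Set.Ioi (0:ℝ)))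
  have t2 : Filter.Tendsto (fun s : ℝ => F x - F p + om / 2 * (1 - s) * ‖p - x‖ ^ 2)
        (nhdsWithin 0 (Set.Ioi 0)) (nhds (F x - F p + om / 2 * (1 - 0) * ‖p - x‖ ^ 2)) := by
      apply Filter.Tendsto.mono_left _ nhdsWithin_le_nhds
      apply Continuous.tendsto (by fun_prop)
  have := le_of_tendsto_of_tendsto t t2 (by
    filter_upwards [Ioo_mem_nhdsGT (show (0:ℝ) < 1 by norm_num)] with s hs
    have h1 := hc p hp x hx s hs.1.le hs.2.le
    have e : (1 - s) • p + s • x = p + s • (x - p) := by module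
    rw [e] at h1
    simp only [slope_def_field, zero_smul, add_zero, sub_zero]
    rw [div_le_iff₀ hs.1]
    nlinarith)
  rw [norm_sub_rev x p]
  linarith

omit [CompleteSpace H] in
lemma step_contr {om : ℝ} {K : Set H} {F : H → ℝ} {h : ℝ} {y y' z z' : H}
    (hy : EStep om K F h y y') (hz : EStep om K F h z z') :
    (1 - h * om) * ‖y' - z'‖ ≤ ‖y - z‖ := by
  have h1 := hy.2 z' hz.1
  have h2 := hz.2 y' hy.1
  have e : ‖z' - y'‖ = ‖y' - z'‖ := norm_sub_rev _ _
  rw [e] at h1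
  have id1 : -‖z' - y‖ ^ 2 + ‖y' - y‖ ^ 2 - ‖y' - z‖ ^ 2 + ‖z' - z‖ ^ 2 =
      -2 * inner ℝ (y' - z') (y - z) := by
    simp only [norm_sub_sq_real, inner_sub_left, inner_sub_right]
    ring
  have cs := real_inner_le_norm (y' - z') (y - z)
  rcases (norm_nonneg (y' - z')).eq_or_lt with h0 | h0
  · rw [← h0]; simp
  · refine le_of_mul_le_mul_left ?_ h0
    nlinarith

omit [CompleteSpace H] in
lemma step_dist {om : ℝ} {K : Set H} {F : H → ℝ} {h m : ℝ} {x x' p : H} (hh : 0 < h) (hm : 0 ≤ m)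
    (hs : EStep om K F h x x') (hp : p ∈ K)
    (hom : 0 ≤ om)
    (hsub : F p - F x' ≤ m * ‖x' - p‖ + om / 2 * ‖x' - p‖ ^ 2) :
    ‖x' - p‖ ≤ ‖x - p‖ + h * (m + om * ‖x' - p‖) := by
  have h1 := hs.2 p hp
  have h2 := mul_le_mul_of_nonneg_left hsub (by linarith : 0 ≤ 2 * h)
  rw [norm_sub_rev p x', norm_sub_rev p x] at h1
  have tri : |‖x' - p‖ - ‖x - p‖| ≤ ‖x' - x‖ := by
    have := abs_norm_sub_norm_le (x' - p) (x - p)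
    simpa using this
  have tri2 := sq_le_sq' (by linarith [abs_nonneg (‖x' - p‖ - ‖x - p‖), norm_nonneg (x' - x)]) tri
  rw [sq_abs] at tri2
  rcases (norm_nonneg (x' - p)).eq_or_lt with h0 | h0
  · rw [← h0]; simp; positivity
  · refine le_of_mul_le_mul_left ?_ h0
    nlinarith

omit [CompleteSpace H] in
lemma step_compare {om : ℝ} {K : Set H} {F : H → ℝ} {h L : ℝ} {x x' y0 y1 y2 : H} (hh : 0 < h)
    (hom : 0 ≤ om) (hho : h * om ≤ 1 / 6)
    (hx : EStep om K F h x x') (hy1 : EStep om K F (h / 2) y0 y1) (hy2 : EStep om K F (h / 2) y1 y2)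
    (bx : ‖x' - x‖ ≤ L * h) (b1 : ‖y1 - y0‖ ≤ L * (h / 2)) (b2 : ‖y2 - y1‖ ≤ L * (h / 2)) :
    ‖x' - y2‖ ^ 2 ≤ (1 + 6 * om * h) * (‖x - y0‖ ^ 2 + 2 * L ^ 2 * h ^ 2) := by
  have i1 := hy1.2 x' hx.1
  have i2 := hy2.2 x' hx.1
  have i3 := hx.2 y1 hy1.1
  have i4 := hx.2 y2 hy2.1
  rw [norm_sub_rev y1 x'] at i3
  rw [norm_sub_rev y2 x'] at i4
  have id1 : 2 * (‖x' - y1‖ ^ 2 - ‖x' - y0‖ ^ 2 + ‖y1 - y0‖ ^ 2) +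
      2 * (‖x' - y2‖ ^ 2 - ‖x' - y1‖ ^ 2 + ‖y2 - y1‖ ^ 2) +
      (‖x' - y1‖ ^ 2 - ‖y1 - x‖ ^ 2 + ‖x' - x‖ ^ 2) +
      (‖x' - y2‖ ^ 2 - ‖y2 - x‖ ^ 2 + ‖x' - x‖ ^ 2) =
      2 * (‖x' - y2‖ ^ 2 - ‖x - y0‖ ^ 2 + ‖(x' - y2) - (x - y0)‖ ^ 2) -
      4 * inner ℝ (y1 - y0) (y2 - y1) + 2 * inner ℝ (x' - x) (y2 - y1) := by
    simp only [norm_sub_sq_real, inner_sub_left, inner_sub_right, real_inner_self_eq_norm_sq]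
    rw [real_inner_comm y0 x, real_inner_comm y2 x', real_inner_comm y1 x',  real_inner_comm y0 x', real_inner_comm x x', real_inner_comm y1 x, real_inner_comm y2 x, real_inner_comm y0 y1, real_inner_comm y0 y2, real_inner_comm y1 y2]
    ring
  have c1 : inner ℝ (y1 - y0) (y2 - y1) ≤ (L * (h / 2)) * (L * (h / 2)) :=
    (real_inner_le_norm _ _).trans (mul_le_mul b1 b2 (norm_nonneg _) ((norm_nonneg _).trans b1))
  have c2 : -inner ℝ (x' - x) (y2 - y1) ≤ (L * h) * (L * (h / 2)) := by
    refine (neg_le_abs _).trans ((abs_real_inner_le_norm _ _).trans ?_)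
    exact mul_le_mul bx b2 (norm_nonneg _) ((norm_nonneg _).trans bx)
  have c3 : ‖x' - y1‖ ^ 2 ≤ 2 * ‖x' - y2‖ ^ 2 + 2 * (L * (h / 2)) ^ 2 := by
    have t : ‖x' - y1‖ ≤ ‖x' - y2‖ + L * (h / 2) := by
      have := norm_add_le (x' - y2) (y2 - y1)
      rw [sub_add_sub_cancel] at this
      linarith
    have := pow_le_pow_left₀ (norm_nonneg _) t 2
    nlinarith [sq_nonneg (‖x' - y2‖ - L * (h / 2))]
  have hq : 0 ≤ h * om := by positivity
  have main : ‖x' - y2‖ ^ 2 - ‖x - y0‖ ^ 2 ≤ h * om * (‖x' - y1‖ ^ 2 + ‖x' - y2‖ ^ 2) + L ^ 2 * h ^ 2 := by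
    nlinarith [sq_nonneg ‖(x' - y2) - (x - y0)‖]
  have c4 := mul_le_mul_of_nonneg_left c3 hq
  have e6 : 6 * om * h = 6 * (h * om) := by ring
  rw [e6]
  have hC : 0 ≤ L ^ 2 * h ^ 2 := by positivity
  have hA : 0 ≤ ‖x' - y2‖ ^ 2 := by positivity
  generalize h * om = q at *
  generalize ‖x' - y2‖ ^ 2 = A at *
  generalize ‖x - y0‖ ^ 2 = B at *
  have e7 : (L * (h / 2)) ^ 2 = L ^ 2 * h ^ 2 / 4 := by ring
  have e8 : 2 * L ^ 2 * h ^ 2 = 2 * (L ^ 2 * h ^ 2) := by ring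
  rw [e7] at c4
  rw [e8]
  generalize L ^ 2 * h ^ 2 = C at *
  have m1 : A * (1 - 3 * q) ≤ B + 2 * C := by nlinarith
  have m2 := mul_le_mul_of_nonneg_left m1 (by linarith : 0 ≤ 1 + 6 * q)
  have m3 : 0 ≤ A * (3 * q * (1 - 6 * q)) := by
    apply mul_nonneg hA; apply mul_nonneg <;> linarith
  nlinarith

lemma disc_gronwall {a : ℕ → ℝ} {c B : ℝ} (hc : 0 ≤ c) (hB : 0 ≤ B) (N : ℕ)
    (ha : ∀ n < N, a (n + 1) ≤ (1 + c) * (a n + B)) (ha0 : 0 ≤ a 0) :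
    a N ≤ Real.exp (N * c) * (a 0 + N * B) := by
  have h1 : ∀ n ≤ N, a n ≤ (1 + c) ^ n * (a 0 + n * B) := by
    intro n
    induction n with
    | zero => intro _; simp
    | succ n ih =>
      intro hn
      have i1 := ih (by omega)
      have i2 := ha n (by omega)
      have i3 : 1 ≤ (1 + c) ^ n := one_le_pow₀ (by linarith)
      have i4 := mul_le_mul_of_nonneg_right i3 hB
      calc a (n + 1) ≤ (1 + c) * (a n + B) := i2
        _ ≤ (1 + c) * ((1 + c) ^ n * (a 0 + n * B) + (1 + c) ^ n * B) := by
          apply mul_le_mul_of_nonneg_left _ (by linarith); linarith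
        _ = _ := by push_cast; ring
  refine (h1 N le_rfl).trans ?_
  apply mul_le_mul_of_nonneg_right _ (by positivity)
  rw [Real.exp_nat_mul]
  apply pow_le_pow_left₀ (by linarith)
  linarith [Real.add_one_le_exp c]

omit [CompleteSpace H] in
lemma disc_vel {om : ℝ} {K : Set H} {F : H → ℝ} {h m S : ℝ} {X : ℕ → H} (hh : 0 < h) (hm : 0 ≤ m)
    (hom : 0 ≤ om) (hho : h * om ≤ 1 / 6) (h0 : X 0 ∈ K)
    (hX : ∀ n, EStep om K F h (X n) (X (n + 1)))
    (hsub : ∀ x ∈ K, F (X 0) - F x ≤ m * ‖x - X 0‖ + om / 2 * ‖x - X 0‖ ^ 2)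
    (n : ℕ) (hn : n * h ≤ S) :
    ‖X (n + 1) - X n‖ ≤ 2 * m * Real.exp (2 * om * S) * h := by
  have hq : 0 ≤ h * om := by positivity
  have f := step_dist hh hm (hX 0) h0 hom (hsub _ (hX 0).1)
  simp only [sub_self, norm_zero, zero_add] at f
  have f2 : ‖X 1 - X 0‖ ≤ 2 * m * h := by nlinarith [norm_nonneg (X 1 - X 0)]
  have g := disc_gronwall (a := fun n => ‖X (n + 1) - X n‖) (c := 2 * (h * om)) (B := 0)
    (by positivity) le_rfl n (by
      intro k _
      have := step_contr (hX (k + 1)) (hX k)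
      simp only [add_zero]
      have m2 := mul_le_mul_of_nonneg_left this (by linarith : 0 ≤ 1 + 2 * (h * om))
      have m3 : 0 ≤ ‖X (k + 1 + 1) - X (k + 1)‖ * (h * om * (1 - 2 * (h * om))) := by
        apply mul_nonneg (norm_nonneg _); apply mul_nonneg <;> linarith
      nlinarith) (norm_nonneg _)
  simp only [mul_zero, add_zero, zero_add] at g
  have e : (n : ℝ) * (2 * (h * om)) ≤ 2 * om * S := by nlinarith
  calc _ ≤ _ := g
    _ ≤ Real.exp (2 * om * S) * (2 * m * h) := by
      apply mul_le_mul (Real.exp_le_exp.2 e) f2 (norm_nonneg _) (Real.exp_nonneg _)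
    _ = _ := by ring

omit [CompleteSpace H] in
lemma disc_compare {om : ℝ} {K : Set H} {F : H → ℝ} {h L S : ℝ} {X Y : ℕ → H} (hh : 0 < h)
    (hom : 0 ≤ om) (hho : h * om ≤ 1 / 6) (hXY : X 0 = Y 0)
    (hX : ∀ n, EStep om K F h (X n) (X (n + 1)))
    (hY : ∀ n, EStep om K F (h / 2) (Y n) (Y (n + 1)))
    (vX : ∀ n : ℕ, n * h ≤ S → ‖X (n + 1) - X n‖ ≤ L * h)
    (vY : ∀ n : ℕ, n * (h / 2) ≤ S → ‖Y (n + 1) - Y n‖ ≤ L * (h / 2))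
    (n : ℕ) (hn : n * h ≤ S) :
    ‖X n - Y (2 * n)‖ ^ 2 ≤ Real.exp (6 * om * S) * (2 * L ^ 2 * S) * h := by
  have g := disc_gronwall (a := fun n => ‖X n - Y (2 * n)‖ ^ 2) (c := 6 * om * h)
    (B := 2 * L ^ 2 * h ^ 2) (by positivity) (by positivity) n (by
      intro k hk
      have hk' : (k : ℝ) + 1 ≤ n := by exact_mod_cast hk
      have hk2 : ((k : ℝ) + 1) * h ≤ S := (mul_le_mul_of_nonneg_right hk' hh.le).trans hn
      refine step_compare hh hom hho (hX k) (hY (2 * k)) (hY (2 * k + 1)) (vX k ?_) (vY (2 * k) ?_)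
        (vY (2 * k + 1) ?_)
      · linarith
      · push_cast; linarith
      · push_cast; linarith) (by positivity)
  simp only [mul_zero, hXY, sub_self, norm_zero, ne_eq, OfNat.ofNat_ne_zero, not_false_eq_true,
    zero_pow, zero_add] at g
  have e : (n : ℝ) * (6 * om * h) ≤ 6 * om * S := by nlinarith
  have e2 : (n : ℝ) * (2 * L ^ 2 * h ^ 2) ≤ 2 * L ^ 2 * S * h := by
    have : 0 ≤ 2 * L ^ 2 * h := by positivity
    nlinarith
  calc _ ≤ _ := g
    _ ≤ Real.exp (6 * om * S) * (2 * L ^ 2 * S * h) := by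
      apply mul_le_mul (Real.exp_le_exp.2 e) e2 (by positivity) (Real.exp_nonneg _)
    _ = _ := by ring

lemma floor_two {t h : ℝ} (hh : 0 < h) (ht : 0 ≤ t) :
    ⌊t / (h / 2)⌋₊ = 2 * ⌊t / h⌋₊ ∨ ⌊t / (h / 2)⌋₊ = 2 * ⌊t / h⌋₊ + 1 := by
  have h1 : t / (h / 2) = 2 * (t / h) := by field_simp
  have h2 : 0 ≤ t / h := by positivity
  rw [h1]
  generalize t / h = s at *
  have a1 := Nat.floor_le h2
  have a2 := Nat.lt_floor_add_one s
  have b1 : 2 * ⌊s⌋₊ ≤ ⌊2 * s⌋₊ := Nat.le_floor (by push_cast; linarith)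
  have b2 : ⌊2 * s⌋₊ < 2 * ⌊s⌋₊ + 2 := (Nat.floor_lt (by linarith)).2 (by push_cast; linarith)
  omega

lemma floor_mul_le {t h : ℝ} (hh : 0 < h) (ht : 0 ≤ t) : (⌊t / h⌋₊ : ℝ) * h ≤ t := by
  have := Nat.floor_le (show 0 ≤ t / h by positivity)
  rwa [le_div_iff₀ hh] at this

lemma exists_limit {om : ℝ} {K : Set H} {F : H → ℝ} {g T₀ : H} (hKne : K.Nonempty)
    (hKcl : IsClosed K) (hKconv : Convex ℝ K) (hbdd : BddBelow (Set.range F))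
    (hF : Continuous F) (hom : 0 ≤ om) (hc : LambdaConvexOn (-om) K F) (hT₀ : T₀ ∈ K)
    (hg : HasGradientAt F g T₀) {S τ : ℝ} (hS : 0 ≤ S) (hτ : 0 < τ) (hτo : τ * om ≤ 1 / 6) :
    ∃ (L : ℝ) (X : ℕ → ℕ → H) (T : ℝ → H), 0 ≤ L ∧ T 0 = T₀ ∧ (∀ k n, X k n ∈ K) ∧
      (∀ k n, EStep om K F (τ / 2 ^ k) (X k n) (X k (n + 1))) ∧
      (∀ (k n : ℕ), n * (τ / 2 ^ k) ≤ S → ‖X k (n + 1) - X k n‖ ≤ L * (τ / 2 ^ k)) ∧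
      ∀ t, 0 ≤ t → t ≤ S → Filter.Tendsto (fun k => X k ⌊t / (τ / 2 ^ k)⌋₊) Filter.atTop
        (nhds (T t)) := by
  have hpos : ∀ k : ℕ, 0 < τ / 2 ^ k := fun k => by positivity
  have hle : ∀ k : ℕ, τ / 2 ^ k ≤ τ := fun k => div_le_self hτ.le (one_le_pow₀ (by norm_num))
  have hho : ∀ k : ℕ, τ / 2 ^ k * om ≤ 1 / 6 := fun k =>
    (mul_le_mul_of_nonneg_right (hle k) hom).trans hτo
  have hex : ∀ (k : ℕ) (y : H), ∃ x', EStep om K F (τ / 2 ^ k) y x' := fun k y =>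
    exists_step hKne hKcl hKconv hbdd hF hc (hpos k) ((hho k).trans_lt (by norm_num)) y
  choose J hJ using hex
  let X : ℕ → ℕ → H := fun k n => Nat.rec T₀ (fun _ x => J k x) n
  have hX : ∀ k n, EStep om K F (τ / 2 ^ k) (X k n) (X k (n + 1)) := fun k n => hJ k (X k n)
  have hX0 : ∀ k, X k 0 = T₀ := fun k => rfl
  have hXK : ∀ k n, X k n ∈ K := by
    intro k n
    cases n with
    | zero => exact hT₀
    | succ n => exact (hX k n).1
  have hsub : ∀ x ∈ K, F T₀ - F x ≤ ‖g‖ * ‖x - T₀‖ + om / 2 * ‖x - T₀‖ ^ 2 := by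
    intro x hx
    have h1 := subgrad hg hc hT₀ hx
    have h2 := (neg_le_abs _).trans (abs_real_inner_le_norm g (x - T₀))
    linarith
  set L := 2 * ‖g‖ * Real.exp (2 * om * S) with hL
  have hL0 : 0 ≤ L := by positivity
  have vX : ∀ (k n : ℕ), n * (τ / 2 ^ k) ≤ S → ‖X k (n + 1) - X k n‖ ≤ L * (τ / 2 ^ k) :=
    fun k n hn => disc_vel (hpos k) (norm_nonneg g) hom (hho k) (hXK k 0) (hX k) hsub n hn
  have hhalf : ∀ k : ℕ, τ / 2 ^ (k + 1) = τ / 2 ^ k / 2 := fun k => by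
    rw [pow_succ]; field_simp
  set r : ℝ := Real.sqrt (1 / 2) with hr
  have hr1 : r < 1 := by rw [hr, Real.sqrt_lt' one_pos]; norm_num
  have hr0 : 0 ≤ r := Real.sqrt_nonneg _
  have hrsq : r ^ 2 = 1 / 2 := Real.sq_sqrt (by norm_num)
  have hrk : ∀ k : ℕ, τ / 2 ^ k = τ * (r ^ k) ^ 2 := by
    intro k
    rw [← pow_mul, mul_comm k 2, pow_mul, hrsq, one_div, inv_pow]; rfl
  set C := Real.exp (6 * om * S) * (2 * L ^ 2 * S) * τ with hC
  have hC0 : 0 ≤ C := by positivity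
  have hcau : ∀ t, 0 ≤ t → t ≤ S → CauchySeq (fun k => X k ⌊t / (τ / 2 ^ k)⌋₊) := by
    intro t ht0 htS
    refine cauchySeq_of_le_geometric r (Real.sqrt C + L * τ) hr1 (fun k => ?_)
    rw [dist_eq_norm]
    set n := ⌊t / (τ / 2 ^ k)⌋₊ with hn
    have hnS : (n : ℝ) * (τ / 2 ^ k) ≤ S := (floor_mul_le (hpos k) ht0).trans htS
    have c1 := disc_compare (X := X k) (Y := X (k + 1)) (hpos k) hom (hho k) rfl (hX k)
      (fun n => hhalf k ▸ hX (k + 1) n) (vX k) (fun n => hhalf k ▸ vX (k + 1) n) n hnS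
    have c2 : ‖X k n - X (k + 1) (2 * n)‖ ≤ Real.sqrt C * r ^ k := by
      refine le_of_sq_le_sq ?_ (by positivity)
      rw [mul_pow, Real.sq_sqrt hC0]
      refine c1.trans (le_of_eq ?_)
      rw [hrk k, hC]; ring
    have c3 : ‖X (k + 1) (2 * n) - X (k + 1) ⌊t / (τ / 2 ^ (k + 1))⌋₊‖ ≤ L * τ * r ^ k := by
      rw [hhalf k]
      rcases floor_two (hpos k) ht0 with h1 | h1
      · rw [h1, ← hn, sub_self, norm_zero]; positivity
      · rw [h1, ← hn, norm_sub_rev]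
        refine (vX (k + 1) (2 * n) ?_).trans ?_
        · rw [hhalf]; push_cast; linarith
        · rw [hhalf, hrk]
          have : (r ^ k) ^ 2 ≤ r ^ k := by
            have := pow_le_one₀ (n := k) hr0 hr1.le
            have := pow_nonneg hr0 k
            nlinarith
          have h0 : 0 ≤ L * τ := by positivity
          have := mul_le_mul_of_nonneg_left this h0
          nlinarith [pow_nonneg hr0 k, mul_nonneg h0 (sq_nonneg (r ^ k))]
    have := norm_sub_le_norm_sub_add_norm_sub (X k n) (X (k + 1) (2 * n))
      (X (k + 1) ⌊t / (τ / 2 ^ (k + 1))⌋₊)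
    linarith
  have hlim : ∀ t, ∃ z, 0 ≤ t → t ≤ S → Filter.Tendsto (fun k => X k ⌊t / (τ / 2 ^ k)⌋₊)
      Filter.atTop (nhds z) := by
    intro t
    by_cases h : 0 ≤ t ∧ t ≤ S
    · obtain ⟨z, hz⟩ := cauchySeq_tendsto_of_complete (hcau t h.1 h.2)
      exact ⟨z, fun _ _ => hz⟩
    · exact ⟨0, fun h1 h2 => absurd ⟨h1, h2⟩ h⟩
  choose T hT using hlim
  refine ⟨L, X, T, hL0, ?_, hXK, hX, vX, hT⟩
  have := hT 0 le_rfl hS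
  simp only [zero_div, Nat.floor_zero] at this
  exact tendsto_nhds_unique this tendsto_const_nhds

omit [CompleteSpace H] in
lemma disc_lip {X : ℕ → H} {i d : ℕ} {c : ℝ} (h : ∀ l < d, ‖X (i + l + 1) - X (i + l)‖ ≤ c) :
    ∀ l ≤ d, ‖X (i + l) - X i‖ ≤ l * c := by
  intro l
  induction l with
  | zero => simp
  | succ l ih =>
    intro hl
    have h1 := ih (by omega)
    have h2 := h l (by omega)
    have h3 := norm_sub_le_norm_sub_add_norm_sub (X (i + l + 1)) (X (i + l)) (X i)
    rw [← add_assoc]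
    push_cast
    linarith

omit [CompleteSpace H] in
lemma disc_A {om : ℝ} {K : Set H} {F : H → ℝ} {h m ρ : ℝ} {X : ℕ → H} {p : H} {i : ℕ}
    (hh : 0 < h) (hm : 0 ≤ m) (hom : 0 ≤ om) (hp : p ∈ K)
    (hX : ∀ n, EStep om K F h (X n) (X (n + 1)))
    (hsub : ∀ x ∈ K, F p - F x ≤ m * ‖x - p‖ + om / 2 * ‖x - p‖ ^ 2) (d : ℕ)
    (hρ : ∀ l ≤ d, ‖X (i + l) - p‖ ≤ ρ) :
    ‖X (i + d) - p‖ ≤ ‖X i - p‖ + d * (h * (m + om * ρ)) := by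
  induction d with
  | zero => simp
  | succ d ih =>
    have h1 := ih (fun l hl => hρ l (by omega))
    have h2 := step_dist hh hm (hX (i + d)) hp hom (hsub _ (hX _).1)
    have h3 := hρ (d + 1) le_rfl
    rw [← add_assoc] at h3 ⊢
    have h4 := mul_le_mul_of_nonneg_left (mul_le_mul_of_nonneg_left h3 hom) hh.le
    push_cast
    linarith

omit [CompleteSpace H] in
lemma disc_B {om : ℝ} {K : Set H} {F : H → ℝ} {h G ρ : ℝ} {X : ℕ → H} {p v : H} {i : ℕ}
    (hh : 0 < h) (hom : 0 ≤ om) (hG : 0 ≤ G) (hv : v ∈ K)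
    (hX : ∀ n, EStep om K F h (X n) (X (n + 1)))
    (hsub : ∀ x ∈ K, F p - F x ≤ G * ‖x - p‖ + om / 2 * ‖x - p‖ ^ 2) (d : ℕ)
    (hρ : ∀ l ≤ d, ‖X (i + l) - p‖ ≤ ρ) :
    ‖v - X (i + d)‖ ^ 2 - ‖v - X i‖ ^ 2 ≤
      d * (h * (2 * (F v - F p) + 2 * G * ρ + om * ρ ^ 2 + om * (‖v - p‖ + ρ) ^ 2)) := by
  induction d with
  | zero => simp
  | succ d ih =>
    have h1 := ih (fun l hl => hρ l (by omega))
    have h2 := (hX (i + d)).2 v hv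
    have h3 := hρ (d + 1) le_rfl
    rw [← add_assoc] at h3 ⊢
    have h5 := hsub _ (hX (i + d)).1
    have h6 : ‖v - X (i + d + 1)‖ ≤ ‖v - p‖ + ρ := by
      have := norm_sub_le_norm_sub_add_norm_sub v p (X (i + d + 1))
      rw [norm_sub_rev p] at this
      linarith
    have h7 := mul_le_mul_of_nonneg_left (pow_le_pow_left₀ (norm_nonneg _) h6 2) hom
    have h8 := mul_le_mul_of_nonneg_left (pow_le_pow_left₀ (norm_nonneg _) h3 2) hom
    have h9 := mul_le_mul_of_nonneg_left h3 hG
    have h10 : 2 * (F v - F (X (i + d + 1))) + om * ‖v - X (i + d + 1)‖ ^ 2 ≤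
      2 * (F v - F p) + 2 * G * ρ + om * ρ ^ 2 + om * (‖v - p‖ + ρ) ^ 2 := by linarith
    have h11 := mul_le_mul_of_nonneg_left h10 hh.le
    have h12 := sq_nonneg ‖X (i + d + 1) - X (i + d)‖
    push_cast
    linarith

lemma tendsto_floor_mul {τ t : ℝ} (hτ : 0 < τ) (ht : 0 ≤ t) :
    Filter.Tendsto (fun k : ℕ => (⌊t / (τ / 2 ^ k)⌋₊ : ℝ) * (τ / 2 ^ k)) Filter.atTop (nhds t) := by
  have hpos : ∀ k : ℕ, 0 < τ / 2 ^ k := fun k => by positivity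
  have t0 : Filter.Tendsto (fun k : ℕ => τ / 2 ^ k) Filter.atTop (nhds 0) := by
    have := (tendsto_pow_atTop_nhds_zero_of_lt_one (r := (1 / 2 : ℝ)) (by norm_num)
      (by norm_num)).const_mul τ
    rw [mul_zero] at this
    refine this.congr (fun k => ?_)
    rw [one_div, inv_pow]; rfl
  have t1 : Filter.Tendsto (fun k : ℕ => t - τ / 2 ^ k) Filter.atTop (nhds t) := by
    simpa using tendsto_const_nhds.sub t0
  refine tendsto_of_tendsto_of_tendsto_of_le_of_le t1 tendsto_const_nhds (fun k => ?_)
    (fun k => floor_mul_le (hpos k) ht)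
  have := Nat.lt_floor_add_one (t / (τ / 2 ^ k))
  rw [div_lt_iff₀ (hpos k)] at this
  simp only
  linarith

omit [CompleteSpace H] in
lemma limit_AB {om : ℝ} {K : Set H} {F : H → ℝ} (hom : 0 ≤ om) {S τ L : ℝ} (hτ : 0 < τ)
    {X : ℕ → ℕ → H} {T : ℝ → H} (hL : 0 ≤ L)
    (hX : ∀ k n, EStep om K F (τ / 2 ^ k) (X k n) (X k (n + 1)))
    (vX : ∀ (k n : ℕ), n * (τ / 2 ^ k) ≤ S → ‖X k (n + 1) - X k n‖ ≤ L * (τ / 2 ^ k))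
    (hT : ∀ t, 0 ≤ t → t ≤ S → Filter.Tendsto (fun k => X k ⌊t / (τ / 2 ^ k)⌋₊) Filter.atTop
        (nhds (T t))) {a b : ℝ} (ha : 0 ≤ a) (hab : a ≤ b) (hb : b ≤ S) (hp : T a ∈ K) :
    ‖T b - T a‖ ≤ (b - a) * L ∧
    (∀ m, 0 ≤ m →
      (∀ x ∈ K, F (T a) - F x ≤ m * ‖x - T a‖ + om / 2 * ‖x - T a‖ ^ 2) →
      ‖T b - T a‖ ≤ (b - a) * (m + om * ((b - a) * L))) ∧
    (∀ G, 0 ≤ G → ∀ v ∈ K,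
      (∀ x ∈ K, F (T a) - F x ≤ G * ‖x - T a‖ + om / 2 * ‖x - T a‖ ^ 2) →
      ‖v - T b‖ ^ 2 - ‖v - T a‖ ^ 2 ≤ (b - a) * (2 * (F v - F (T a)) + 2 * G * ((b - a) * L) +
        om * ((b - a) * L) ^ 2 + om * (‖v - T a‖ + (b - a) * L) ^ 2)) := by
  have hpos : ∀ k : ℕ, 0 < τ / 2 ^ k := fun k => by positivity
  set i : ℕ → ℕ := fun k => ⌊a / (τ / 2 ^ k)⌋₊ with hi
  set j : ℕ → ℕ := fun k => ⌊b / (τ / 2 ^ k)⌋₊ with hj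
  have hij : ∀ k, i k ≤ j k := fun k => Nat.floor_le_floor (div_le_div_of_nonneg_right hab (hpos k).le)
  choose d hd using fun k => Nat.exists_eq_add_of_le (hij k)
  have tX : Filter.Tendsto (fun k => X k (i k)) Filter.atTop (nhds (T a)) :=
    hT a ha (hab.trans hb)
  have tY : Filter.Tendsto (fun k => X k (i k + d k)) Filter.atTop (nhds (T b)) := by
    have := hT b (ha.trans hab) hb
    refine this.congr (fun k => ?_)
    rw [← hd k]
  have td : Filter.Tendsto (fun k => (d k : ℝ) * (τ / 2 ^ k)) Filter.atTop (nhds (b - a)) := by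
    have := (tendsto_floor_mul hτ (ha.trans hab)).sub (tendsto_floor_mul hτ ha)
    refine this.congr (fun k => ?_)
    have e : (j k : ℝ) = i k + d k := by exact_mod_cast hd k
    change (j k : ℝ) * (τ / 2 ^ k) - (i k : ℝ) * (τ / 2 ^ k) = _
    rw [e]; ring
  have tn : Filter.Tendsto (fun k => ‖X k (i k) - T a‖) Filter.atTop (nhds 0) := by
    simpa using (tX.sub_const (T a)).norm
  have hlip : ∀ k, ∀ l ≤ d k, ‖X k (i k + l) - X k (i k)‖ ≤ l * (L * (τ / 2 ^ k)) := by
    intro k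
    refine disc_lip (fun l hl => vX k (i k + l) ?_)
    refine le_trans ?_ ((floor_mul_le (hpos k) (ha.trans hab)).trans hb)
    refine mul_le_mul_of_nonneg_right ?_ (hpos k).le
    have : i k + l ≤ j k := by rw [hd k]; omega
    change ((i k + l : ℕ) : ℝ) ≤ (j k : ℝ)
    exact Nat.cast_le.2 this
  set ρ : ℕ → ℝ := fun k => ‖X k (i k) - T a‖ + d k * (τ / 2 ^ k) * L with hρ
  have tρ : Filter.Tendsto ρ Filter.atTop (nhds ((b - a) * L)) := by
    simpa using tn.add (td.mul_const L)
  have hρk : ∀ k, ∀ l ≤ d k, ‖X k (i k + l) - T a‖ ≤ ρ k := by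
    intro k l hl
    have h1 := hlip k l hl
    have h2 := norm_sub_le_norm_sub_add_norm_sub (X k (i k + l)) (X k (i k)) (T a)
    have h3 : (l : ℝ) ≤ d k := by exact_mod_cast hl
    have h4 : 0 ≤ L * (τ / 2 ^ k) := mul_nonneg hL (hpos k).le
    have h5 := mul_le_mul_of_nonneg_right h3 h4
    simp only [hρ]
    linarith
  refine ⟨?_, ?_, ?_⟩
  · exact le_of_tendsto_of_tendsto' (tY.sub_const (T a)).norm tρ (fun k => hρk k (d k) le_rfl)
  · intro m hm hsub
    have t2 : Filter.Tendsto (fun k => ‖X k (i k) - T a‖ +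
        (d k : ℝ) * (τ / 2 ^ k) * (m + om * ρ k)) Filter.atTop
        (nhds (0 + (b - a) * (m + om * ((b - a) * L)))) :=
      tn.add (td.mul ((tρ.const_mul om).const_add m))
    rw [zero_add] at t2
    refine le_of_tendsto_of_tendsto' (tY.sub_const (T a)).norm t2 (fun k => ?_)
    have := disc_A (hpos k) hm hom hp (hX k) hsub (d k) (hρk k)
    rw [mul_assoc]; exact this
  · intro G hG v hv hsub
    have t1 := ((tY.const_sub v).norm.pow 2).sub ((tX.const_sub v).norm.pow 2)
    have t2 := td.mul ((((tρ.const_mul (2 * G)).const_add (2 * (F v - F (T a)))).add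
      ((tρ.pow 2).const_mul om)).add (((tρ.const_add ‖v - T a‖).pow 2).const_mul om))
    refine le_of_tendsto_of_tendsto' t1 t2 (fun k => ?_)
    have := disc_B (hpos k) hom hG hv (hX k) hsub (d k) (hρk k)
    rw [mul_assoc]; exact this

lemma exists_proj {K : Set H} (hK : Convex ℝ K) {p : H} (hp : p ∈ K) (g : H) :
    ∃ w, IsProjOn (tanCone K p) g w ∧ inner ℝ g w = ‖w‖ ^ 2 ∧
      ∀ x ∈ K, inner ℝ g (x - p) ≤ inner ℝ w (x - p) := by
  set C0 : Set H := {w : H | ∃ t : ℝ, 0 < t ∧ p + t • w ∈ K} with hC0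
  have shrink : ∀ (w : H) (t s : ℝ), p + t • w ∈ K → 0 < t → 0 ≤ s → s ≤ t → p + s • w ∈ K := by
    intro w t s h ht hs hst
    have := fcomb_mem hK hp h (s := s / t) (by positivity) (by rw [div_le_one ht]; exact hst)
    convert this using 1
    have e : s = s / t * t := by field_simp
    conv_lhs => rw [e]
    module
  have hC0c : Convex ℝ C0 := by
    rintro x ⟨t, ht, hx⟩ y ⟨s, hs, hy⟩ a b ha hb hab
    refine ⟨min t s, lt_min ht hs, ?_⟩
    have h1 := shrink x t (min t s) hx ht (lt_min ht hs).le (min_le_left _ _)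
    have h2 := shrink y s (min t s) hy hs (lt_min ht hs).le (min_le_right _ _)
    have := hK h1 h2 ha hb hab
    convert this using 1
    have e : b = 1 - a := by linarith
    subst e
    module
  have hsub : ∀ x ∈ K, x - p ∈ tanCone K p := fun x hx =>
    subset_closure ⟨1, one_pos, by simpa using hx⟩
  have h0 : (0 : H) ∈ tanCone K p := by simpa using hsub p hp
  have hconv : Convex ℝ (tanCone K p) := hC0c.closure
  obtain ⟨w, hw, hmin⟩ := exists_norm_eq_iInf_of_complete_convex ⟨0, h0⟩
    (isClosed_closure.isComplete : IsComplete (tanCone K p)) hconv g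
  have hvar := (norm_eq_iInf_iff_real_inner_le_zero hconv hw).1 hmin
  have h2w : (2 : ℝ) • w ∈ tanCone K p := by
    refine map_mem_closure (f := fun u : H => (2 : ℝ) • u) (by fun_prop) hw ?_
    rintro u ⟨t, ht, hu⟩
    refine ⟨t / 2, by positivity, ?_⟩
    rw [smul_smul, div_mul_cancel₀ _ (by norm_num)]; exact hu
  have e0 := hvar 0 h0
  have e2 := hvar _ h2w
  have e3 : (2 : ℝ) • w - w = w := by module
  rw [e3] at e2
  rw [zero_sub, inner_neg_right] at e0
  have e4 : inner ℝ (g - w) w = 0 := by linarith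
  refine ⟨w, ⟨hw, fun u hu => ?_⟩, ?_, fun x hx => ?_⟩
  · rw [hmin]
    exact ciInf_le ⟨0, by rintro _ ⟨x, rfl⟩; exact norm_nonneg _⟩ (⟨u, hu⟩ : tanCone K p)
  · rw [inner_sub_left, real_inner_self_eq_norm_sq] at e4; linarith
  · have := hvar _ (hsub x hx)
    rw [inner_sub_right, e4, inner_sub_left] at this
    linarith

lemma right_deriv {om : ℝ} {K : Set H} {F : H → ℝ} {g w : H} (hK : Convex ℝ K)
    {T : ℝ → H} {a b : ℝ} (hab : a < b) {L : ℝ} (hp : T a ∈ K)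
    (hg : HasGradientAt F g (T a))
    (hw : w ∈ tanCone K (T a)) (hgw : inner ℝ (-g) w = ‖w‖ ^ 2)
    (hL : ∀ t ∈ Set.Ioo a b, ‖T t - T a‖ ≤ (t - a) * L)
    (hA : ∀ t ∈ Set.Ioo a b, ‖T t - T a‖ ≤ (t - a) * (‖w‖ + om * ((t - a) * L)))
    (hB : ∀ t ∈ Set.Ioo a b, ∀ v ∈ K,
      ‖v - T t‖ ^ 2 - ‖v - T a‖ ^ 2 ≤ (t - a) * (2 * (F v - F (T a)) + 2 * ‖g‖ * ((t - a) * L) +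
        om * ((t - a) * L) ^ 2 + om * (‖v - T a‖ + (t - a) * L) ^ 2)) :
    HasDerivWithinAt T w (Set.Ioi a) a := by
  rw [hasDerivWithinAt_iff_tendsto_slope' (by simp)]
  have hIoo : Set.Ioo a b ∈ nhdsWithin a (Set.Ioi a) := Ioo_mem_nhdsGT hab
  have hsl : ∀ t ∈ Set.Ioo a b, T t - T a = (t - a) • slope T a t := fun t ht => by
    rw [sub_smul_slope]; rfl
  have nrm : ∀ t ∈ Set.Ioo a b, ‖T t - T a‖ = (t - a) * ‖slope T a t‖ := fun t ht => by
    rw [hsl t ht, norm_smul, Real.norm_of_nonneg (by linarith [ht.1])]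
  have hDL : ∀ t ∈ Set.Ioo a b, ‖slope T a t‖ ≤ L := fun t ht => by
    have := hL t ht
    rw [nrm t ht] at this
    exact le_of_mul_le_mul_left this (by linarith [ht.1])
  have hDA : ∀ t ∈ Set.Ioo a b, ‖slope T a t‖ ≤ ‖w‖ + om * ((t - a) * L) := fun t ht => by
    have := hA t ht
    rw [nrm t ht] at this
    exact le_of_mul_le_mul_left this (by linarith [ht.1])
  have hL0 : 0 ≤ L := (norm_nonneg _).trans (hDL ((a + b) / 2) ⟨by linarith, by linarith⟩)
  -- lower bound in feasible directions
  have feas : ∀ u : H, (∃ s : ℝ, 0 < s ∧ T a + s • u ∈ K) → ∀ η : ℝ, 0 < η →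
      ∀ᶠ t in nhdsWithin a (Set.Ioi a), inner ℝ (-g) u - η ≤ inner ℝ (slope T a t) u := by
    rintro u ⟨s, hs, hu⟩ η hη
    have hl : HasDerivAt (fun ε : ℝ => F (T a + ε • u)) (inner ℝ g u) 0 := by
      have h1 : HasDerivAt (fun ε : ℝ => T a + ε • u) u 0 := by
        simpa using ((hasDerivAt_id (0:ℝ)).smul_const u).const_add (T a)
      have h2 : HasFDerivAt F (InnerProductSpace.toDual ℝ H g) (T a + (0:ℝ) • u) := by
        simpa using hg.hasFDerivAt
      have h3 := h2.comp_hasDerivAt (0:ℝ) h1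
      rw [InnerProductSpace.toDual_apply_apply] at h3
      exact h3
    have t := (hasDerivWithinAt_iff_tendsto_slope' (s := Set.Ioi (0:ℝ)) (by simp)).1
      (hl.hasDerivWithinAt (s := Set.Ioi (0:ℝ)))
    have t2 : Filter.Tendsto (fun ε : ℝ => om / 2 * ε * ‖u‖ ^ 2) (nhdsWithin 0 (Set.Ioi 0))
        (nhds (om / 2 * 0 * ‖u‖ ^ 2)) :=
      Filter.Tendsto.mono_left (Continuous.tendsto (by fun_prop) _) nhdsWithin_le_nhds
    have t3 := t.add t2
    have ev := t3.eventually (gt_mem_nhds (show inner ℝ g u + om / 2 * 0 * ‖u‖ ^ 2 <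
      inner ℝ g u + η / 2 by simp; linarith))
    obtain ⟨ε, hε1, hε2⟩ := (ev.and (Ioo_mem_nhdsGT hs)).exists
    have hε0 : 0 < ε := hε2.1
    have hv : T a + ε • u ∈ K := by
      have := fcomb_mem hK hp hu (s := ε / s) (by positivity) (by rw [div_le_one hs]; exact hε2.2.le)
      convert this using 1
      have e : ε = ε / s * s := by field_simp
      conv_lhs => rw [e]
      module
    simp only [slope_def_field, zero_smul, add_zero, sub_zero] at hε1
    have hv2 : ‖T a + ε • u - T a‖ = ε * ‖u‖ := by
      rw [add_sub_cancel_left, norm_smul, Real.norm_of_nonneg hε0.le]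
    -- error term
    have t4 : Filter.Tendsto (fun t : ℝ => 2 * (F (T a + ε • u) - F (T a)) + 2 * ‖g‖ * ((t - a) * L) +
        om * ((t - a) * L) ^ 2 + om * (ε * ‖u‖ + (t - a) * L) ^ 2) (nhdsWithin a (Set.Ioi a))
        (nhds (2 * (F (T a + ε • u) - F (T a)) + 2 * ‖g‖ * ((a - a) * L) +
        om * ((a - a) * L) ^ 2 + om * (ε * ‖u‖ + (a - a) * L) ^ 2)) :=
      Filter.Tendsto.mono_left (Continuous.tendsto (by fun_prop) _) nhdsWithin_le_nhds
    have lt : 2 * (F (T a + ε • u) - F (T a)) + 2 * ‖g‖ * ((a - a) * L) +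
        om * ((a - a) * L) ^ 2 + om * (ε * ‖u‖ + (a - a) * L) ^ 2 <
        2 * ε * (inner ℝ g u + η) := by
      have : (F (T a + ε • u) - F (T a)) / ε * ε = F (T a + ε • u) - F (T a) := by field_simp
      have h2 := mul_lt_mul_of_pos_right hε1 hε0
      rw [add_mul, this] at h2
      have := mul_pos hε0 hη
      simp only [sub_self, zero_mul, mul_zero, add_zero]
      nlinarith
    filter_upwards [t4.eventually (gt_mem_nhds lt), hIoo] with t ht1 ht2
    have hta : 0 < t - a := by linarith [ht2.1]
    have b1 := hB t ht2 _ hv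
    rw [hv2] at b1
    have b2 := mul_le_mul_of_nonneg_left ht1.le hta.le
    have b3 : ‖T a + ε • u - T t‖ ^ 2 = (ε * ‖u‖) ^ 2 -
        2 * ((t - a) * (ε * inner ℝ (slope T a t) u)) + ‖T t - T a‖ ^ 2 := by
      have e : T a + ε • u - T t = (ε • u) - (T t - T a) := by abel
      rw [e, norm_sub_sq_real, norm_smul, Real.norm_of_nonneg hε0.le]
      congr 3
      rw [hsl t ht2, inner_smul_left, inner_smul_right, real_inner_comm]
      simp only [conj_trivial]
      ring
    rw [b3] at b1
    have b4 : (t - a) * ε * (-inner ℝ (slope T a t) u) ≤ (t - a) * ε * (inner ℝ g u + η) := by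
      nlinarith [sq_nonneg ‖T t - T a‖]
    have b5 := le_of_mul_le_mul_left b4 (mul_pos hta hε0)
    rw [inner_neg_left]
    linarith
  -- conclusion
  rw [tendsto_iff_norm_sub_tendsto_zero]
  have hsq : Filter.Tendsto (fun t => ‖slope T a t - w‖ ^ 2) (nhdsWithin a (Set.Ioi a)) (nhds 0) := by
    rw [Metric.tendsto_nhds]
    intro δ hδ
    set c := 3 + 2 * L + 2 * ‖g‖ with hc
    have hc0 : 0 < c := by positivity
    set η := δ / (2 * c) with hη
    have hη0 : 0 < η := by positivity
    have hηc : η * c < δ := by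
      have : η * c = δ / 2 := by rw [hη]; field_simp
      linarith
    obtain ⟨u, hu, huw⟩ := Metric.mem_closure_iff.1 hw η hη0
    rw [dist_eq_norm] at huw
    have t4 : Filter.Tendsto (fun t : ℝ => (‖w‖ + om * ((t - a) * L)) ^ 2) (nhdsWithin a (Set.Ioi a))
        (nhds ((‖w‖ + om * ((a - a) * L)) ^ 2)) :=
      Filter.Tendsto.mono_left (Continuous.tendsto (by fun_prop) _) nhdsWithin_le_nhds
    filter_upwards [feas u hu η hη0, hIoo, t4.eventually (gt_mem_nhds
      (show (‖w‖ + om * ((a - a) * L)) ^ 2 < ‖w‖ ^ 2 + η by simp; linarith))] with t h1 h2 h3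
    rw [dist_zero_right, Real.norm_of_nonneg (by positivity), norm_sub_sq_real]
    have d1 := pow_le_pow_left₀ (norm_nonneg _) (hDA t h2) 2
    have d2 : inner ℝ (slope T a t) (u - w) ≤ L * η := by
      refine (real_inner_le_norm _ _).trans ?_
      rw [norm_sub_rev]
      exact mul_le_mul (hDL t h2) huw.le (norm_nonneg _) hL0
    have d3 : inner ℝ (-g) (w - u) ≤ ‖g‖ * η := by
      refine (real_inner_le_norm _ _).trans ?_
      rw [norm_neg]
      exact mul_le_mul_of_nonneg_left huw.le (norm_nonneg _)
    rw [inner_sub_right] at d2 d3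
    nlinarith
  have := hsq.sqrt
  simpa using this

/-- Existence of solutions to the constrained gradient flow of `F` in `K` on `[0, t_max]`:
a locally absolutely continuous curve (encoded by the fundamental theorem of calculus with an
integrable a.e.-derivative) staying in `K`, starting at `T₀`, whose a.e.-derivative is the
projection of `−∇F(T(t))` onto the tangent cone of `K` at `T(t)`. -/
theorem constrained_gradient_flow_exists (K : Set H) (hKne : K.Nonempty)
    (hKcl : IsClosed K) (hKconv : Convex ℝ K)
    (F : H → ℝ) (F' : H → H)
    (hbdd : BddBelow (Set.range F)) (hlsc : LowerSemicontinuous F)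
    (hgrad : ∀ x : H, HasGradientAt F (F' x) x)
    (lam : ℝ) (hconv : LambdaConvexOn lam K F)
    (T₀ : H) (hT₀ : T₀ ∈ K) (tmax : ℝ) (htmax : 0 < tmax) :
    ∃ T T' : ℝ → H,
      T 0 = T₀ ∧
      (∀ t ∈ Set.Icc (0 : ℝ) tmax, T t ∈ K) ∧
      IntervalIntegrable T' MeasureTheory.volume 0 tmax ∧
      (∀ a b : ℝ, 0 ≤ a → a ≤ b → b ≤ tmax → T b - T a = ∫ t in a..b, T' t) ∧
      (∀ᵐ t ∂(MeasureTheory.volume.restrict (Set.Ioo (0 : ℝ) tmax)),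
        HasDerivAt T (T' t) t ∧ IsProjOn (tanCone K (T t)) (-(F' (T t))) (T' t)) := by
  obtain ⟨om, hom, hlam⟩ : ∃ om : ℝ, 0 ≤ om ∧ -lam ≤ om := ⟨max (-lam) 0, le_max_right _ _, le_max_left _ _⟩
  have hc : LambdaConvexOn (-om) K F := by
    intro x hx y hy s h0 h1
    have h2 := hconv x hx y hy s h0 h1
    have h3 : 0 ≤ s * (1 - s) * ‖x - y‖ ^ 2 :=
      mul_nonneg (mul_nonneg h0 (by linarith)) (sq_nonneg _)
    have h4 := mul_le_mul_of_nonneg_right hlam h3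
    nlinarith
  have hF : Continuous F := continuous_iff_continuousAt.2
    fun x => (hgrad x).hasFDerivAt.continuousAt
  set S := tmax + 1 with hS
  have hS0 : 0 ≤ S := by linarith
  set τ : ℝ := 1 / (6 * (om + 1)) with hτdef
  have hτ : 0 < τ := by positivity
  have hτo : τ * om ≤ 1 / 6 := by
    rw [hτdef, one_div_mul_eq_div, div_le_iff₀ (by positivity)]; linarith
  obtain ⟨L, X, T, hL, hT0, hXK, hX, vX, hT⟩ := exists_limit hKne hKcl hKconv hbdd hF hom hc hT₀
    (hgrad T₀) hS0 hτ hτo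
  have hTK : ∀ t, 0 ≤ t → t ≤ S → T t ∈ K := fun t h0 h1 =>
    hKcl.mem_of_tendsto (hT t h0 h1) (Filter.Eventually.of_forall fun k => hXK k _)
  have hlim := fun a b (ha : 0 ≤ a) (hab : a ≤ b) (hb : b ≤ S) =>
    limit_AB hom hτ hL hX vX hT ha hab hb (hTK a ha (hab.trans hb))
  have hsubG : ∀ p ∈ K, ∀ x ∈ K, F p - F x ≤ ‖F' p‖ * ‖x - p‖ + om / 2 * ‖x - p‖ ^ 2 := by
    intro p hp x hx
    have h1 := subgrad (hgrad p) hc hp hx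
    have h2 := (neg_le_abs _).trans (abs_real_inner_le_norm (F' p) (x - p))
    linarith
  have hWex : ∀ p, ∃ w, p ∈ K → (IsProjOn (tanCone K p) (-(F' p)) w ∧
      inner ℝ (-(F' p)) w = ‖w‖ ^ 2 ∧
      ∀ x ∈ K, inner ℝ (-(F' p)) (x - p) ≤ inner ℝ w (x - p)) := by
    intro p
    by_cases hp : p ∈ K
    · obtain ⟨w, hw⟩ := exists_proj hKconv hp (-(F' p))
      exact ⟨w, fun _ => hw⟩
    · exact ⟨0, fun h => absurd h hp⟩
  choose W hW using hWex
  have hsubW : ∀ p ∈ K, ∀ x ∈ K, F p - F x ≤ ‖W p‖ * ‖x - p‖ + om / 2 * ‖x - p‖ ^ 2 := by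
    intro p hp x hx
    have h1 := subgrad (hgrad p) hc hp hx
    have h2 := (hW p hp).2.2 x hx
    have h3 := real_inner_le_norm (W p) (x - p)
    rw [inner_neg_left] at h2
    linarith
  -- globally continuous extension
  set E : ℝ → H := fun t => T (max 0 (min t S)) with hE
  have hET : ∀ t, 0 ≤ t → t ≤ S → E t = T t := by
    intro t h0 h1
    simp only [hE]
    rw [min_eq_left h1, max_eq_right h0]
  have hlip : LipschitzWith ⟨L, hL⟩ E := by
    refine LipschitzWith.of_dist_le_mul (fun x y => ?_)
    wlog hxy : x ≤ y generalizing x y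
    · rw [dist_comm, dist_comm x y]; exact this y x (by linarith)
    have hm : max 0 (min x S) ≤ max 0 (min y S) := max_le_max le_rfl (min_le_min hxy le_rfl)
    have h1 := (hlim _ _ (le_max_left _ _) hm (max_le hS0 (min_le_right _ _))).1
    have h2 : max 0 (min y S) - max 0 (min x S) ≤ y - x := by
      rcases le_total y S with h | h <;> rcases le_total x S with h' | h' <;>
      simp only [h, h', min_eq_left, min_eq_right] <;>
      rcases le_total 0 x with h3 | h3 <;> rcases le_total 0 y with h4 | h4 <;>
      simp only [h3, h4, hS0, max_eq_left, max_eq_right] <;> linarith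
    rw [dist_comm, dist_comm x y, dist_eq_norm, Real.dist_eq, abs_of_nonneg (by linarith)]
    change ‖T (max 0 (min y S)) - T (max 0 (min x S))‖ ≤ L * (y - x)
    nlinarith
  have hder : ∀ t, 0 ≤ t → t ≤ tmax → HasDerivWithinAt E (W (E t)) (Set.Ioi t) t := by
    intro t h0 h1
    have htS : t ≤ S := by linarith
    have hEt := hET t h0 htS
    have hp : E t ∈ K := by rw [hEt]; exact hTK t h0 htS
    have hp' := hW _ hp
    have key : ∀ s ∈ Set.Ioo t S, E s = T s := fun s hs => hET s (h0.trans hs.1.le) hs.2.le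
    refine right_deriv (om := om) (L := L) (b := S) hKconv (by linarith) hp (hgrad (E t)) hp'.1.1
      hp'.2.1 ?_ ?_ ?_
    · intro s hs
      rw [key s hs, hEt]
      exact (hlim t s h0 hs.1.le hs.2.le).1
    · intro s hs
      have := (hlim t s h0 hs.1.le hs.2.le).2.1 ‖W (T t)‖ (norm_nonneg _)
        (hsubW _ (hTK t h0 htS))
      rwa [key s hs, hEt]
    · intro s hs v hv
      have := (hlim t s h0 hs.1.le hs.2.le).2.2 ‖F' (T t)‖ (norm_nonneg _) v hv
        (hsubG _ (hTK t h0 htS))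
      rwa [key s hs, hEt]
  have hDn : ∀ t, 0 ≤ t → t ≤ tmax → Filter.Tendsto
      (fun n : ℕ => ((n : ℝ) + 1) • (E (t + 1 / ((n : ℝ) + 1)) - E t)) Filter.atTop
      (nhds (W (E t))) := by
    intro t h0 h1
    have h2 := (hasDerivWithinAt_iff_tendsto_slope' (by simp)).1 (hder t h0 h1)
    have h3 : Filter.Tendsto (fun n : ℕ => t + 1 / ((n : ℝ) + 1)) Filter.atTop
        (nhdsWithin t (Set.Ioi t)) := by
      refine tendsto_nhdsWithin_iff.2 ⟨?_, Filter.Eventually.of_forall fun n => ?_⟩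
      · simpa using (tendsto_one_div_add_atTop_nhds_zero_nat (𝕜 := ℝ)).const_add t
      · have : 0 < 1 / ((n : ℝ) + 1) := by positivity
        simp only [Set.mem_Ioi]; linarith
    refine (h2.comp h3).congr (fun n => ?_)
    simp [slope_def_module]
  have hWL : ∀ t, 0 ≤ t → t ≤ tmax → ‖W (E t)‖ ≤ L := by
    intro t h0 h1
    refine le_of_tendsto (hDn t h0 h1).norm (Filter.Eventually.of_forall fun n => ?_)
    have h2 := hlip.dist_le_mul (t + 1 / ((n : ℝ) + 1)) t
    rw [dist_eq_norm, Real.dist_eq, add_sub_cancel_left, abs_of_pos (by positivity)] at h2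
    have h3 : (0 : ℝ) < (n : ℝ) + 1 := by positivity
    rw [norm_smul, Real.norm_of_nonneg h3.le]
    have h4 := mul_le_mul_of_nonneg_left h2 h3.le
    refine h4.trans (le_of_eq ?_)
    change ((n : ℝ) + 1) * (L * (1 / ((n : ℝ) + 1))) = L
    field_simp
  have hint : IntegrableOn (fun t => W (E t)) (Set.Icc 0 tmax) volume := by
    have : IsFiniteMeasure (volume.restrict (Set.Icc 0 tmax)) := ⟨by simp⟩
    refine Integrable.of_bound ?_ L ?_
    · refine aestronglyMeasurable_of_tendsto_ae Filter.atTop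
        (f := fun (n : ℕ) t => ((n : ℝ) + 1) • (E (t + 1 / ((n : ℝ) + 1)) - E t)) (fun n => ?_) ?_
      · have := hlip.continuous
        exact Continuous.aestronglyMeasurable (by fun_prop)
      · filter_upwards [ae_restrict_mem measurableSet_Icc] with t ht using hDn t ht.1 ht.2
    · filter_upwards [ae_restrict_mem measurableSet_Icc] with t ht using hWL t ht.1 ht.2
  have hii : ∀ a b : ℝ, 0 ≤ a → a ≤ b → b ≤ tmax →
      IntervalIntegrable (fun t => W (E t)) volume a b := by
    intro a b ha hab hb
    rw [intervalIntegrable_iff_integrableOn_Icc_of_le hab]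
    exact hint.mono_set (Set.Icc_subset_Icc ha hb)
  have hftc : ∀ a b : ℝ, 0 ≤ a → a ≤ b → b ≤ tmax → E b - E a = ∫ t in a..b, W (E t) := by
    intro a b ha hab hb
    symm
    refine intervalIntegral.integral_eq_sub_of_hasDeriv_right_of_le hab hlip.continuous.continuousOn
      (fun t ht => hder t (ha.trans ht.1.le) (ht.2.le.trans hb)) (hii a b ha hab hb)
  refine ⟨E, fun t => W (E t), ?_, ?_, hii 0 tmax le_rfl htmax.le le_rfl, hftc, ?_⟩
  · rw [hET 0 le_rfl hS0, hT0]
  · intro t ht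
    have : t ≤ S := by linarith [ht.2]
    rw [hET t ht.1 this]; exact hTK t ht.1 this
  · have hae := (hii 0 tmax le_rfl htmax.le le_rfl).ae_hasDerivAt_integral
    rw [ae_restrict_iff' measurableSet_Ioo]
    filter_upwards [hae] with t ht hmem
    have htS : t ≤ S := by linarith [hmem.2]
    refine ⟨?_, ?_⟩
    · have h1 := ht (by rw [Set.uIcc_of_le htmax.le]; exact ⟨hmem.1.le, hmem.2.le⟩) 0
        (by rw [Set.uIcc_of_le htmax.le]; exact ⟨le_rfl, htmax.le⟩)
      have h2 := h1.const_add (E 0)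
      refine h2.congr_of_eventuallyEq ?_
      filter_upwards [Ioo_mem_nhds hmem.1 hmem.2] with s hs
      rw [← hftc 0 s le_rfl hs.1.le hs.2.le]; abel
    · refine (hW _ ?_).1
      rw [hET t hmem.1.le htS]; exact hTK t hmem.1.le htS
end

section
/- Let K ⊆ H be a nonempty closed convex set and let F : H → ℝ be bounded from below, lower semicontinuous (for the norm topology), Fréchet differentiable with gradient ∇F, and λ-convex on K for some λ ∈ ℝ. Let T₀ ∈ K. For every τ > 0 with 1/τ + λ > 0, define the proximal iterates T₀^τ := T₀ and, for k ≥ 0, T_{k+1}^τ := the unique minimizer over K of T ↦ F(T) + ‖T − T_k^τ‖²/(2τ); let T̂_τ : (0,∞) → H be the piecewise constant interpolation T̂_τ(t) := T_k^τ for t ∈ ((k−1)τ, kτ]. Then for every t_max > 0 there exist a sequence τ_j → 0 and a locally absolutely continuous curve T : [0, t_max] → K with T(0) = T₀, satisfying T'(t) = proj_{Tan_{T(t)} K}(−∇F(T(t))) for a.e. t ∈ (0, t_max), such that T̂_{τ_j}(t) → T(t) in H as j → ∞ for almost every t ∈ [0, t_max]. -/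
open MeasureTheory Filter
open scoped RealInnerProductSpace

variable {H : Type*} [NormedAddCommGroup H] [InnerProductSpace ℝ H] [CompleteSpace H]

open scoped NNReal Topology

/-- Lipschitz curves in a separable Hilbert space are integrals of bounded functions. -/
theorem lipschitz_deriv_sep {E : Type*} [NormedAddCommGroup E] [InnerProductSpace ℝ E]
    [CompleteSpace E] [TopologicalSpace.SeparableSpace E] (f : ℝ → E) (C : ℝ≥0)
    (hf : LipschitzWith C f) :
    ∃ f' : ℝ → E, AEStronglyMeasurable f' volume ∧ (∀ᵐ t, ‖f' t‖ ≤ C) ∧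
      ∀ a b : ℝ, f b - f a = ∫ t in a..b, f' t := by
  classical
  obtain ⟨w, b, hb⟩ := exists_hilbertBasis ℝ E
  have hon := b.orthonormal
  have hdisc : DiscreteTopology w := by
    refine DiscreteTopology.of_forall_le_dist (r := 1) one_pos ?_
    intro x y hxy
    have h1 : ‖b x‖ = 1 := hon.1 x
    have h2 : ‖b y‖ = 1 := hon.1 y
    have h3 : inner ℝ (b x) (b y) = 0 := hon.2 hxy
    have h4 : dist x y = ‖b x - b y‖ := by
      rw [hb, Subtype.dist_eq, dist_eq_norm]
    have h5 : ‖b x - b y‖ ^ 2 = 2 := by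
      rw [norm_sub_sq_real, h1, h2, h3]; norm_num
    rw [h4]
    nlinarith [norm_nonneg (b x - b y)]
  have hsc : SecondCountableTopology E := UniformSpace.secondCountable_of_separable E
  have hcount : Countable w := by
    rw [← TopologicalSpace.separableSpace_iff_countable (α := w)]
    infer_instance
  set g : w → ℝ → ℝ := fun i t => inner ℝ (b i) (f t) with hg
  have hglip : ∀ i, LipschitzWith C (g i) := by
    intro i
    refine LipschitzWith.of_dist_le_mul fun x y => ?_
    rw [Real.dist_eq, hg]
    simp only
    rw [← inner_sub_right]
    refine (abs_real_inner_le_norm _ _).trans ?_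
    rw [hon.1 i, one_mul, ← dist_eq_norm]
    exact hf.dist_le_mul x y
  have hae : ∀ᵐ t : ℝ, ∀ i, DifferentiableAt ℝ (g i) t :=
    ae_all_iff.2 fun i => (hglip i).ae_differentiableAt_real
  have hbound : ∀ᵐ t : ℝ, ∀ s : Finset w, ∑ i ∈ s, ‖deriv (g i) t‖ ^ 2 ≤ (C : ℝ) ^ 2 := by
    filter_upwards [hae] with t ht s
    have htend : Tendsto (fun u => ∑ i ∈ s, ‖slope (g i) t u‖ ^ 2) (𝓝[≠] t)
        (𝓝 (∑ i ∈ s, ‖deriv (g i) t‖ ^ 2)) := by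
      refine tendsto_finsetSum _ fun i _ => ?_
      exact ((hasDerivAt_iff_tendsto_slope.1 (ht i).hasDerivAt).norm).pow 2
    refine le_of_tendsto htend ?_
    filter_upwards [self_mem_nhdsWithin] with u hu
    have h1 : ∀ i, slope (g i) t u = inner ℝ (b i) (slope f t u) := by
      intro i
      simp [slope_def_field, slope_def_module, hg, inner_smul_right, inner_sub_right, div_eq_inv_mul]
    simp_rw [h1]
    refine (hon.sum_inner_products_le (slope f t u)).trans ?_
    have hne : 0 < |u - t| := abs_pos.2 (sub_ne_zero.2 hu)
    have : ‖slope f t u‖ ≤ C := by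
      rw [slope_def_module, norm_smul, norm_inv, Real.norm_eq_abs, inv_mul_le_iff₀ hne, mul_comm]
      have := hf.dist_le_mul u t
      rwa [dist_eq_norm, Real.dist_eq] at this
    gcongr
  set f' : ℝ → E := fun t =>
    if h : Memℓp (fun i : w => deriv (g i) t) 2 then b.repr.symm ⟨_, h⟩ else 0 with hf'
  have hmem : ∀ᵐ t : ℝ, Memℓp (fun i : w => deriv (g i) t) 2 := by
    filter_upwards [hbound] with t ht
    refine memℓp_gen' (C := (C : ℝ) ^ 2) fun s => ?_
    simpa using ht s
  have hsum : ∀ᵐ t : ℝ, HasSum (fun i => deriv (g i) t • b i) (f' t) := by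
    filter_upwards [hmem] with t ht
    simp only [hf', dif_pos ht]
    exact b.hasSum_repr_symm ⟨_, ht⟩
  have hinner : ∀ᵐ t : ℝ, ∀ i, inner ℝ (b i) (f' t) = deriv (g i) t := by
    filter_upwards [hmem] with t ht i
    simp only [hf', dif_pos ht]
    rw [← b.repr_apply_apply, LinearIsometryEquiv.apply_symm_apply]
  have hnorm : ∀ᵐ t : ℝ, ‖f' t‖ ≤ C := by
    filter_upwards [hmem, hbound] with t ht htb
    simp only [hf', dif_pos ht]
    rw [LinearIsometryEquiv.norm_map]
    refine lp.norm_le_of_forall_sum_le (by simp) C.2 fun s => ?_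
    simpa using htb s
  have hmeas : AEStronglyMeasurable f' volume := by
    refine aestronglyMeasurable_of_tendsto_ae (u := (atTop : Filter (Finset w)))
      (f := fun s t => ∑ i ∈ s, deriv (g i) t • b i) ?_ hsum
    intro s
    refine Finset.aestronglyMeasurable_fun_sum s fun i _ => ?_
    exact (measurable_deriv (g i)).aestronglyMeasurable.smul_const _
  refine ⟨f', hmeas, hnorm, fun x y => ?_⟩
  have hint : IntervalIntegrable f' volume x y := by
    refine (intervalIntegrable_const (c := (C : ℝ))).mono_fun hmeas.restrict ?_
    refine ae_restrict_of_ae ?_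
    filter_upwards [hnorm] with t ht
    simpa using ht
  apply b.repr.injective
  ext i
  rw [b.repr_apply_apply, b.repr_apply_apply]
  have h1 := (innerSL ℝ (b i)).intervalIntegral_comp_comm hint
  simp only [innerSL_apply_apply] at h1
  rw [← h1, inner_sub_right]
  have h2 : ∫ t in x..y, deriv (g i) t = g i y - g i x :=
    ((hglip i).lipschitzOnWith (s := Set.uIcc x y)).absolutelyContinuousOnInterval.integral_deriv_eq_sub
  rw [← h2]
  refine intervalIntegral.integral_congr_ae ?_
  filter_upwards [hinner] with t ht _
  exact (ht i).symm

/-- Lipschitz curves in a Hilbert space are integrals of bounded functions. -/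
theorem lipschitz_deriv_hilbert (f : ℝ → H) (C : ℝ≥0) (hf : LipschitzWith C f) :
    ∃ f' : ℝ → H, (∀ a b : ℝ, IntervalIntegrable f' volume a b) ∧
      (∀ a b : ℝ, f b - f a = ∫ t in a..b, f' t) ∧ ∀ᵐ t, HasDerivAt f (f' t) t := by
  classical
  set S : Submodule ℝ H := (Submodule.span ℝ (Set.range f)).topologicalClosure with hS
  have hsep : TopologicalSpace.IsSeparable (S : Set H) := by
    rw [hS, Submodule.topologicalClosure_coe, TopologicalSpace.isSeparable_closure]
    exact (TopologicalSpace.isSeparable_range hf.continuous).span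
  have : TopologicalSpace.SeparableSpace S := hsep.separableSpace
  have : CompleteSpace S :=
    (Submodule.isClosed_topologicalClosure _).completeSpace_coe
  have hmem : ∀ t, f t ∈ S := fun t =>
    Submodule.le_topologicalClosure _ (Submodule.subset_span ⟨t, rfl⟩)
  set fS : ℝ → S := fun t => ⟨f t, hmem t⟩
  have hfS : LipschitzWith C fS := fun x y => hf x y
  obtain ⟨g, hgm, hgb, hgi⟩ := lipschitz_deriv_sep fS C hfS
  have hii : ∀ a b : ℝ, IntervalIntegrable g volume a b := by
    intro a b
    refine (intervalIntegrable_const (c := (C : ℝ))).mono_fun hgm.restrict ?_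
    refine ae_restrict_of_ae ?_
    filter_upwards [hgb] with t ht
    simpa using ht
  have h1 : ∀ a b : ℝ, IntervalIntegrable (fun t => (g t : H)) volume a b := fun a b =>
    ⟨S.subtypeL.integrable_comp (hii a b).1, S.subtypeL.integrable_comp (hii a b).2⟩
  have h2 : ∀ a b : ℝ, f b - f a = ∫ t in a..b, (g t : H) := by
    intro a b
    have := S.subtypeL.intervalIntegral_comp_comm (hii a b)
    rw [← hgi] at this
    simpa [fS] using this.symm
  refine ⟨fun t => (g t : H), h1, h2, ?_⟩
  have hloc : LocallyIntegrable (fun t => (g t : H)) volume := by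
    rw [locallyIntegrable_iff]
    intro k hk
    obtain ⟨r, hr⟩ := hk.isBounded.subset_closedBall 0
    rw [Real.closedBall_eq_Icc] at hr
    refine IntegrableOn.mono_set ?_ hr
    by_cases hle : (0 - r) ≤ 0 + r
    · exact (intervalIntegrable_iff_integrableOn_Icc_of_le hle).1 (h1 _ _)
    · rw [Set.Icc_eq_empty hle]; exact integrableOn_empty
  filter_upwards [LocallyIntegrable.ae_hasDerivAt_integral hloc] with t ht
  have := (ht 0).const_add (f 0)
  refine this.congr_of_eventuallyEq (Eventually.of_forall fun u => ?_)
  simp only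
  rw [← h2]; abel

theorem deriv_nonneg_of_right_min {φ : ℝ → ℝ} {d : ℝ} (h : HasDerivAt φ d 0)
    (hmin : ∀ᶠ s in 𝓝[>] (0 : ℝ), φ 0 ≤ φ s) : 0 ≤ d := by
  have h1 := h.tendsto_slope_zero_right
  refine ge_of_tendsto h1 ?_
  filter_upwards [hmin, self_mem_nhdsWithin] with s hs hs0
  have hs0' : (0 : ℝ) < s := hs0
  rw [zero_add, smul_eq_mul]
  exact mul_nonneg (inv_nonneg.2 hs0'.le) (sub_nonneg.2 hs)

theorem hasDerivAt_line {F : H → ℝ} {g x : H} (h : HasGradientAt F g x) (v : H) :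
    HasDerivAt (fun s : ℝ => F (x + s • v)) ⟪g, v⟫ 0 := by
  have h1 : HasDerivAt (fun s : ℝ => x + s • v) v 0 := by
    simpa using ((hasDerivAt_id (0 : ℝ)).smul_const v).const_add x
  have h2 : HasFDerivAt F (InnerProductSpace.toDual ℝ H g) (x + (0 : ℝ) • v) := by
    simpa using h.hasFDerivAt
  have h3 := h2.comp_hasDerivAt (0 : ℝ) h1
  rw [InnerProductSpace.toDual_apply_apply] at h3
  exact h3

theorem eventually_mem_Ioc : ∀ᶠ s in 𝓝[>] (0 : ℝ), 0 < s ∧ s ≤ 1 := by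
  have : Set.Ioc (0 : ℝ) 1 ∈ 𝓝[>] (0 : ℝ) := Ioc_mem_nhdsGT one_pos
  filter_upwards [this] with s hs using hs

theorem grad_ineq {K : Set H} {F : H → ℝ} {F' : H → H} {lam : ℝ}
    (hgrad : ∀ x : H, HasGradientAt F (F' x) x) (hconv : LambdaConvexOn lam K F)
    {p U : H} (hp : p ∈ K) (hU : U ∈ K) :
    ⟪F' p, U - p⟫ ≤ F U - F p + |lam| / 2 * ‖U - p‖ ^ 2 := by
  have h1 := hasDerivAt_line (hgrad p) (U - p)
  have h2 : HasDerivAt (fun s : ℝ => s * (F U - F p + |lam| / 2 * ‖U - p‖ ^ 2)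
      - F (p + s • (U - p))) (1 * (F U - F p + |lam| / 2 * ‖U - p‖ ^ 2) - ⟪F' p, U - p⟫) 0 :=
    ((hasDerivAt_id (0 : ℝ)).mul_const _).sub h1
  have h3 := deriv_nonneg_of_right_min h2 ?_
  · linarith
  filter_upwards [eventually_mem_Ioc] with s hs
  have h4 := hconv p hp U hU s hs.1.le hs.2
  have h5 : (1 - s) • p + s • U = p + s • (U - p) := by
    rw [smul_sub, sub_smul, one_smul]; abel
  rw [h5, norm_sub_rev p U] at h4
  have h6 : -lam / 2 * s * (1 - s) * ‖U - p‖ ^ 2 ≤ |lam| / 2 * s * ‖U - p‖ ^ 2 := by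
    have ha : -lam ≤ |lam| := neg_le_abs lam
    have hb : -lam * (1 - s) ≤ |lam| := by
      nlinarith [abs_nonneg lam, mul_nonneg (sub_nonneg.2 ha) (sub_nonneg.2 hs.2), hs.1]
    have hc : 0 ≤ s / 2 * ‖U - p‖ ^ 2 := by have := hs.1; positivity
    nlinarith [mul_le_mul_of_nonneg_right hb hc]
  simp only [zero_mul, zero_smul, add_zero, zero_sub]
  nlinarith

theorem grad_mono {K : Set H} {F : H → ℝ} {F' : H → H} {lam : ℝ}
    (hgrad : ∀ x : H, HasGradientAt F (F' x) x) (hconv : LambdaConvexOn lam K F)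
    {p q : H} (hp : p ∈ K) (hq : q ∈ K) :
    -|lam| * ‖p - q‖ ^ 2 ≤ ⟪F' p - F' q, p - q⟫ := by
  have h1 := grad_ineq hgrad hconv hp hq
  have h2 := grad_ineq hgrad hconv hq hp
  rw [← neg_sub p q, inner_neg_right, norm_neg] at h1
  rw [inner_sub_left]
  linarith

theorem prox_vi {K : Set H} (hKconv : Convex ℝ K) {F : H → ℝ} {F' : H → H}
    (hgrad : ∀ x : H, HasGradientAt F (F' x) x) {τ : ℝ} (hτ : 0 < τ) {p q : H} (hp : p ∈ K)
    (hmin : ∀ U ∈ K, F p + ‖p - q‖ ^ 2 / (2 * τ) ≤ F U + ‖U - q‖ ^ 2 / (2 * τ))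
    {U : H} (hU : U ∈ K) : 0 ≤ ⟪τ • F' p + (p - q), U - p⟫ := by
  have h1 := hasDerivAt_line (hgrad p) (U - p)
  have h2 : HasDerivAt (fun s : ℝ => τ * F (p + s • (U - p)) +
      (s * ⟪p - q, U - p⟫ + s ^ 2 * (‖U - p‖ ^ 2 / 2)))
      (τ * ⟪F' p, U - p⟫ + (1 * ⟪p - q, U - p⟫ + ((2 : ℕ) * (0 : ℝ) ^ (2 - 1)) * (‖U - p‖ ^ 2 / 2))) 0 :=
    (h1.const_mul τ).add (((hasDerivAt_id (0 : ℝ)).mul_const _).add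
      ((hasDerivAt_pow 2 (0 : ℝ)).mul_const _))
  have h3 := deriv_nonneg_of_right_min h2 ?_
  · rw [inner_add_left, real_inner_smul_left]
    simpa using h3
  filter_upwards [eventually_mem_Ioc] with s hs
  have hmem : p + s • (U - p) ∈ K := hKconv.add_smul_sub_mem hp hU ⟨hs.1.le, hs.2⟩
  have h4 := hmin _ hmem
  have h5 : p + s • (U - p) - q = (p - q) + s • (U - p) := by abel
  have h6 : ‖p + s • (U - p) - q‖ ^ 2 = ‖p - q‖ ^ 2 + 2 * (s * ⟪p - q, U - p⟫)
      + s ^ 2 * ‖U - p‖ ^ 2 := by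
    rw [h5, norm_add_sq_real, real_inner_smul_right, norm_smul, mul_pow, Real.norm_eq_abs, sq_abs]
  rw [h6] at h4
  have h7 := mul_le_mul_of_nonneg_left h4 hτ.le
  have e1 : τ * (F p + ‖p - q‖ ^ 2 / (2 * τ)) = τ * F p + ‖p - q‖ ^ 2 / 2 := by
    field_simp
  have e2 : τ * (F (p + s • (U - p)) + (‖p - q‖ ^ 2 + 2 * (s * ⟪p - q, U - p⟫)
      + s ^ 2 * ‖U - p‖ ^ 2) / (2 * τ)) = τ * F (p + s • (U - p)) + (‖p - q‖ ^ 2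
      + 2 * (s * ⟪p - q, U - p⟫) + s ^ 2 * ‖U - p‖ ^ 2) / 2 := by
    field_simp
  rw [e1, e2] at h7
  simp only [zero_mul, zero_smul, add_zero, ne_eq, OfNat.ofNat_ne_zero, not_false_eq_true, zero_pow]
  linarith

theorem vi_pair {K : Set H} {F' : H → H} {m h : ℝ} (hh : 0 ≤ h)
    (hmono : ∀ p ∈ K, ∀ q ∈ K, -m * ‖p - q‖ ^ 2 ≤ ⟪F' p - F' q, p - q⟫)
    {p q A B : H} (hp : p ∈ K) (hq : q ∈ K)
    (h1 : 0 ≤ ⟪h • F' p + A, q - p⟫) (h2 : 0 ≤ ⟪h • F' q + B, p - q⟫) :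
    ⟪A - B, p - q⟫ ≤ h * m * ‖p - q‖ ^ 2 := by
  have h3 := mul_le_mul_of_nonneg_left (hmono p hp q hq) hh
  rw [← neg_sub p q, inner_neg_right, inner_add_left, real_inner_smul_left] at h1
  rw [inner_add_left, real_inner_smul_left] at h2
  rw [inner_sub_left] at h3 ⊢
  linarith

theorem exp_absorb {x z c : ℝ} (hx0 : 0 ≤ x) (hx : x ≤ 1 / 2) (hc : 0 ≤ c)
    (h : z * (1 - x) ≤ c) : z ≤ Real.exp (2 * x) * c := by
  have h1 : 1 + 2 * x ≤ Real.exp (2 * x) := by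
    have := Real.add_one_le_exp (2 * x); linarith
  have h2 : z ≤ (1 + 2 * x) * c := by
    have hz : z ≤ c / (1 - x) := by rw [le_div_iff₀ (by linarith)]; exact h
    refine hz.trans ?_
    rw [div_le_iff₀ (by linarith)]
    nlinarith [mul_nonneg hc (mul_nonneg hx0 (by linarith : 0 ≤ 1 - 2 * x))]
  exact h2.trans (mul_le_mul_of_nonneg_right h1 hc)

theorem vel_step {d m h c : ℝ} {A B : H} (hd : d = ‖A‖) (hm : 0 ≤ h * m) (hmh : h * m ≤ 1 / 2)
    (hB : ‖B‖ ≤ c) (h1 : ⟪A - B, A⟫ ≤ h * m * ‖A‖ ^ 2) :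
    d ≤ Real.exp (2 * (h * m)) * c := by
  have hc : 0 ≤ c := (norm_nonneg B).trans hB
  refine exp_absorb hm hmh hc ?_
  rw [inner_sub_left, real_inner_self_eq_norm_sq, ← hd] at h1
  have h2 : ⟪B, A⟫ ≤ c * d := by
    refine (real_inner_le_norm B A).trans ?_
    rw [← hd]
    exact mul_le_mul_of_nonneg_right hB (hd ▸ norm_nonneg A)
  have hd0 : 0 ≤ d := hd ▸ norm_nonneg A
  rcases hd0.eq_or_lt with h0 | h0
  · rw [← h0]; simpa using hc
  · refine le_of_mul_le_mul_right ?_ h0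
    nlinarith

theorem vel_bound {K : Set H} {F' : H → H} {m τ : ℝ} (hm : 0 ≤ m) (hτ : 0 < τ)
    (hmτ : τ * m ≤ 1 / 2)
    (hmono : ∀ p ∈ K, ∀ q ∈ K, -m * ‖p - q‖ ^ 2 ≤ ⟪F' p - F' q, p - q⟫)
    {x : ℕ → H} (hxK : ∀ k, x k ∈ K)
    (hvi : ∀ k, ∀ U ∈ K, 0 ≤ ⟪τ • F' (x (k + 1)) + (x (k + 1) - x k), U - x (k + 1)⟫) (k : ℕ) :
    ‖x (k + 1) - x k‖ ≤ Real.exp (2 * (τ * m)) ^ (k + 1) * (τ * ‖F' (x 0)‖) := by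
  have hp : 0 ≤ τ * m := by positivity
  induction k with
  | zero =>
    rw [zero_add, pow_one]
    refine vel_step (B := -(τ • F' (x 0))) rfl hp hmτ ?_ ?_
    · rw [norm_neg, norm_smul, Real.norm_eq_abs, abs_of_pos hτ]
    · refine vi_pair hτ.le hmono (hxK 1) (hxK 0) (hvi 0 _ (hxK 0)) ?_
      simp
  | succ k ih =>
    rw [pow_succ', mul_assoc]
    refine vel_step rfl hp hmτ ih ?_
    exact vi_pair hτ.le hmono (hxK _) (hxK _) (hvi (k + 1) _ (hxK _)) (hvi k _ (hxK _))

theorem compare_step {K : Set H} {F' : H → H} {m h L : ℝ} (hm : 0 ≤ m) (hh : 0 < h) (hL : 0 ≤ L)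
    (hmh : 6 * (h * m) ≤ 1 / 2)
    (hmono : ∀ p ∈ K, ∀ q ∈ K, -m * ‖p - q‖ ^ 2 ≤ ⟪F' p - F' q, p - q⟫)
    {x0 x1 y0 y1 y2 : H} (hx1 : x1 ∈ K) (hy1 : y1 ∈ K) (hy2 : y2 ∈ K)
    (hvx : ∀ U ∈ K, 0 ≤ ⟪(2 * h) • F' x1 + (x1 - x0), U - x1⟫)
    (hvy1 : ∀ U ∈ K, 0 ≤ ⟪h • F' y1 + (y1 - y0), U - y1⟫)
    (hvy2 : ∀ U ∈ K, 0 ≤ ⟪h • F' y2 + (y2 - y1), U - y2⟫)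
    (hV : ‖x1 - x0‖ ≤ 2 * h * L) (hW1 : ‖y1 - y0‖ ≤ h * L) (hW2 : ‖y2 - y1‖ ≤ h * L) :
    ‖x1 - y2‖ ^ 2 ≤ Real.exp (12 * (h * m)) * (‖x0 - y0‖ ^ 2 + 8 * h ^ 2 * L ^ 2) := by
  have hhm : 0 ≤ h * m := by positivity
  have hvx' : ∀ U ∈ K, 0 ≤ ⟪h • F' x1 + (1 / 2 : ℝ) • (x1 - x0), U - x1⟫ := by
    intro U hU
    have := hvx U hU
    rw [inner_add_left, real_inner_smul_left] at this ⊢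
    rw [real_inner_smul_left]
    linarith
  have h1 := vi_pair hh.le hmono hx1 hy2 (hvx' _ hy2) (hvy2 _ hx1)
  have h2 := vi_pair hh.le hmono hx1 hy1 (hvx' _ hy1) (hvy1 _ hx1)
  set e := x1 - y2 with he
  set V := x1 - x0
  set W1 := y1 - y0
  set W2 := y2 - y1
  have e1 : x1 - y1 = e + W2 := by simp only [e, W2]; abel
  have e0 : x0 - y0 = e - (V - W1 - W2) := by simp only [e, V, W1, W2]; abel
  rw [e1, inner_add_right] at h2
  have h3 : ‖x0 - y0‖ ^ 2 = ‖e‖ ^ 2 - 2 * ⟪V - W1 - W2, e⟫ + ‖V - W1 - W2‖ ^ 2 := by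
    rw [e0, norm_sub_sq_real, real_inner_comm]
  have h4 : ⟪V - W1 - W2, e⟫ = ⟪(1 / 2 : ℝ) • V - W2, e⟫ + ⟪(1 / 2 : ℝ) • V - W1, e⟫ := by
    simp only [inner_sub_left, real_inner_smul_left]; ring
  have h5 : ‖e + W2‖ ^ 2 ≤ 2 * ‖e‖ ^ 2 + 2 * (h * L) ^ 2 := by
    have := parallelogram_law_with_norm ℝ e W2
    have h6 : ‖W2‖ ^ 2 ≤ (h * L) ^ 2 := by gcongr
    nlinarith [sq_nonneg ‖e - W2‖]
  have h7 : -⟪(1 / 2 : ℝ) • V - W1, W2⟫ ≤ 2 * (h * L) * (h * L) := by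
    have h8 : ‖(1 / 2 : ℝ) • V - W1‖ ≤ 2 * (h * L) := by
      refine (norm_sub_le _ _).trans ?_
      rw [norm_smul]
      norm_num
      linarith
    have h9 := (abs_le.1 (abs_real_inner_le_norm ((1 / 2 : ℝ) • V - W1) W2)).1
    have h10 : ‖(1 / 2 : ℝ) • V - W1‖ * ‖W2‖ ≤ 2 * (h * L) * (h * L) := by gcongr
    linarith
  have h11 : h * m * ‖e + W2‖ ^ 2 ≤ h * m * (2 * ‖e‖ ^ 2 + 2 * (h * L) ^ 2) := by gcongr
  have h12 : h * m * (2 * (h * L) ^ 2) ≤ (h * L) ^ 2 := by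
    nlinarith [sq_nonneg (h * L)]
  rw [show 12 * (h * m) = 2 * (6 * (h * m)) by ring]
  refine exp_absorb (by positivity) hmh (by positivity) ?_
  nlinarith [sq_nonneg ‖V - W1 - W2‖, sq_nonneg (h * L)]

theorem compare {K : Set H} {F' : H → H} {m h L : ℝ} (hm : 0 ≤ m) (hh : 0 < h) (hL : 0 ≤ L)
    (hmh : 6 * (h * m) ≤ 1 / 2)
    (hmono : ∀ p ∈ K, ∀ q ∈ K, -m * ‖p - q‖ ^ 2 ≤ ⟪F' p - F' q, p - q⟫)
    {x y : ℕ → H} (hxK : ∀ k, x k ∈ K) (hyK : ∀ k, y k ∈ K) (h0 : x 0 = y 0)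
    (hvx : ∀ k, ∀ U ∈ K, 0 ≤ ⟪(2 * h) • F' (x (k + 1)) + (x (k + 1) - x k), U - x (k + 1)⟫)
    (hvy : ∀ k, ∀ U ∈ K, 0 ≤ ⟪h • F' (y (k + 1)) + (y (k + 1) - y k), U - y (k + 1)⟫) (N : ℕ)
    (hV : ∀ k < N, ‖x (k + 1) - x k‖ ≤ 2 * h * L)
    (hW : ∀ k < 2 * N, ‖y (k + 1) - y k‖ ≤ h * L) :
    ∀ k ≤ N, ‖x k - y (2 * k)‖ ^ 2 ≤
      Real.exp (12 * (h * m)) ^ k * (k * (8 * h ^ 2 * L ^ 2)) := by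
  intro k
  induction k with
  | zero => intro _; simp [h0]
  | succ k ih =>
    intro hk
    have ih' := ih (by omega)
    have hst := compare_step hm hh hL hmh hmono (hxK (k + 1)) (hyK (2 * k + 1)) (hyK (2 * k + 2))
      (hvx k) (hvy (2 * k)) (hvy (2 * k + 1)) (hV k (by omega)) (hW (2 * k) (by omega))
      (hW (2 * k + 1) (by omega))
    rw [show 2 * (k + 1) = 2 * k + 2 by ring]
    refine hst.trans ?_
    rw [pow_succ' (Real.exp _), mul_assoc (Real.exp _)]
    refine mul_le_mul_of_nonneg_left ?_ (Real.exp_pos _).le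
    have h1 : 1 ≤ Real.exp (12 * (h * m)) ^ k :=
      one_le_pow₀ (Real.one_le_exp (by positivity))
    have h2 : 0 ≤ 8 * h ^ 2 * L ^ 2 := by positivity
    push_cast
    nlinarith

theorem ceil_bounds {t τ : ℝ} (ht : 0 ≤ t) (hτ : 0 < τ) :
    t ≤ (⌈t / τ⌉₊ : ℝ) * τ ∧ (⌈t / τ⌉₊ : ℝ) * τ ≤ t + τ := by
  constructor
  · have := Nat.le_ceil (t / τ)
    rwa [div_le_iff₀ hτ] at this
  · have := (Nat.ceil_lt_add_one (div_nonneg ht hτ.le)).le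
    have h2 := mul_le_mul_of_nonneg_right this hτ.le
    rwa [add_mul, div_mul_cancel₀ _ hτ.ne', one_mul] at h2

theorem ceil_tendsto {t : ℝ} (ht : 0 ≤ t) {τ : ℕ → ℝ} (hτ0 : ∀ j, 0 < τ j)
    (hτ : Tendsto τ atTop (𝓝 0)) : Tendsto (fun j => (⌈t / τ j⌉₊ : ℝ) * τ j) atTop (𝓝 t) := by
  refine tendsto_of_tendsto_of_tendsto_of_le_of_le tendsto_const_nhds
    (h := fun j => t + τ j) ?_ (fun j => (ceil_bounds ht (hτ0 j)).1)
    (fun j => (ceil_bounds ht (hτ0 j)).2)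
  simpa using hτ.const_add t

theorem limit_evi {g : H → ℝ} (hg : Continuous g) {U : H} {x : ℕ → ℕ → H} {τ : ℕ → ℝ}
    (hτ0 : ∀ j, 0 < τ j) (hτ1 : ∀ j, τ j ≤ 1) (hτ : Tendsto τ atTop (𝓝 0)) {L tmax : ℝ}
    (hL : 0 ≤ L)
    (hstep : ∀ j k, ‖x j (k + 1) - U‖ ^ 2 - ‖x j k - U‖ ^ 2 ≤ 2 * τ j * g (x j (k + 1)))
    (hdl : ∀ j k l : ℕ, k ≤ l → l * τ j ≤ tmax + 2 → ‖x j l - x j k‖ ≤ ((l : ℝ) - k) * τ j * L)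
    {T : ℝ → H} {t : ℝ} {v : H} (ht0 : 0 ≤ t) (htm : t < tmax)
    (hconv : ∀ s ∈ Set.Icc (0 : ℝ) tmax,
      Tendsto (fun j => x j ⌈s / τ j⌉₊) atTop (𝓝 (T s)))
    (hd : HasDerivAt T v t) : ⟪v, T t - U⟫ ≤ g (T t) := by
  refine le_of_forall_pos_le_add fun ε hε => ?_
  have h1 : HasDerivAt (fun s => T (t + s) - U) v 0 := by
    refine HasDerivAt.sub_const U ?_
    refine HasDerivAt.comp_const_add t 0 ?_
    simpa using hd
  have h2 : HasDerivAt (fun s => s * (2 * (g (T t) + ε)) - ‖T (t + s) - U‖ ^ 2)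
      (1 * (2 * (g (T t) + ε)) - 2 * ⟪T (t + 0) - U, v⟫) 0 :=
    ((hasDerivAt_id (0 : ℝ)).mul_const _).sub h1.norm_sq
  have h3 := deriv_nonneg_of_right_min h2 ?_
  · rw [add_zero, real_inner_comm] at h3
    linarith
  obtain ⟨r, hr, hrg⟩ := Metric.continuousAt_iff.1 (hg.continuousAt (x := T t)) ε hε
  have hL1 : 0 < L + 1 := by linarith
  have hmem : Set.Ioo (0 : ℝ) (min (tmax - t) (r / (4 * (L + 1)))) ∈ 𝓝[>] (0 : ℝ) :=
    Ioo_mem_nhdsGT (lt_min (by linarith) (by positivity))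
  filter_upwards [hmem] with s hs
  have hs0 := hs.1
  have hs1 : s < tmax - t := hs.2.trans_le (min_le_left _ _)
  have hs2 : s < r / (4 * (L + 1)) := hs.2.trans_le (min_le_right _ _)
  have hsr : L * s ≤ r / 4 := by
    rw [lt_div_iff₀ (by positivity)] at hs2
    nlinarith
  have hct := hconv t ⟨ht0, htm.le⟩
  have hcb := hconv (t + s) ⟨by linarith, by linarith⟩
  have hlim1 : Tendsto (fun j => ‖x j ⌈(t + s) / τ j⌉₊ - U‖ ^ 2 - ‖x j ⌈t / τ j⌉₊ - U‖ ^ 2) atTop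
      (𝓝 (‖T (t + s) - U‖ ^ 2 - ‖T t - U‖ ^ 2)) :=
    ((hcb.sub_const U).norm.pow 2).sub ((hct.sub_const U).norm.pow 2)
  have hlim2 : Tendsto (fun j => ((⌈(t + s) / τ j⌉₊ : ℝ) * τ j - (⌈t / τ j⌉₊ : ℝ) * τ j) *
      (2 * (g (T t) + ε))) atTop (𝓝 ((t + s - t) * (2 * (g (T t) + ε)))) :=
    ((ceil_tendsto (by linarith) hτ0 hτ).sub (ceil_tendsto ht0 hτ0 hτ)).mul_const _
  have hle : ‖T (t + s) - U‖ ^ 2 - ‖T t - U‖ ^ 2 ≤ (t + s - t) * (2 * (g (T t) + ε)) := by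
    refine le_of_tendsto_of_tendsto hlim1 hlim2 ?_
    have hev1 : ∀ᶠ j in atTop, dist (x j ⌈t / τ j⌉₊) (T t) < r / 4 :=
      (Metric.tendsto_nhds.1 hct) _ (by positivity)
    have hev2 : ∀ᶠ j in atTop, L * τ j < r / 4 := by
      have : Tendsto (fun j => L * τ j) atTop (𝓝 0) := by simpa using hτ.const_mul L
      exact this.eventually_lt_const (by positivity)
    filter_upwards [hev1, hev2] with j hj1 hj2
    have hτj := hτ0 j
    obtain ⟨ha1, ha2⟩ := ceil_bounds ht0 hτj
    obtain ⟨hb1, hb2⟩ := ceil_bounds (t := t + s) (by linarith) hτj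
    have hab : ⌈t / τ j⌉₊ ≤ ⌈(t + s) / τ j⌉₊ := by
      refine Nat.ceil_mono ?_
      gcongr; linarith
    generalize ⌈t / τ j⌉₊ = a at *
    generalize ⌈(t + s) / τ j⌉₊ = b at *
    have key : ∀ l, a ≤ l → l ≤ b → ‖x j l - U‖ ^ 2 - ‖x j a - U‖ ^ 2 ≤
        ((l : ℝ) * τ j - a * τ j) * (2 * (g (T t) + ε)) := by
      intro l hl
      induction l, hl using Nat.le_induction with
      | base => intro _; simp
      | succ k hk ih =>
        intro hkb
        have ih' := ih (by omega)
        have hkb' : ((k + 1 : ℕ) : ℝ) * τ j ≤ b * τ j := by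
          have : ((k + 1 : ℕ) : ℝ) ≤ b := by exact_mod_cast hkb
          gcongr
        have hd1 := hdl j a (k + 1) (by omega) (by linarith [hτ1 j])
        have hd2 : (((k + 1 : ℕ) : ℝ) - a) * τ j * L ≤ L * s + L * τ j := by
          have : (((k + 1 : ℕ) : ℝ) - a) * τ j ≤ s + τ j := by rw [sub_mul]; linarith
          nlinarith
        have hd3 : dist (x j (k + 1)) (T t) < r := by
          refine (dist_triangle _ (x j a) _).trans_lt ?_
          rw [dist_eq_norm (x j (k + 1))]
          linarith
        have hg1 := hrg hd3
        rw [Real.dist_eq] at hg1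
        have hg2 := (abs_lt.1 hg1).2
        have hst := hstep j k
        push_cast
        have : 2 * τ j * g (x j (k + 1)) ≤ 2 * τ j * (g (T t) + ε) := by
          gcongr; linarith
        linarith
    exact key b hab le_rfl
  simp only [zero_mul, add_zero, zero_sub]
  linarith

theorem flow_proj {K : Set H} (hKconv : Convex ℝ K) {F : H → ℝ} {F' : H → H}
    (hgrad : ∀ x : H, HasGradientAt F (F' x) x) {m : ℝ} {T : ℝ → H} (hTK : ∀ s, T s ∈ K)
    {t : ℝ} {v : H} (hd : HasDerivAt T v t)
    (hevi : ∀ U ∈ K, ⟪v, T t - U⟫ ≤ F U - F (T t) + m / 2 * ‖U - T t‖ ^ 2) :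
    IsProjOn (tanCone K (T t)) (-(F' (T t))) v := by
  have hvi : ∀ V ∈ K, 0 ≤ ⟪F' (T t) + v, V - T t⟫ := by
    intro V hV
    have h1 := hasDerivAt_line (hgrad (T t)) (V - T t)
    have h2 : HasDerivAt (fun s : ℝ => F (T t + s • (V - T t)) +
        (s * ⟪v, V - T t⟫ + s ^ 2 * (m / 2 * ‖V - T t‖ ^ 2)))
        (⟪F' (T t), V - T t⟫ + (1 * ⟪v, V - T t⟫ +
          ((2 : ℕ) * (0 : ℝ) ^ (2 - 1)) * (m / 2 * ‖V - T t‖ ^ 2))) 0 :=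
      h1.add (((hasDerivAt_id (0 : ℝ)).mul_const _).add
        ((hasDerivAt_pow 2 (0 : ℝ)).mul_const _))
    have h3 := deriv_nonneg_of_right_min h2 ?_
    · rw [inner_add_left]
      simpa using h3
    filter_upwards [eventually_mem_Ioc] with s hs
    have h4 := hevi _ (hKconv.add_smul_sub_mem (hTK t) hV ⟨hs.1.le, hs.2⟩)
    rw [sub_add_cancel_left, add_sub_cancel_left, inner_neg_right, real_inner_smul_right,
      norm_smul, mul_pow, Real.norm_eq_abs, sq_abs] at h4
    simp only [zero_mul, zero_smul, add_zero, ne_eq, OfNat.ofNat_ne_zero, not_false_eq_true,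
      zero_pow]
    linarith
  have hvT : v ∈ tanCone K (T t) := by
    have h1 := hd.tendsto_slope_zero_right
    refine mem_closure_of_tendsto h1 ?_
    filter_upwards [self_mem_nhdsWithin] with s hs
    have hs' : (0 : ℝ) < s := hs
    refine ⟨s, hs', ?_⟩
    rw [smul_inv_smul₀ hs'.ne', add_sub_cancel]
    exact hTK _
  have hpol : ∀ u ∈ tanCone K (T t), 0 ≤ ⟪F' (T t) + v, u⟫ := by
    intro u hu
    have hcl : IsClosed {u : H | 0 ≤ ⟪F' (T t) + v, u⟫} :=
      isClosed_le continuous_const (by fun_prop)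
    refine closure_minimal ?_ hcl hu
    rintro w ⟨s, hs, hw⟩
    have := hvi _ hw
    rw [add_sub_cancel_left, real_inner_smul_right] at this
    exact nonneg_of_mul_nonneg_right this hs
  have hneg : ⟪F' (T t) + v, v⟫ ≤ 0 := by
    have h1 := hd.tendsto_slope_zero_left
    have h2 : Tendsto (fun s : ℝ => ⟪F' (T t) + v, s⁻¹ • (T (t + s) - T t)⟫) (𝓝[<] 0)
        (𝓝 ⟪F' (T t) + v, v⟫) := tendsto_const_nhds.inner h1
    refine le_of_tendsto h2 ?_
    filter_upwards [self_mem_nhdsWithin] with s hs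
    have hs' : s < (0 : ℝ) := hs
    rw [real_inner_smul_right]
    exact mul_nonpos_of_nonpos_of_nonneg (inv_nonpos.2 hs'.le) (hvi _ (hTK _))
  refine ⟨hvT, fun u hu => ?_⟩
  have h1 := hpol u hu
  have h2 : ‖-(F' (T t)) - u‖ ^ 2 = ‖-(F' (T t)) - v‖ ^ 2
      + 2 * (⟪F' (T t) + v, u⟫ - ⟪F' (T t) + v, v⟫) + ‖v - u‖ ^ 2 := by
    have e : -(F' (T t)) - u = (-(F' (T t)) - v) + (v - u) := by abel
    rw [e, norm_add_sq_real, ← inner_sub_right]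
    have e2 : -(F' (T t)) - v = -(F' (T t) + v) := by abel
    have e3 : v - u = -(u - v) := by abel
    rw [e2, e3, inner_neg_neg]
  refine le_of_sq_le_sq ?_ (norm_nonneg _)
  nlinarith [sq_nonneg ‖v - u‖]

set_option maxHeartbeats 4000000

/-- Convergence of the proximal (minimizing movement) scheme to a solution of the constrained
gradient flow as the time step `τ → 0`. Here `Tseq τ k` denotes the `k`-th proximal iterate with
time step `τ` (starting at `T₀`), and the piecewise constant interpolation `t ↦ Tseq τ ⌈t/τ⌉₊`
converges, along a sequence `τ_j → 0`, at almost every `t ∈ [0, t_max]`, to a solution of the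
constrained gradient flow. -/
theorem prox_scheme_converges_to_flow (K : Set H) (hKne : K.Nonempty)
    (hKcl : IsClosed K) (hKconv : Convex ℝ K)
    (F : H → ℝ) (F' : H → H)
    (hbdd : BddBelow (Set.range F)) (hlsc : LowerSemicontinuous F)
    (hgrad : ∀ x : H, HasGradientAt F (F' x) x)
    (lam : ℝ) (hconv : LambdaConvexOn lam K F)
    (T₀ : H) (hT₀ : T₀ ∈ K)
    (Tseq : ℝ → ℕ → H) (hTseq0 : ∀ τ : ℝ, Tseq τ 0 = T₀)
    (hTseqStep : ∀ τ : ℝ, 0 < τ → 1 / τ + lam > 0 → ∀ k : ℕ,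
      Tseq τ (k + 1) ∈ K ∧
        ∀ U ∈ K, F (Tseq τ (k + 1)) + ‖Tseq τ (k + 1) - Tseq τ k‖ ^ 2 / (2 * τ) ≤
          F U + ‖U - Tseq τ k‖ ^ 2 / (2 * τ))
    (tmax : ℝ) (htmax : 0 < tmax) :
    ∃ (τj : ℕ → ℝ) (T T' : ℝ → H),
      (∀ j : ℕ, 0 < τj j ∧ 1 / τj j + lam > 0) ∧
      Tendsto τj atTop (nhds 0) ∧
      T 0 = T₀ ∧
      (∀ t ∈ Set.Icc (0 : ℝ) tmax, T t ∈ K) ∧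
      IntervalIntegrable T' MeasureTheory.volume 0 tmax ∧
      (∀ a b : ℝ, 0 ≤ a → a ≤ b → b ≤ tmax → T b - T a = ∫ t in a..b, T' t) ∧
      (∀ᵐ t ∂(MeasureTheory.volume.restrict (Set.Ioo (0 : ℝ) tmax)),
        HasDerivAt T (T' t) t ∧ IsProjOn (tanCone K (T t)) (-(F' (T t))) (T' t)) ∧
      (∀ᵐ t ∂(MeasureTheory.volume.restrict (Set.Icc (0 : ℝ) tmax)),
        Tendsto (fun j => Tseq (τj j) ⌈t / τj j⌉₊) atTop (nhds (T t))) := by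
  classical
  set m : ℝ := |lam| with hmdef
  have hm : 0 ≤ m := abs_nonneg lam
  set τ0 : ℝ := 1 / (12 * (m + 1)) with hτ0def
  have hτ0 : 0 < τ0 := by positivity
  have hτ0m : τ0 * (m + 1) = 1 / 12 := by rw [hτ0def]; field_simp
  have hτ0le : τ0 ≤ 1 := by nlinarith
  set r : ℝ := Real.sqrt (1 / 2) with hrdef
  have hr0 : 0 ≤ r := Real.sqrt_nonneg _
  have hr2 : r ^ 2 = 1 / 2 := Real.sq_sqrt (by norm_num)
  have hr1 : r < 1 := by nlinarith
  set τ : ℕ → ℝ := fun j => τ0 * (r ^ j) ^ 2 with hτdef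
  have hrp : 0 < r := by
    rcases hr0.eq_or_lt with h | h
    · rw [← h] at hr2; norm_num at hr2
    · exact h
  have hrj1 : ∀ j : ℕ, r ^ j ≤ 1 := fun j => pow_le_one₀ hr0 hr1.le
  have hτpos : ∀ j, 0 < τ j := fun j => by simp only [hτdef]; positivity
  have hτler : ∀ j, τ j ≤ τ0 * r ^ j := by
    intro j
    simp only [hτdef]
    have : (r ^ j) ^ 2 ≤ r ^ j := by nlinarith [hrj1 j, pow_nonneg hr0 j]
    gcongr
  have hτle0 : ∀ j, τ j ≤ τ0 := by
    intro j
    refine (hτler j).trans ?_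
    nlinarith [hrj1 j]
  have hτle1 : ∀ j, τ j ≤ 1 := fun j => (hτle0 j).trans hτ0le
  have hτm : ∀ j, τ j * (m + 1) ≤ 1 / 12 := by
    intro j
    rw [← hτ0m]
    have := hτle0 j
    gcongr
  have hτhalf : ∀ j, τ j = 2 * τ (j + 1) := by
    intro j
    simp only [hτdef]
    rw [pow_succ r, mul_pow, hr2]; ring
  have hτtend : Tendsto τ atTop (𝓝 0) := by
    have h1 : Tendsto (fun j : ℕ => τ0 * r ^ j) atTop (𝓝 0) := by
      simpa using (tendsto_pow_atTop_nhds_zero_of_lt_one hr0 hr1).const_mul τ0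
    exact squeeze_zero (fun j => (hτpos j).le) hτler h1
  have hτadm : ∀ j, 1 / τ j + lam > 0 := by
    intro j
    have h1 : 12 * (m + 1) ≤ 1 / τ j := by
      rw [le_div_iff₀ (hτpos j)]; linarith [hτm j]
    have h2 : -m ≤ lam := neg_abs_le lam
    linarith
  set x : ℕ → ℕ → H := fun j k => Tseq (τ j) k with hxdef
  have hx0 : ∀ j, x j 0 = T₀ := fun j => hTseq0 _
  have hxK : ∀ j k, x j k ∈ K := by
    intro j k
    cases k with
    | zero => rw [hx0]; exact hT₀
    | succ k => exact (hTseqStep _ (hτpos j) (hτadm j) k).1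
  have hvi : ∀ j k, ∀ U ∈ K,
      0 ≤ ⟪τ j • F' (x j (k + 1)) + (x j (k + 1) - x j k), U - x j (k + 1)⟫ := by
    intro j k U hU
    obtain ⟨h1, h2⟩ := hTseqStep _ (hτpos j) (hτadm j) k
    exact prox_vi hKconv hgrad (hτpos j) h1 h2 hU
  have hmono : ∀ p ∈ K, ∀ q ∈ K, -m * ‖p - q‖ ^ 2 ≤ ⟪F' p - F' q, p - q⟫ :=
    fun p hp q hq => grad_mono hgrad hconv hp hq
  set R : ℝ := tmax + 2 with hR
  have hR0 : 0 < R := by linarith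
  set L : ℝ := Real.exp (2 * m * R) * ‖F' T₀‖ with hLdef
  have hL : 0 ≤ L := by positivity
  have hvel : ∀ j k : ℕ, ((k : ℝ) + 1) * τ j ≤ R → ‖x j (k + 1) - x j k‖ ≤ τ j * L := by
    intro j k hk
    have h1 := vel_bound hm (hτpos j) (by nlinarith [hτm j, hτpos j]) hmono (hxK j) (hvi j) k
    rw [hx0] at h1
    refine h1.trans ?_
    have h2 : Real.exp (2 * (τ j * m)) ^ (k + 1) ≤ Real.exp (2 * m * R) := by
      rw [← Real.exp_nat_mul]
      refine Real.exp_le_exp.2 ?_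
      push_cast
      nlinarith
    have h3 : 0 ≤ τ j * ‖F' T₀‖ := mul_nonneg (hτpos j).le (norm_nonneg _)
    calc _ ≤ Real.exp (2 * m * R) * (τ j * ‖F' T₀‖) := mul_le_mul_of_nonneg_right h2 h3
      _ = τ j * L := by rw [hLdef]; ring
  have hdl : ∀ j k l : ℕ, k ≤ l → l * τ j ≤ R → ‖x j l - x j k‖ ≤ ((l : ℝ) - k) * τ j * L := by
    intro j k l hkl
    induction l, hkl using Nat.le_induction with
    | base => intro _; simp
    | succ l hl ih =>
      intro hlR
      push_cast at hlR ⊢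
      have h1 := hvel j l hlR
      have h2 := ih (by nlinarith [hτpos j])
      have h3 := norm_add_le (x j (l + 1) - x j l) (x j l - x j k)
      rw [sub_add_sub_cancel] at h3
      linarith
  set A : ℝ := Real.exp (6 * m * R) * (2 * R * L ^ 2) with hA
  have hA0 : 0 ≤ A := by positivity
  have hcmp : ∀ j k : ℕ, (k : ℝ) * τ j ≤ R → ‖x j k - x (j + 1) (2 * k)‖ ^ 2 ≤ A * τ j := by
    intro j k hk
    have hh := hτhalf j
    set h := τ (j + 1) with hhdef
    have hhpos : 0 < h := hτpos (j + 1)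
    have hmh : 6 * (h * m) ≤ 1 / 2 := by nlinarith [hτm (j + 1)]
    have hvx := hvi j
    rw [hh] at hvx
    have h1 := compare hm hhpos hL hmh hmono (hxK j) (hxK (j + 1)) (by rw [hx0, hx0]) hvx
      (hvi (j + 1)) k ?_ ?_ k le_rfl
    · refine h1.trans ?_
      have h2 : Real.exp (12 * (h * m)) ^ k ≤ Real.exp (6 * m * R) := by
        rw [← Real.exp_nat_mul]
        refine Real.exp_le_exp.2 ?_
        have h3 : m * (k * τ j) ≤ m * R := mul_le_mul_of_nonneg_left hk hm
        rw [hh] at h3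
        linarith
      have h3 : (k : ℝ) * (8 * h ^ 2 * L ^ 2) ≤ 2 * R * L ^ 2 * τ j := by
        have e : (k : ℝ) * (8 * h ^ 2 * L ^ 2) = (k * τ j) * (2 * τ j * L ^ 2) := by
          rw [hh]; ring
        rw [e]
        have : 0 ≤ 2 * τ j * L ^ 2 := by have := hτpos j; positivity
        nlinarith
      calc _ ≤ Real.exp (6 * m * R) * (2 * R * L ^ 2 * τ j) := by
            refine mul_le_mul h2 h3 (by positivity) (by positivity)
        _ = A * τ j := by rw [hA]; ring
    · intro i hi
      rw [← hh]
      refine hvel j i (le_trans ?_ hk)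
      have : (i : ℝ) + 1 ≤ k := by exact_mod_cast hi
      have := hτpos j
      gcongr
    · intro i hi
      refine hvel (j + 1) i (le_trans ?_ hk)
      have : (i : ℝ) + 1 ≤ 2 * k := by exact_mod_cast hi
      rw [hh, ← hhdef]
      nlinarith
  set C : ℝ := Real.sqrt (A * τ0) + L * τ0 with hC
  have hXX : ∀ t ∈ Set.Icc (0 : ℝ) tmax, ∀ j,
      dist (x j ⌈t / τ j⌉₊) (x (j + 1) ⌈t / τ (j + 1)⌉₊) ≤ C * r ^ j := by
    intro t ht j
    have hh := hτhalf j
    obtain ⟨ha1, ha2⟩ := ceil_bounds ht.1 (hτpos j)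
    obtain ⟨hb1, hb2⟩ := ceil_bounds ht.1 (hτpos (j + 1))
    have hle : ⌈t / τ (j + 1)⌉₊ ≤ 2 * ⌈t / τ j⌉₊ := by
      refine Nat.ceil_le.2 ?_
      rw [div_le_iff₀ (hτpos (j + 1))]
      push_cast
      rw [hh] at ha1 ⊢
      linarith
    generalize ⌈t / τ (j + 1)⌉₊ = b at *
    generalize ⌈t / τ j⌉₊ = a at *
    have haR : (a : ℝ) * τ j ≤ R := by linarith [ht.2, hτle1 j]
    have h1 := hcmp j a haR
    have h2 : ‖x j a - x (j + 1) (2 * a)‖ ≤ Real.sqrt (A * τ0) * r ^ j := by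
      refine le_of_sq_le_sq ?_ (by positivity)
      rw [mul_pow, Real.sq_sqrt (by positivity)]
      refine h1.trans (le_of_eq ?_)
      simp only [hτdef]; ring
    have h3 := hdl (j + 1) b (2 * a) hle (by push_cast; rw [hh] at haR; linarith)
    have h4 : (((2 * a : ℕ) : ℝ) - b) * τ (j + 1) * L ≤ L * τ0 * r ^ j := by
      have h5 : (((2 * a : ℕ) : ℝ) - b) * τ (j + 1) ≤ τ0 * r ^ j := by
        refine le_trans ?_ (hτler j)
        push_cast
        have : (2 * (a : ℝ) - b) * τ (j + 1) = a * τ j - b * τ (j + 1) := by rw [hh]; ring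
        rw [this]; linarith
      nlinarith
    rw [dist_eq_norm]
    have h6 := norm_add_le (x j a - x (j + 1) (2 * a)) (x (j + 1) (2 * a) - x (j + 1) b)
    rw [sub_add_sub_cancel] at h6
    rw [hC, add_mul]
    linarith
  have hlim : ∀ t : Set.Icc (0 : ℝ) tmax, ∃ y : H,
      Tendsto (fun j => x j ⌈(t : ℝ) / τ j⌉₊) atTop (𝓝 y) := fun t =>
    cauchySeq_tendsto_of_complete (cauchySeq_of_le_geometric r C hr1 (hXX t t.2))
  choose Y hY using hlim
  have hYdist : ∀ s t : Set.Icc (0 : ℝ) tmax, (s : ℝ) ≤ t → dist (Y t) (Y s) ≤ L * ((t : ℝ) - s) := by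
    intro s t hst
    have hl1 := (hY t).dist (hY s)
    have hl2 : Tendsto (fun j => L * ((t : ℝ) - s + τ j)) atTop (𝓝 (L * ((t : ℝ) - s))) := by
      simpa using (hτtend.const_add ((t : ℝ) - s)).const_mul L
    refine le_of_tendsto_of_tendsto' hl1 hl2 fun j => ?_
    obtain ⟨ha1, ha2⟩ := ceil_bounds s.2.1 (hτpos j)
    obtain ⟨hb1, hb2⟩ := ceil_bounds t.2.1 (hτpos j)
    have hab : ⌈(s : ℝ) / τ j⌉₊ ≤ ⌈(t : ℝ) / τ j⌉₊ := by
      refine Nat.ceil_mono ?_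
      have := hτpos j
      gcongr
    have h1 := hdl j _ _ hab (by linarith [t.2.2, hτle1 j])
    rw [dist_eq_norm]
    refine h1.trans ?_
    rw [mul_comm]
    refine mul_le_mul_of_nonneg_left ?_ hL
    rw [sub_mul]; linarith
  have hYlip : LipschitzWith (Real.toNNReal L) Y := by
    refine LipschitzWith.of_dist_le_mul fun s t => ?_
    rw [Real.coe_toNNReal L hL, Subtype.dist_eq, Real.dist_eq]
    rcases le_total (s : ℝ) t with h | h
    · rw [dist_comm, abs_sub_comm, abs_of_nonneg (sub_nonneg.2 h)]
      exact hYdist s t h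
    · rw [abs_of_nonneg (sub_nonneg.2 h)]
      exact hYdist t s h
  set T : ℝ → H := fun t => Y (Set.projIcc 0 tmax htmax.le t) with hTdef
  have hTlip : LipschitzWith (Real.toNNReal L * 1) T := hYlip.comp (LipschitzWith.projIcc htmax.le)
  have hTY : ∀ t (ht : t ∈ Set.Icc (0 : ℝ) tmax), T t = Y ⟨t, ht⟩ := by
    intro t ht
    simp only [hTdef]
    rw [Set.projIcc_of_mem htmax.le ht]
  have hTconv : ∀ t ∈ Set.Icc (0 : ℝ) tmax,
      Tendsto (fun j => x j ⌈t / τ j⌉₊) atTop (𝓝 (T t)) := by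
    intro t ht
    rw [hTY t ht]
    exact hY ⟨t, ht⟩
  have hTK : ∀ t, T t ∈ K := fun t =>
    hKcl.mem_of_tendsto (hY _) (Eventually.of_forall fun j => hxK j _)
  obtain ⟨T', hT'1, hT'2, hT'3⟩ := lipschitz_deriv_hilbert T _ hTlip
  have hFc : Continuous F := continuous_iff_continuousAt.2 fun y => (hgrad y).continuousAt
  refine ⟨τ, T, T', fun j => ⟨hτpos j, hτadm j⟩, hτtend, ?_, fun t _ => hTK t, hT'1 _ _,
    fun a b _ _ _ => hT'2 a b, ?_, ?_⟩
  · have h1 := hTconv 0 ⟨le_rfl, htmax.le⟩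
    simp only [zero_div, Nat.ceil_zero, hx0] at h1
    exact tendsto_nhds_unique h1 tendsto_const_nhds
  · rw [ae_restrict_iff' measurableSet_Ioo]
    filter_upwards [hT'3] with t hd ht
    refine ⟨hd, flow_proj hKconv hgrad (m := m) hTK hd fun U hU => ?_⟩
    refine limit_evi (g := fun y => F U - F y + m / 2 * ‖U - y‖ ^ 2) (by fun_prop)
      hτpos hτle1 hτtend hL ?_ hdl ht.1.le ht.2 hTconv hd
    intro j k
    have h1 := hvi j k U hU
    have h2 := grad_ineq hgrad hconv (hxK j (k + 1)) hU
    have h3 : ‖x j k - U‖ ^ 2 = ‖x j (k + 1) - U‖ ^ 2 +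
        2 * ⟪x j (k + 1) - x j k, U - x j (k + 1)⟫ + ‖x j (k + 1) - x j k‖ ^ 2 := by
      have e : x j k - U = (x j (k + 1) - U) - (x j (k + 1) - x j k) := by abel
      rw [e, norm_sub_sq_real, ← neg_sub (x j (k + 1)) U, inner_neg_right,
        real_inner_comm (x j (k + 1) - x j k)]
      ring
    rw [inner_add_left, real_inner_smul_left] at h1
    have h4 := mul_le_mul_of_nonneg_left h2 (hτpos j).le
    nlinarith [sq_nonneg ‖x j (k + 1) - x j k‖]
  · rw [ae_restrict_iff' measurableSet_Icc]
    exact Eventually.of_forall hTconv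
end

section
/- Let K ⊆ H be a nonempty closed convex set, F : H → ℝ Fréchet differentiable with gradient ∇F, and let T : [0,∞) → H be a solution of the constrained gradient flow of F in K starting at some T₀ ∈ K. Assume that t ↦ F(T(t)) is locally absolutely continuous on [0,∞). Then t ↦ F(T(t)) is nonincreasing on [0,∞); moreover, for a.e. t > 0, the derivative of t ↦ F(T(t)) equals −‖T'(t)‖². -/
open MeasureTheory
open scoped RealInnerProductSpace

variable {H : Type*} [NormedAddCommGroup H] [InnerProductSpace ℝ H] [CompleteSpace H]

/-- `T : [0,∞) → H` (with a.e. derivative `T'`) is a solution of the constrained gradient flow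
of `F` (with gradient `F'`) in `K` starting at `T₀`: a locally absolutely continuous curve
(encoded by the fundamental theorem of calculus with a locally integrable a.e.-derivative)
staying in `K`, starting at `T₀`, whose derivative at a.e. `t > 0` exists and is the projection
of `−F'(T(t))` onto the tangent cone of `K` at `T(t)`. -/
def IsFlowSol (K : Set H) (F' : H → H) (T₀ : H) (T T' : ℝ → H) : Prop :=
  T 0 = T₀ ∧
  (∀ t : ℝ, 0 ≤ t → T t ∈ K) ∧
  (∀ b : ℝ, 0 < b → IntervalIntegrable T' MeasureTheory.volume 0 b) ∧
  (∀ a b : ℝ, 0 ≤ a → a ≤ b → T b - T a = ∫ t in a..b, T' t) ∧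
  (∀ᵐ t ∂(MeasureTheory.volume.restrict (Set.Ioi (0 : ℝ))),
    HasDerivAt T (T' t) t ∧ IsProjOn (tanCone K (T t)) (-(F' (T t))) (T' t))

/-- `f : ℝ → ℝ` is locally absolutely continuous on `[0,∞)` with a.e. derivative `g`
(encoded by the fundamental theorem of calculus with a locally integrable a.e.-derivative). -/
def IsLocACWithDeriv (f g : ℝ → ℝ) : Prop :=
  (∀ b : ℝ, 0 < b → IntervalIntegrable g MeasureTheory.volume 0 b) ∧
  (∀ a b : ℝ, 0 ≤ a → a ≤ b → f b - f a = ∫ t in a..b, g t) ∧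
  (∀ᵐ t ∂(MeasureTheory.volume.restrict (Set.Ioi (0 : ℝ))), HasDerivAt f (g t) t)

/-- `F` is `λ`-star-convex on `K` around `Tstar`. -/
def StarConvexAround (lam : ℝ) (K : Set H) (F : H → ℝ) (Tstar : H) : Prop :=
  ∀ T ∈ K, ∀ s : ℝ, 0 ≤ s → s ≤ 1 →
    F ((1 - s) • T + s • Tstar) ≤
      (1 - s) * F T + s * F Tstar - lam / 2 * s * (1 - s) * ‖T - Tstar‖ ^ 2

theorem tanCone_smul_mem {K : Set H} {T w : H} (hw : w ∈ tanCone K T) {c : ℝ} (hc : 0 < c) :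
    c • w ∈ tanCone K T := by
  have hcont : Continuous (fun x : H => c • x) := continuous_const_smul c
  refine map_mem_closure hcont hw ?_
  rintro x ⟨t, ht, hx⟩
  refine ⟨t / c, div_pos ht hc, ?_⟩
  rw [smul_smul, div_mul_cancel₀ _ hc.ne']
  exact hx

theorem inner_eq_of_isProjOn_tanCone {K : Set H} {T v w : H} (h : IsProjOn (tanCone K T) v w) :
    ⟪v, w⟫ = ‖w‖ ^ 2 := by
  obtain ⟨hw, hmin⟩ := h
  have key : ∀ e : ℝ, -1 < e → 0 ≤ e * (2 * (‖w‖ ^ 2 - ⟪v, w⟫) + e * ‖w‖ ^ 2) := by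
    intro e he
    have h1 := hmin _ (tanCone_smul_mem hw (c := 1 + e) (by linarith))
    have h2 : ‖v - w‖ ^ 2 ≤ ‖v - (1 + e) • w‖ ^ 2 := by gcongr
    rw [norm_sub_sq_real, norm_sub_sq_real, real_inner_smul_right, norm_smul, mul_pow,
      Real.norm_eq_abs, sq_abs] at h2
    nlinarith
  by_contra hne
  set d := ‖w‖ ^ 2 - ⟪v, w⟫ with hd
  have hd0 : d ≠ 0 := fun h0 => hne (by linarith)
  have hN : 0 ≤ ‖w‖ ^ 2 := by positivity
  set N := ‖w‖ ^ 2
  have hM : 0 < N + |d| + 1 := by positivity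
  have h3 := key (-d / (N + |d| + 1)) (by
    rw [lt_div_iff₀ hM]
    have := le_abs_self d
    linarith)
  have h4 : -d / (N + |d| + 1) * (2 * d + -d / (N + |d| + 1) * N)
      = -(d ^ 2 * (N + 2 * |d| + 2)) / (N + |d| + 1) ^ 2 := by
    field_simp
    ring
  rw [h4] at h3
  have h5 : 0 < d ^ 2 * (N + 2 * |d| + 2) := by positivity
  have h6 : -(d ^ 2 * (N + 2 * |d| + 2)) / (N + |d| + 1) ^ 2 < 0 :=
    div_neg_of_neg_of_pos (by linarith) (by positivity)
  linarith

/-- Along a solution of the constrained gradient flow, `t ↦ F(T(t))` is nonincreasing on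
`[0,∞)` and its derivative at a.e. `t > 0` equals `−‖T'(t)‖²`. -/
theorem value_nonincreasing_along_flow (K : Set H) (hKne : K.Nonempty)
    (hKcl : IsClosed K) (hKconv : Convex ℝ K)
    (F : H → ℝ) (F' : H → H) (hgrad : ∀ x : H, HasGradientAt F (F' x) x)
    (T₀ : H) (hT₀ : T₀ ∈ K) (T T' : ℝ → H)
    (hflow : IsFlowSol K F' T₀ T T')
    (hAC : ∃ g : ℝ → ℝ, IsLocACWithDeriv (fun t => F (T t)) g) :
    AntitoneOn (fun t => F (T t)) (Set.Ici (0 : ℝ)) ∧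
      ∀ᵐ t ∂(MeasureTheory.volume.restrict (Set.Ioi (0 : ℝ))),
        HasDerivAt (fun s => F (T s)) (-‖T' t‖ ^ 2) t := by
  obtain ⟨-, -, -, -, hder⟩ := hflow
  have hmain : ∀ᵐ t ∂(MeasureTheory.volume.restrict (Set.Ioi (0 : ℝ))),
        HasDerivAt (fun s => F (T s)) (-‖T' t‖ ^ 2) t := by
    filter_upwards [hder] with t ht
    obtain ⟨h1, h2⟩ := ht
    have h3 := inner_eq_of_isProjOn_tanCone h2
    rw [inner_neg_left] at h3
    have h4 := (hgrad (T t)).hasFDerivAt.comp_hasDerivAt t h1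
    have h5 : (InnerProductSpace.toDual ℝ H (F' (T t))) (T' t) = -‖T' t‖ ^ 2 := by
      rw [InnerProductSpace.toDual_apply_apply]
      linarith
    rw [h5] at h4
    exact h4
  refine ⟨?_, hmain⟩
  obtain ⟨g, -, hg, hgd⟩ := hAC
  intro a ha b hb hab
  have hle : ∀ᵐ t ∂(MeasureTheory.volume.restrict (Set.Ioi (0 : ℝ))), g t ≤ 0 := by
    filter_upwards [hmain, hgd] with t h1 h2
    rw [h2.unique h1]
    have : 0 ≤ ‖T' t‖ ^ 2 := by positivity
    linarith
  have hsub : Set.Ioc a b ⊆ Set.Ioi 0 := fun x hx => lt_of_le_of_lt ha hx.1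
  have h := hg a b ha hab
  rw [intervalIntegral.integral_of_le hab] at h
  have h6 := integral_nonpos_of_ae (ae_restrict_of_ae_restrict_of_subset hsub hle)
  simp only at h ⊢
  linarith
end

section
/- Let K ⊆ H be a nonempty closed convex set, F : H → ℝ Fréchet differentiable with gradient ∇F, and let T* ∈ K be a minimizer of F over K. Assume F is star-convex on K around T* (i.e., 0-star-convex). Let T : [0,∞) → H be a solution of the constrained gradient flow of F in K starting at T₀ ∈ K, and assume t ↦ F(T(t)) is locally absolutely continuous. Then for almost every t > 0, F(T(t)) − F(T*) ≤ ‖T₀ − T*‖² / (2t). -/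
open MeasureTheory
open scoped RealInnerProductSpace

variable {H : Type*} [NormedAddCommGroup H] [InnerProductSpace ℝ H] [CompleteSpace H]

theorem tanCone_convex {K : Set H} (hK : Convex ℝ K) {T : H} (hT : T ∈ K) :
    Convex ℝ (tanCone K T) := by
  apply Convex.closure
  have key : ∀ (w : H) (t s : ℝ), 0 < s → s ≤ t → T + t • w ∈ K → T + s • w ∈ K := by
    intro w t s hs hst h
    have ht : 0 < t := lt_of_lt_of_le hs hst
    have := hK.add_smul_mem hT h (t := s / t) ⟨by positivity, by rw [div_le_one ht]; exact hst⟩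
    rwa [smul_smul, div_mul_cancel₀ _ ht.ne'] at this
  rintro w₁ ⟨t₁, ht₁, h₁⟩ w₂ ⟨t₂, ht₂, h₂⟩ a b ha hb hab
  refine ⟨min t₁ t₂, lt_min ht₁ ht₂, ?_⟩
  have e₁ := key w₁ t₁ (min t₁ t₂) (lt_min ht₁ ht₂) (min_le_left _ _) h₁
  have e₂ := key w₂ t₂ (min t₁ t₂) (lt_min ht₁ ht₂) (min_le_right _ _) h₂
  have := hK e₁ e₂ ha hb hab
  convert this using 1
  have hb' : b = 1 - a := by linarith
  subst hb'
  module

theorem tanCone_two_smul {K : Set H} {T w : H} (hw : w ∈ tanCone K T) :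
    (2 : ℝ) • w ∈ tanCone K T := by
  refine map_mem_closure (continuous_const_smul (2 : ℝ)) hw ?_
  rintro u ⟨t, ht, hu⟩
  refine ⟨t / 2, by positivity, ?_⟩
  rwa [smul_smul, div_mul_cancel₀ _ (two_ne_zero)]

theorem IsProjOn.inner_le {C : Set H} (hC : Convex ℝ C) {v w : H} (h : IsProjOn C v w)
    {u : H} (hu : u ∈ C) : ⟪v - w, u - w⟫ ≤ 0 := by
  obtain ⟨hw, hmin⟩ := h
  refine (norm_eq_iInf_iff_real_inner_le_zero hC hw).1 ?_ u hu
  have : Nonempty C := ⟨⟨w, hw⟩⟩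
  apply le_antisymm
  · exact le_ciInf fun x => hmin x x.2
  · exact ciInf_le (f := fun x : C => ‖v - x‖)
      ⟨0, by rintro _ ⟨x, rfl⟩; exact norm_nonneg _⟩ ⟨w, hw⟩

theorem ac_of_dist_le {X : Type*} [PseudoMetricSpace X] {f : ℝ → X} {G : ℝ → ℝ} {a b : ℝ}
    (hG : AbsolutelyContinuousOnInterval G a b)
    (h : ∀ x ∈ Set.uIcc a b, ∀ y ∈ Set.uIcc a b, dist (f x) (f y) ≤ dist (G x) (G y)) :
    AbsolutelyContinuousOnInterval f a b := by
  rw [absolutelyContinuousOnInterval_iff] at hG ⊢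
  intro ε hε
  obtain ⟨δ, hδ, H⟩ := hG ε hε
  refine ⟨δ, hδ, fun E hE hl => lt_of_le_of_lt (Finset.sum_le_sum fun i hi => ?_) (H E hE hl)⟩
  exact h _ (hE.1 i hi).1 _ (hE.1 i hi).2

theorem ac_norm_sub {E : Type*} [NormedAddCommGroup E] [NormedSpace ℝ E]
    {f g : ℝ → E} (c : E) {b : ℝ} (hb : 0 < b)
    (hg : IntervalIntegrable g volume 0 b)
    (hfg : ∀ x y : ℝ, 0 ≤ x → x ≤ y → f y - f x = ∫ t in x..y, g t) :
    AbsolutelyContinuousOnInterval f 0 b ∧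
    AbsolutelyContinuousOnInterval (fun t => ‖f t - c‖) 0 b := by
  have hG : AbsolutelyContinuousOnInterval (fun x => ∫ t in (0:ℝ)..x, ‖g t‖) 0 b :=
    hg.norm.absolutelyContinuousOnInterval_intervalIntegral (by simp)
  have key : ∀ x ∈ Set.uIcc 0 b, ∀ y ∈ Set.uIcc 0 b, dist (f x) (f y) ≤
      dist (∫ t in (0:ℝ)..x, ‖g t‖) (∫ t in (0:ℝ)..y, ‖g t‖) := by
    have main : ∀ x ∈ Set.uIcc 0 b, ∀ y ∈ Set.uIcc 0 b, x ≤ y → dist (f x) (f y) ≤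
      dist (∫ t in (0:ℝ)..x, ‖g t‖) (∫ t in (0:ℝ)..y, ‖g t‖) := by
      intro x hx y hy hxy
      have i1 : IntervalIntegrable (fun t => ‖g t‖) volume 0 x :=
        hg.norm.mono_set (Set.uIcc_subset_uIcc Set.left_mem_uIcc hx)
      have i2 : IntervalIntegrable (fun t => ‖g t‖) volume 0 y :=
        hg.norm.mono_set (Set.uIcc_subset_uIcc Set.left_mem_uIcc hy)
      rw [Set.uIcc_of_le hb.le] at hx
      rw [dist_comm (f x), dist_comm (∫ t in (0:ℝ)..x, ‖g t‖), dist_eq_norm, dist_eq_norm, hfg x y hx.1 hxy,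
        intervalIntegral.integral_interval_sub_left i2 i1]
      exact (intervalIntegral.norm_integral_le_integral_norm hxy).trans (le_abs_self _)
    intro x hx y hy
    rcases le_total x y with h | h
    · exact main x hx y hy h
    · rw [dist_comm (f x), dist_comm (∫ t in (0:ℝ)..x, ‖g t‖)]
      exact main y hy x hx h
  refine ⟨ac_of_dist_le hG key, ac_of_dist_le hG fun x hx y hy => le_trans ?_ (key x hx y hy)⟩
  rw [Real.dist_eq, dist_eq_norm]
  simpa using abs_norm_sub_norm_le (f x - c) (f y - c)

/-- First-order consequence of star-convexity. -/
theorem star_first_order {K : Set H} {F : H → ℝ} {G x y : H} (hF : HasGradientAt F G x)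
    (hs : StarConvexAround 0 K F y) (hx : x ∈ K) : ⟪G, y - x⟫ ≤ F y - F x := by
  have hl : HasDerivAt (fun s : ℝ => x + s • (y - x)) (y - x) 0 := by
    simpa using ((hasDerivAt_id (0:ℝ)).smul_const (y - x)).const_add x
  have hd : HasDerivAt (fun s : ℝ => F (x + s • (y - x))) ⟪G, y - x⟫ 0 := by
    have h1 : HasFDerivAt F (InnerProductSpace.toDual ℝ H G) (x + (0:ℝ) • (y - x)) := by
      simpa using hF.hasFDerivAt
    exact HasDerivAt.congr_deriv (h1.comp_hasDerivAt (0:ℝ) hl) (by simp)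
  have ht := hd.hasDerivWithinAt (s := Set.Ioi 0)
  rw [hasDerivWithinAt_iff_tendsto_slope' (by simp)] at ht
  refine le_of_tendsto ht ?_
  filter_upwards [Ioo_mem_nhdsGT (zero_lt_one' ℝ)] with s hs1
  have h2 := hs x hx s hs1.1.le hs1.2.le
  have e : (1 - s) • x + s • y = x + s • (y - x) := by module
  rw [e] at h2
  rw [slope_def_field]
  simp only [zero_smul, add_zero, sub_zero]
  rw [div_le_iff₀ hs1.1]
  linarith

/-- Sublinear convergence of the values along the constrained gradient flow when `F` is
star-convex around its minimizer `Tstar` over `K`: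
`F(T(t)) − F(T*) ≤ ‖T₀ − T*‖²/(2t)` for a.e. `t > 0`. -/
theorem value_convergence_star_convex (K : Set H) (hKne : K.Nonempty)
    (hKcl : IsClosed K) (hKconv : Convex ℝ K)
    (F : H → ℝ) (F' : H → H) (hgrad : ∀ x : H, HasGradientAt F (F' x) x)
    (Tstar : H) (hTstar : Tstar ∈ K) (hmin : ∀ U ∈ K, F Tstar ≤ F U)
    (hstar : StarConvexAround 0 K F Tstar)
    (T₀ : H) (hT₀ : T₀ ∈ K) (T T' : ℝ → H)
    (hflow : IsFlowSol K F' T₀ T T')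
    (hAC : ∃ g : ℝ → ℝ, IsLocACWithDeriv (fun t => F (T t)) g) :
    ∀ᵐ t ∂(MeasureTheory.volume.restrict (Set.Ioi (0 : ℝ))),
      F (T t) - F Tstar ≤ ‖T₀ - Tstar‖ ^ 2 / (2 * t) := by
  obtain ⟨g, hgi, hgf, hgd⟩ := hAC
  obtain ⟨hT0, hTK, hTi, hTf, hTd⟩ := hflow
  refine (ae_restrict_iff' measurableSet_Ioi).2 (Filter.Eventually.of_forall fun b hb => ?_)
  replace hb : 0 < b := hb
  have acF := (ac_norm_sub (0:ℝ) hb (hgi b hb) hgf).1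
  have acN := (ac_norm_sub Tstar hb (hTi b hb) hTf).2
  have acid : AbsolutelyContinuousOnInterval (fun t : ℝ => t) 0 b :=
    contDiff_id.contDiffOn.absolutelyContinuousOnInterval
  have acc : AbsolutelyContinuousOnInterval (fun t : ℝ => F Tstar) 0 b :=
    contDiff_const.contDiffOn.absolutelyContinuousOnInterval
  have ac := (acid.mul (acF.sub acc)).add ((acN.mul acN).const_mul (1/2))
  have hFTC := ac.integral_deriv_eq_sub
  have hnp : ∀ᵐ t ∂(volume.restrict (Set.Ioi (0 : ℝ))),
      deriv ((fun t : ℝ => t) * ((fun t => F (T t)) - fun _ => F Tstar) +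
        fun t => (1/2 : ℝ) * ((fun t => ‖T t - Tstar‖) * fun t => ‖T t - Tstar‖) t) t ≤ 0 := by
    filter_upwards [hTd, ae_restrict_mem measurableSet_Ioi] with t ⟨hd, hp⟩ ht
    replace ht : 0 < t := ht
    have hK := hTK t ht.le
    have hFd : HasDerivAt (fun t => F (T t)) ⟪F' (T t), T' t⟫ t := by
      exact HasDerivAt.congr_deriv ((hgrad (T t)).hasFDerivAt.comp_hasDerivAt t hd) (by simp)
    have hNd : HasDerivAt (fun t => ‖T t - Tstar‖ ^ 2) (2 * ⟪T t - Tstar, T' t⟫) t :=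
      (hd.sub_const Tstar).norm_sq
    have hΦ := ((hasDerivAt_id t).mul (hFd.sub_const (F Tstar))).add (hNd.const_mul (1/2 : ℝ))
    have heq : ((fun t : ℝ => t) * ((fun t => F (T t)) - fun _ => F Tstar) +
        fun t => (1/2 : ℝ) * ((fun t => ‖T t - Tstar‖) * fun t => ‖T t - Tstar‖) t) =
        ((id * fun t => F (T t) - F Tstar) + fun t => (1/2 : ℝ) * ‖T t - Tstar‖ ^ 2) := by
      funext s
      simp only [Pi.add_apply, Pi.mul_apply, Pi.sub_apply, id]
      ring
    rw [heq, hΦ.deriv]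
    have hC := tanCone_convex hKconv hK
    have h0 : (0 : H) ∈ tanCone K (T t) := subset_closure ⟨1, one_pos, by simpa using hK⟩
    have h1 : Tstar - T t ∈ tanCone K (T t) := subset_closure ⟨1, one_pos, by simpa using hTstar⟩
    have p0 := hp.inner_le hC h0
    have p1 := hp.inner_le hC h1
    have p2 := hp.inner_le hC (tanCone_two_smul hp.1)
    rw [two_smul, add_sub_cancel_right] at p2
    have hso := star_first_order (hgrad (T t)) hstar hK
    have hnn : 0 ≤ ⟪T' t, T' t⟫ := real_inner_self_nonneg
    simp only [inner_sub_left, inner_sub_right, inner_neg_left, inner_zero_right] at p0 p1 p2 hso ⊢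
    rw [real_inner_comm (T' t) (T t), real_inner_comm (T' t) Tstar]
    have q0 : ⟪F' (T t), T' t⟫ ≤ 0 := by linarith
    have q1 := mul_nonpos_of_nonneg_of_nonpos ht.le q0
    simp only [id]
    linarith
  have hle : b * (F (T b) - F Tstar) + 1/2 * (‖T b - Tstar‖ * ‖T b - Tstar‖) -
      (1/2 * (‖T 0 - Tstar‖ * ‖T 0 - Tstar‖)) ≤ 0 := by
    have : ∫ t in (0:ℝ)..b, deriv ((fun t : ℝ => t) * ((fun t => F (T t)) - fun _ => F Tstar) +
        fun t => (1/2 : ℝ) * ((fun t => ‖T t - Tstar‖) * fun t => ‖T t - Tstar‖) t) t ≤ 0 := by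
      rw [intervalIntegral.integral_of_le hb.le]
      exact integral_nonpos_of_ae (ae_restrict_of_ae_restrict_of_subset
        (fun x hx => hx.1) hnp)
    have h3 := hFTC.symm.trans_le this
    simpa using h3
  rw [hT0] at hle
  rw [le_div_iff₀ (by positivity)]
  nlinarith [mul_self_nonneg ‖T b - Tstar‖]
end

section
/- Let K ⊆ H be a nonempty closed convex set, F : H → ℝ Fréchet differentiable with gradient ∇F, and let T* ∈ K be a minimizer of F over K. Assume F is λ-star-convex on K around T* with λ > 0. Let T : [0,∞) → H be a solution of the constrained gradient flow of F in K starting at T₀ ∈ K, and assume t ↦ F(T(t)) is locally absolutely continuous. Then for almost every t ≥ 0, F(T(t)) − F(T*) ≤ e^{−2λt} · (F(T₀) − F(T*)). -/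
open MeasureTheory
open scoped RealInnerProductSpace

variable {H : Type*} [NormedAddCommGroup H] [InnerProductSpace ℝ H] [CompleteSpace H]

lemma closure_smul_mem (K : Set H) (x w : H) (hw : w ∈ tanCone K x) (c : ℝ) (hc : 0 < c) :
    c • w ∈ tanCone K x := by
  unfold tanCone at *
  refine map_mem_closure (continuous_const_smul c) hw ?_
  rintro y ⟨t, ht, hy⟩
  refine ⟨t / c, by positivity, ?_⟩
  rw [smul_smul, div_mul_cancel₀ _ hc.ne']
  exact hy

lemma closure_add_mem (K : Set H) (hK : Convex ℝ K) (x z w : H) (hx : x ∈ K) (hz : z ∈ K)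
    (hw : w ∈ tanCone K x) (s : ℝ) (hs : 0 < s) :
    w + s • (z - x) ∈ tanCone K x := by
  unfold tanCone at *
  refine map_mem_closure (f := fun w => w + s • (z - x)) (by fun_prop) hw ?_
  rintro y ⟨t, ht, hy⟩
  have hd : 0 < 1 + t * s := by positivity
  refine ⟨t / (1 + t * s), by positivity, ?_⟩
  have h := hK hy hz (a := 1 / (1 + t * s)) (b := t * s / (1 + t * s)) (by positivity)
    (by positivity) (by field_simp)
  convert h using 1
  have h1 : x = (1 / (1 + t * s)) • x + (t * s / (1 + t * s)) • x := by
    rw [← add_smul]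
    have : 1 / (1 + t * s) + t * s / (1 + t * s) = 1 := by field_simp
    rw [this, one_smul]
  nth_rewrite 1 [h1]
  match_scalars <;> field_simp <;> ring

lemma nonpos_of_quad (a b : ℝ) (h : ∀ s : ℝ, 0 < s → s < 1 → a ≤ s * b) : a ≤ 0 := by
  have ht : Filter.Tendsto (fun s : ℝ => s * b) (nhdsWithin 0 (Set.Ioi 0)) (nhds 0) := by
    have : Filter.Tendsto (fun s : ℝ => s * b) (nhds 0) (nhds (0 * b)) :=
      (continuous_id.mul continuous_const).tendsto 0
    rw [zero_mul] at this
    exact this.mono_left nhdsWithin_le_nhds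
  refine ge_of_tendsto ht ?_
  filter_upwards [Ioo_mem_nhdsGT (zero_lt_one' ℝ)] with s hs
  exact h s hs.1 hs.2

lemma inner_le_of_dir (C : Set H) (v w u : H) (hp : IsProjOn C v w)
    (hu : ∀ s : ℝ, 0 < s → s < 1 → w + s • u ∈ C) : ⟪v - w, u⟫ ≤ 0 := by
  have : 2 * ⟪v - w, u⟫ ≤ 0 := by
    refine nonpos_of_quad _ (‖u‖ ^ 2) fun s hs hs1 => ?_
    have h := hp.2 _ (hu s hs hs1)
    rw [← sub_sub] at h
    have h2 : ‖v - w‖ ^ 2 ≤ ‖v - w - s • u‖ ^ 2 := by gcongr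
    rw [norm_sub_sq_real (v - w), inner_smul_right, norm_smul, mul_pow, Real.norm_eq_abs,
      sq_abs] at h2
    have : s * (2 * ⟪v - w, u⟫) ≤ s * (s * ‖u‖ ^ 2) := by nlinarith
    exact le_of_mul_le_mul_left this hs
  linarith

lemma star_deriv (lam : ℝ) (K : Set H) (F : H → ℝ) (G x z : H) (hx : x ∈ K)
    (hg : HasGradientAt F G x) (hstar : StarConvexAround lam K F z) :
    ⟪G, z - x⟫ ≤ F z - F x - lam / 2 * ‖x - z‖ ^ 2 := by
  have hline : HasDerivAt (fun s : ℝ => x + s • (z - x)) (z - x) 0 := by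
    simpa using ((hasDerivAt_id (0 : ℝ)).smul_const (z - x)).const_add x
  have hF : HasFDerivAt F (InnerProductSpace.toDual ℝ H G) (x + (0 : ℝ) • (z - x)) := by
    simpa using hg.hasFDerivAt
  have hd := hF.comp_hasDerivAt (0 : ℝ) hline
  simp only [InnerProductSpace.toDual_apply_apply] at hd
  have hs := (hasDerivAt_iff_tendsto_slope.mp hd).mono_left
    (nhdsWithin_mono (0 : ℝ) (fun y (hy : y ∈ Set.Ioi (0 : ℝ)) => ne_of_gt hy))
  have ht : Filter.Tendsto (fun s : ℝ => F z - F x - lam / 2 * (1 - s) * ‖x - z‖ ^ 2)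
      (nhdsWithin 0 (Set.Ioi 0)) (nhds (F z - F x - lam / 2 * (1 - 0) * ‖x - z‖ ^ 2)) := by
    refine Filter.Tendsto.mono_left (Continuous.tendsto ?_ 0) nhdsWithin_le_nhds
    fun_prop
  rw [sub_zero, mul_one] at ht
  refine le_of_tendsto_of_tendsto hs ht ?_
  filter_upwards [Ioo_mem_nhdsGT (zero_lt_one' ℝ)] with s hs
  have h := hstar x hx s hs.1.le hs.2.le
  have e : (1 - s) • x + s • z = x + s • (z - x) := by module
  rw [e] at h
  simp only [slope_def_field, Function.comp, sub_zero, zero_smul, add_zero]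
  rw [div_le_iff₀ hs.1]
  nlinarith

lemma pointwise_bound (K : Set H) (hK : Convex ℝ K) (F : H → ℝ) (G x z w : H)
    (hx : x ∈ K) (hz : z ∈ K) (hg : HasGradientAt F G x) (lam : ℝ) (hlam : 0 < lam)
    (hstar : StarConvexAround lam K F z) (hp : IsProjOn (tanCone K x) (-G) w) :
    ⟪G, w⟫ ≤ -(2 * lam * (F x - F z)) := by
  have h1 := star_deriv lam K F G x z hx hg hstar
  have h2 : ⟪-G - w, z - x⟫ ≤ 0 := inner_le_of_dir _ _ _ _ hp
    fun s hs _ => closure_add_mem K hK x z w hx hz hp.1 s hs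
  have h3 : ⟪-G - w, -w⟫ ≤ 0 := inner_le_of_dir _ _ _ _ hp fun s hs hs1 => by
    have := closure_smul_mem K x w hp.1 (1 - s) (by linarith)
    convert this using 1
    module
  have h4 := real_inner_le_norm w (z - x)
  rw [norm_sub_rev z x] at h4
  simp only [inner_sub_left, inner_neg_left, inner_neg_right, real_inner_self_eq_norm_sq] at h2 h3
  have h5 : F x - F z ≤ ‖w‖ * ‖x - z‖ - lam / 2 * ‖x - z‖ ^ 2 := by linarith
  have h6 : 2 * lam * (F x - F z) ≤ ‖w‖ ^ 2 := by
    nlinarith [sq_nonneg (‖w‖ - lam * ‖x - z‖), mul_le_mul_of_nonneg_left h5 hlam.le]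
  linarith

lemma gronwall_ac (f g : ℝ → ℝ) (hf : IsLocACWithDeriv f g) (c m : ℝ)
    (hle : ∀ᵐ t ∂(volume.restrict (Set.Ioi (0 : ℝ))), g t ≤ -(c * (f t - m)))
    (b : ℝ) (hb : 0 ≤ b) : f b - m ≤ Real.exp (-(c * b)) * (f 0 - m) := by
  rcases hb.eq_or_lt with rfl | hb
  · simp
  obtain ⟨hi, hint, hder⟩ := hf
  have hac := (hi b hb).absolutelyContinuousOnInterval_intervalIntegral
    (c := 0) (by simp)
  have hconst : AbsolutelyContinuousOnInterval (fun _ : ℝ => f 0 - m) 0 b :=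
    ContDiffOn.absolutelyContinuousOnInterval contDiffOn_const
  have hexp : AbsolutelyContinuousOnInterval (fun t : ℝ => Real.exp (c * t)) 0 b :=
    ContDiffOn.absolutelyContinuousOnInterval
      ((Real.contDiff_exp.comp (contDiff_const.mul contDiff_id)).contDiffOn)
  have hP := hexp.mul (hac.add hconst)
  set P : ℝ → ℝ := (fun t : ℝ => Real.exp (c * t)) *
    ((fun x => ∫ v in (0 : ℝ)..x, g v) + fun _ => f 0 - m) with hPdef
  have hPe : ∀ t, 0 ≤ t → P t = Real.exp (c * t) * (f t - m) := by
    intro t ht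
    have := hint 0 t le_rfl ht
    simp only [hPdef, Pi.mul_apply, Pi.add_apply, ← this]
    ring
  have hftc := hP.integral_deriv_eq_sub
  have hneg : ∫ t in (0 : ℝ)..b, deriv P t ≤ 0 := by
    rw [intervalIntegral.integral_of_le hb.le]
    refine integral_nonpos_of_ae ?_
    have hsub : Set.Ioc 0 b ⊆ Set.Ioi (0 : ℝ) := fun t ht => ht.1
    filter_upwards [ae_restrict_of_ae_restrict_of_subset hsub hle,
      ae_restrict_of_ae_restrict_of_subset hsub hder, ae_restrict_mem measurableSet_Ioc]
      with t h1 h2 h3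
    have hd : HasDerivAt (fun t => Real.exp (c * t) * (f t - m))
        (Real.exp (c * t) * c * (f t - m) + Real.exp (c * t) * g t) t := by
      have he : HasDerivAt (fun t => Real.exp (c * t)) (Real.exp (c * t) * c) t := by
        simpa using ((hasDerivAt_id t).const_mul c).exp
      exact he.mul (h2.sub_const m)
    have hd' : HasDerivAt P _ t := hd.congr_of_eventuallyEq (by
      filter_upwards [Ioi_mem_nhds h3.1] with y hy
      exact hPe y (le_of_lt hy))
    rw [hd'.deriv]
    have := Real.exp_pos (c * t)
    simp only [Pi.zero_apply]
    nlinarith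
  rw [hftc, hPe b hb.le, hPe 0 le_rfl] at hneg
  simp only [mul_zero, Real.exp_zero, one_mul] at hneg
  have hE := Real.exp_pos (-(c * b))
  have hone : Real.exp (-(c * b)) * Real.exp (c * b) = 1 := by
    rw [← Real.exp_add]; simp
  have := mul_le_mul_of_nonneg_left hneg hE.le
  rw [mul_sub, ← mul_assoc, hone] at this
  linarith

/-- Exponential convergence of the values along the constrained gradient flow when `F` is
`λ`-star-convex around its minimizer with `λ > 0`:
`F(T(t)) − F(T*) ≤ e^{−2λt}·(F(T₀) − F(T*))` for a.e. `t ≥ 0`. -/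
theorem value_exponential_convergence (K : Set H) (hKne : K.Nonempty)
    (hKcl : IsClosed K) (hKconv : Convex ℝ K)
    (F : H → ℝ) (F' : H → H) (hgrad : ∀ x : H, HasGradientAt F (F' x) x)
    (Tstar : H) (hTstar : Tstar ∈ K) (hmin : ∀ U ∈ K, F Tstar ≤ F U)
    (lam : ℝ) (hlam : 0 < lam) (hstar : StarConvexAround lam K F Tstar)
    (T₀ : H) (hT₀ : T₀ ∈ K) (T T' : ℝ → H)
    (hflow : IsFlowSol K F' T₀ T T')
    (hAC : ∃ g : ℝ → ℝ, IsLocACWithDeriv (fun t => F (T t)) g) :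
    ∀ᵐ t ∂(MeasureTheory.volume.restrict (Set.Ici (0 : ℝ))),
      F (T t) - F Tstar ≤ Real.exp (-(2 * lam * t)) * (F T₀ - F Tstar) := by
  obtain ⟨g, hg⟩ := hAC
  obtain ⟨h0, hmem, -, -, hder⟩ := hflow
  filter_upwards [ae_restrict_mem measurableSet_Ici] with t ht
  rw [← h0]
  refine gronwall_ac (fun t => F (T t)) g hg (2 * lam) (F Tstar) ?_ t ht
  filter_upwards [hder, hg.2.2, ae_restrict_mem measurableSet_Ioi] with s h1 h2 h3
  have hd := (hgrad (T s)).hasFDerivAt.comp_hasDerivAt s h1.1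
  simp only [InnerProductSpace.toDual_apply_apply] at hd
  rw [h2.unique hd]
  exact pointwise_bound K hKconv F _ _ _ _ (hmem s (le_of_lt h3)) hTstar (hgrad _) lam hlam
    hstar h1.2
end

section
/- Let K ⊆ H be a nonempty closed convex set, F : H → ℝ Fréchet differentiable with gradient ∇F, and let T* ∈ K be a minimizer of F over K. Assume F is λ-star-convex on K around T* with λ > 0. Let T : [0,∞) → H be a solution of the constrained gradient flow of F in K starting at T₀ ∈ K, and assume t ↦ F(T(t)) is locally absolutely continuous. Then for almost every t ≥ 0, ‖T(t) − T*‖² ≤ (4/λ) · e^{−2λt} · (F(T₀) − F(T*)). -/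
open MeasureTheory
open scoped RealInnerProductSpace

variable {H : Type*} [NormedAddCommGroup H] [InnerProductSpace ℝ H] [CompleteSpace H]

lemma proj_cone_energy (C : Set H) (hC : ∀ w ∈ C, ∀ c : ℝ, 0 < c → c • w ∈ C) (v p w : H)
    (hp : IsProjOn C v p) (hw : w ∈ C) :
    ⟪v, p⟫ = ‖p‖ ^ 2 ∧ 2 * ⟪v, w⟫ - ‖w‖ ^ 2 ≤ ‖p‖ ^ 2 := by
  obtain ⟨hpC, hp⟩ := hp
  have key : ∀ u ∈ C, -(2 * ⟪v, p⟫) + ‖p‖ ^ 2 ≤ -(2 * ⟪v, u⟫) + ‖u‖ ^ 2 := by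
    intro u hu
    have h := pow_le_pow_left₀ (norm_nonneg _) (hp u hu) 2
    rw [norm_sub_sq_real, norm_sub_sq_real] at h
    linarith
  have hsc : ∀ c : ℝ, 0 < c →
      -(2 * ⟪v, p⟫) + ‖p‖ ^ 2 ≤ -(2 * (c * ⟪v, p⟫)) + c ^ 2 * ‖p‖ ^ 2 := by
    intro c hc
    have h := key _ (hC p hpC c hc)
    rw [real_inner_smul_right, norm_smul, mul_pow, Real.norm_eq_abs, sq_abs] at h
    exact h
  have heq : ⟪v, p⟫ = ‖p‖ ^ 2 := by
    rcases eq_or_ne p 0 with h0 | h0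
    · simp [h0]
    have hN : 0 < ‖p‖ ^ 2 := by positivity
    generalize ‖p‖ ^ 2 = N at *
    generalize ⟪v, p⟫ = a at *
    have ha : 0 < a := by
      by_contra ha
      have := hsc (1 / 2) (by norm_num)
      linarith
    have h := hsc (a / N) (by positivity)
    have e1 : -(2 * (a / N * a)) + (a / N) ^ 2 * N = -(a ^ 2 / N) := by
      field_simp; ring
    rw [e1] at h
    have h2 : (a - N) ^ 2 / N ≤ 0 := by
      have : (a - N) ^ 2 / N = a ^ 2 / N - 2 * a + N := by field_simp; ring
      linarith
    have h3 : (a - N) ^ 2 ≤ 0 := by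
      rw [div_le_iff₀ hN] at h2; linarith
    have h4 : a - N = 0 := by nlinarith [sq_nonneg (a - N), pow_eq_zero_iff (two_ne_zero) |>.1 (le_antisymm h3 (sq_nonneg _))]
    linarith
  refine ⟨heq, ?_⟩
  have := key w hw
  linarith

lemma tanCone_smul (K : Set H) (T : H) : ∀ w ∈ tanCone K T, ∀ c : ℝ, 0 < c →
    c • w ∈ tanCone K T := by
  intro w hw c hc
  unfold tanCone at *
  refine map_mem_closure (continuous_const_smul c) hw ?_
  rintro x ⟨t, ht, hx⟩
  refine ⟨t / c, by positivity, ?_⟩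
  rw [smul_smul, div_mul_cancel₀ _ hc.ne']
  exact hx

lemma star_grad (K : Set H) (F : H → ℝ) (F' : H → H)
    (hgrad : ∀ x : H, HasGradientAt F (F' x) x) (Tstar : H) (lam : ℝ)
    (hstar : StarConvexAround lam K F Tstar) (X : H) (hX : X ∈ K) :
    ⟪F' X, Tstar - X⟫ ≤ F Tstar - F X - lam / 2 * ‖X - Tstar‖ ^ 2 := by
  have hl : HasDerivAt (fun s : ℝ => X + s • (Tstar - X)) (Tstar - X) 0 := by
    simpa using ((hasDerivAt_id (0 : ℝ)).smul_const (Tstar - X)).const_add X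
  have hF : HasFDerivAt F (InnerProductSpace.toDual ℝ H (F' X)) (X + (0 : ℝ) • (Tstar - X)) := by
    simpa using (hgrad X).hasFDerivAt
  have hd : HasDerivAt (fun s : ℝ => F (X + s • (Tstar - X))) ⟪F' X, Tstar - X⟫ 0 := by
    have h := hF.comp_hasDerivAt (0 : ℝ) hl
    exact h
  have hs := hd.tendsto_slope_zero_right
  have hc : Filter.Tendsto (fun s : ℝ => F Tstar - F X - lam / 2 * (1 - s) * ‖X - Tstar‖ ^ 2)
      (nhdsWithin 0 (Set.Ioi 0)) (nhds (F Tstar - F X - lam / 2 * (1 - 0) * ‖X - Tstar‖ ^ 2)) := by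
    apply Filter.Tendsto.mono_left _ nhdsWithin_le_nhds
    apply Continuous.tendsto (f := fun s : ℝ => F Tstar - F X - lam / 2 * (1 - s) * ‖X - Tstar‖ ^ 2)
    fun_prop
  have := le_of_tendsto_of_tendsto hs hc ?_
  · simpa using this
  filter_upwards [Ioo_mem_nhdsGT (show (0 : ℝ) < 1 by norm_num)] with s hs
  have h := hstar X hX s hs.1.le hs.2.le
  have e : (1 - s) • X + s • Tstar = X + s • (Tstar - X) := by module
  rw [e] at h
  simp only [zero_add, zero_smul, add_zero, smul_eq_mul]
  rw [inv_mul_le_iff₀ hs.1]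
  linarith

lemma quad_growth (K : Set H) (F : H → ℝ) (Tstar : H) (hTstar : Tstar ∈ K)
    (hKconv : Convex ℝ K) (hmin : ∀ U ∈ K, F Tstar ≤ F U) (lam : ℝ)
    (hstar : StarConvexAround lam K F Tstar) (X : H) (hX : X ∈ K) :
    lam / 2 * ‖X - Tstar‖ ^ 2 ≤ F X - F Tstar := by
  have hc : Filter.Tendsto (fun s : ℝ => lam / 2 * s * ‖X - Tstar‖ ^ 2)
      (nhdsWithin 1 (Set.Iio 1)) (nhds (lam / 2 * 1 * ‖X - Tstar‖ ^ 2)) := by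
    apply Filter.Tendsto.mono_left _ nhdsWithin_le_nhds
    apply Continuous.tendsto (f := fun s : ℝ => lam / 2 * s * ‖X - Tstar‖ ^ 2)
    fun_prop
  have := le_of_tendsto hc (b := F X - F Tstar) ?_
  · simpa using this
  filter_upwards [Ioo_mem_nhdsLT (show (0 : ℝ) < 1 by norm_num)] with s hs
  have h := hstar X hX s hs.1.le hs.2.le
  have h2 := hmin _ (hKconv hX hTstar (sub_nonneg.2 hs.2.le) hs.1.le (by ring))
  have h3 : 0 < 1 - s := sub_pos.2 hs.2
  refine le_of_mul_le_mul_left (a := 1 - s) ?_ h3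
  linarith

lemma flow_discrete_gronwall (e : ℝ → ℝ) (m : ℝ) (hm : 0 < m)
    (h : ∀ a b : ℝ, 0 ≤ a → a ≤ b → e b * (1 + m * (b - a)) ≤ e a) (t : ℝ) (ht : 0 ≤ t) :
    e t ≤ Real.exp (-(m * t)) * e 0 := by
  have hn : ∀ n : ℕ, 0 < n → e t * (1 + m * t / n) ^ n ≤ e 0 := by
    intro n hn
    have hn' : (0 : ℝ) < n := by exact_mod_cast hn
    have hk : ∀ k : ℕ, e (k * (t / n)) * (1 + m * t / n) ^ k ≤ e 0 := by
      intro k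
      induction k with
      | zero => simp
      | succ k ih =>
        have h1 := h (k * (t / n)) ((k + 1 : ℕ) * (t / n)) (by positivity)
          (by gcongr; simp)
        have e1 : m * (((k + 1 : ℕ) : ℝ) * (t / n) - k * (t / n)) = m * t / n := by
          push_cast; ring
        rw [e1] at h1
        refine le_trans ?_ ih
        rw [pow_succ', ← mul_assoc]
        exact mul_le_mul_of_nonneg_right h1 (by positivity)
    have := hk n
    rwa [mul_div_cancel₀ _ hn'.ne'] at this
  have hl := (Real.tendsto_one_add_div_pow_exp (m * t)).const_mul (e t)
  have h1 : e t * Real.exp (m * t) ≤ e 0 :=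
    le_of_tendsto hl (Filter.eventually_atTop.2 ⟨1, fun n h => hn n h⟩)
  rw [Real.exp_neg, inv_mul_eq_div, le_div_iff₀ (Real.exp_pos _)]
  exact h1

/-- Exponential convergence of the flow itself when `F` is `λ`-star-convex around its minimizer
with `λ > 0`: `‖T(t) − T*‖² ≤ (4/λ)·e^{−2λt}·(F(T₀) − F(T*))` for a.e. `t ≥ 0`. -/
theorem flow_exponential_convergence (K : Set H) (hKne : K.Nonempty)
    (hKcl : IsClosed K) (hKconv : Convex ℝ K)
    (F : H → ℝ) (F' : H → H) (hgrad : ∀ x : H, HasGradientAt F (F' x) x)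
    (Tstar : H) (hTstar : Tstar ∈ K) (hmin : ∀ U ∈ K, F Tstar ≤ F U)
    (lam : ℝ) (hlam : 0 < lam) (hstar : StarConvexAround lam K F Tstar)
    (T₀ : H) (hT₀ : T₀ ∈ K) (T T' : ℝ → H)
    (hflow : IsFlowSol K F' T₀ T T')
    (hAC : ∃ g : ℝ → ℝ, IsLocACWithDeriv (fun t => F (T t)) g) :
    ∀ᵐ t ∂(MeasureTheory.volume.restrict (Set.Ici (0 : ℝ))),
      ‖T t - Tstar‖ ^ 2 ≤ 4 / lam * Real.exp (-(2 * lam * t)) * (F T₀ - F Tstar) := by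
  obtain ⟨h0, hTK, -, -, hae⟩ := hflow
  obtain ⟨g, hgi, hgI, hgd⟩ := hAC
  have hnn : ∀ t, 0 ≤ t → 0 ≤ F (T t) - F Tstar := fun t ht => sub_nonneg.2 (hmin _ (hTK t ht))
  have hg : ∀ᵐ t ∂(volume.restrict (Set.Ioi (0 : ℝ))),
      g t ≤ -(2 * lam * (F (T t) - F Tstar)) := by
    filter_upwards [hae, hgd, ae_restrict_mem measurableSet_Ioi] with t ht hgt htpos
    have hK := hTK t (le_of_lt htpos)
    have hd : HasDerivAt (fun t => F (T t)) ⟪F' (T t), T' t⟫ t := by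
      have h := (hgrad (T t)).hasFDerivAt.comp_hasDerivAt t ht.1
      exact h
    have e1 := hgt.unique hd
    have hw : lam • (Tstar - T t) ∈ tanCone K (T t) := by
      refine tanCone_smul K (T t) _ (subset_closure ⟨1, one_pos, ?_⟩) lam hlam
      simpa using hTstar
    obtain ⟨h1, h2⟩ := proj_cone_energy _ (tanCone_smul K (T t)) _ _ _ ht.2 hw
    have h3 := star_grad K F F' hgrad Tstar lam hstar (T t) hK
    rw [inner_neg_left] at h1 h2
    rw [real_inner_smul_right, norm_smul, mul_pow, Real.norm_eq_abs, sq_abs,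
      norm_sub_rev] at h2
    rw [e1]
    have h4 := mul_le_mul_of_nonneg_left h3 hlam.le
    nlinarith
  have hgab : ∀ a b : ℝ, 0 ≤ a → a ≤ b → IntervalIntegrable g volume a b := by
    intro a b ha hab
    have := hgi (b + 1) (by linarith)
    refine this.mono_set ?_
    rw [Set.uIcc_of_le hab, Set.uIcc_of_le (by linarith)]
    exact Set.Icc_subset_Icc ha (by linarith)
  have hbd : ∀ a b c : ℝ, 0 ≤ a → a ≤ b →
      (∀ t, a < t → t ≤ b → c ≤ 2 * lam * (F (T t) - F Tstar)) →
      F (T b) - F (T a) ≤ -(c * (b - a)) := by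
    intro a b c ha hab hc
    have h1 := hgI a b ha hab
    simp only at h1
    rw [h1]
    have h2 : ∫ t in a..b, g t ≤ ∫ _t in a..b, (-c : ℝ) := by
      rw [intervalIntegral.integral_of_le hab, intervalIntegral.integral_of_le hab]
      refine integral_mono_ae (hgab a b ha hab).1 (by simp) ?_
      have hg2 := ae_restrict_of_ae_restrict_of_subset
        (show Set.Ioc a b ⊆ Set.Ioi 0 from fun x hx => lt_of_le_of_lt ha hx.1) hg
      filter_upwards [hg2, ae_restrict_mem measurableSet_Ioc] with t ht htm
      have := hc t htm.1 htm.2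
      linarith
    refine h2.trans (le_of_eq ?_)
    simp
    ring
  have hanti : ∀ a b : ℝ, 0 ≤ a → a ≤ b → F (T b) ≤ F (T a) := by
    intro a b ha hab
    have := hbd a b 0 ha hab (fun t h1 h2 => by
      have := hnn t (by linarith)
      positivity)
    linarith
  have hgr := flow_discrete_gronwall (fun t => F (T t) - F Tstar) (2 * lam) (by positivity) (by
    intro a b ha hab
    have := hbd a b (2 * lam * (F (T b) - F Tstar)) ha hab (fun t h1 h2 => by
      have := hanti t b (by linarith) h2
      gcongr)
    linarith)
  filter_upwards [ae_restrict_mem measurableSet_Ici] with t ht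
  have ht' : 0 ≤ t := ht
  have h1 := hgr t ht'
  simp only [h0] at h1
  have h2 := quad_growth K F Tstar hTstar hKconv hmin lam hstar (T t) (hTK t ht')
  have h3 := hmin T₀ hT₀
  have h4 : 0 ≤ Real.exp (-(2 * lam * t)) * (F T₀ - F Tstar) :=
    mul_nonneg (Real.exp_pos _).le (sub_nonneg.2 h3)
  rw [mul_assoc, div_mul_eq_mul_div, le_div_iff₀ hlam]
  linarith
end

section
/- (Constrained Polyak–Łojasiewicz inequality.) Let K ⊆ H be a nonempty closed convex set, F : H → ℝ Fréchet differentiable with gradient ∇F, T* ∈ K, and assume F is λ-star-convex on K around T* with λ > 0. Then for every T ∈ K, setting w := proj_{Tan_T K}(−∇F(T)), one has F(T) − F(T*) ≤ ‖w‖² / (2λ). -/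
open MeasureTheory
open scoped RealInnerProductSpace

variable {H : Type*} [NormedAddCommGroup H] [InnerProductSpace ℝ H] [CompleteSpace H]

/-- Constrained Polyak–Łojasiewicz inequality: if `F` is `λ`-star-convex on `K` around
`Tstar ∈ K` with `λ > 0`, then for `T ∈ K` and `w := proj_{Tan_T K}(−∇F(T))`,
`F(T) − F(T*) ≤ ‖w‖²/(2λ)`. -/
theorem constrained_PL_inequality (K : Set H) (hKne : K.Nonempty)
    (hKcl : IsClosed K) (hKconv : Convex ℝ K)
    (F : H → ℝ) (F' : H → H) (hgrad : ∀ x : H, HasGradientAt F (F' x) x)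
    (Tstar : H) (hTstar : Tstar ∈ K)
    (lam : ℝ) (hlam : 0 < lam) (hstar : StarConvexAround lam K F Tstar)
    (T : H) (hT : T ∈ K) (w : H)
    (hw : IsProjOn (tanCone K T) (-(F' T)) w) :
    F T - F Tstar ≤ ‖w‖ ^ 2 / (2 * lam) := by
  set d := Tstar - T with hd
  have h1 : ⟪F' T, d⟫ ≤ F Tstar - F T - lam / 2 * ‖d‖ ^ 2 := by
    have hline : HasDerivAt (fun s : ℝ => T + s • d) d 0 := by
      simpa using ((hasDerivAt_id (0 : ℝ)).smul_const d).const_add T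
    have hF : HasFDerivAt F (InnerProductSpace.toDual ℝ H (F' T)) (T + (0 : ℝ) • d) := by
      simpa using (hgrad T).hasFDerivAt
    have hcomp : HasDerivAt (fun s : ℝ => F (T + s • d)) ⟪F' T, d⟫ 0 := by
      simpa [Function.comp_def] using hF.comp_hasDerivAt (0 : ℝ) hline
    have hs := hcomp.tendsto_slope_zero_right
    have hr : Filter.Tendsto (fun s : ℝ => F Tstar - F T - lam / 2 * (1 - s) * ‖d‖ ^ 2)
        (nhdsWithin 0 (Set.Ioi 0)) (nhds (F Tstar - F T - lam / 2 * ‖d‖ ^ 2)) := by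
      have hc : Continuous (fun s : ℝ => F Tstar - F T - lam / 2 * (1 - s) * ‖d‖ ^ 2) := by
        fun_prop
      have := hc.tendsto 0
      simp only [sub_zero, mul_one] at this
      exact this.mono_left nhdsWithin_le_nhds
    refine le_of_tendsto_of_tendsto hs hr ?_
    filter_upwards [Ioo_mem_nhdsGT (zero_lt_one' ℝ)] with s hs
    have h := hstar T hT s hs.1.le hs.2.le
    have e : (1 - s) • T + s • Tstar = T + s • d := by rw [hd]; module
    rw [e, norm_sub_rev T Tstar, ← hd] at h
    simp only [zero_add, zero_smul, add_zero, smul_eq_mul]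
    rw [inv_mul_le_iff₀ hs.1]
    linarith
  have hmem : ∀ ε : ℝ, 0 < ε → w + ε • d ∈ tanCone K T := by
    intro ε hε
    have hc : Continuous (fun x : H => x + ε • d) := by fun_prop
    refine map_mem_closure (f := fun x : H => x + ε • d) hc hw.1 ?_
    rintro x ⟨t, ht, hx⟩
    have hp : 0 < 1 + t * ε := by positivity
    refine ⟨t / (1 + t * ε), by positivity, ?_⟩
    have := hKconv hx hTstar (a := 1 / (1 + t * ε)) (b := t * ε / (1 + t * ε))
      (by positivity) (by positivity) (by field_simp)
    convert this using 1
    rw [hd]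
    match_scalars <;> field_simp <;> ring
  have h2 : ⟪-(F' T) - w, d⟫ ≤ 0 := by
    have key : ∀ ε : ℝ, 0 < ε → 2 * ⟪-(F' T) - w, d⟫ ≤ ε * ‖d‖ ^ 2 := by
      intro ε hε
      have h := hw.2 _ (hmem ε hε)
      have h' := pow_le_pow_left₀ (norm_nonneg _) h 2
      rw [← sub_sub, norm_sub_sq_real (-(F' T) - w), inner_smul_right, norm_smul, mul_pow,
        Real.norm_eq_abs, sq_abs] at h'
      refine le_of_mul_le_mul_left ?_ hε
      nlinarith
    by_contra hcon
    push Not at hcon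
    have hk := key (⟪-(F' T) - w, d⟫ / (‖d‖ ^ 2 + 1)) (by positivity)
    have : ⟪-(F' T) - w, d⟫ / (‖d‖ ^ 2 + 1) * ‖d‖ ^ 2 ≤ ⟪-(F' T) - w, d⟫ := by
      rw [div_mul_eq_mul_div, div_le_iff₀ (by positivity)]
      nlinarith
    linarith
  rw [inner_sub_left, inner_neg_left] at h2
  have h3 := real_inner_le_norm w d
  rw [le_div_iff₀ (by positivity)]
  have h4 : F T - F Tstar ≤ ‖w‖ * ‖d‖ - lam / 2 * ‖d‖ ^ 2 := by linarith
  nlinarith [sq_nonneg (‖w‖ - lam * ‖d‖), mul_le_mul_of_nonneg_left h4 hlam.le]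
end

section
/- Let K ⊆ H be a nonempty closed convex set and let F : H → ℝ be lower semicontinuous (for the norm topology) and convex on K, and assume F admits a unique minimizer T* over K. Fix τ > 0 and T₀ ∈ K, and define the proximal iterates by letting T_{k+1} be the unique minimizer over K of T ↦ F(T) + ‖T − T_k‖²/(2τ) for each k ≥ 0 (these minimizers exist and are unique). Then T_k converges weakly to T* in H as k → ∞, i.e., ⟨T_k, y⟩ → ⟨T*, y⟩ for every y ∈ H. -/
open Filter
open scoped RealInnerProductSpace

variable {H : Type*} [NormedAddCommGroup H] [InnerProductSpace ℝ H] [CompleteSpace H]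

/-- Weak convergence of the proximal iterates of a lower semicontinuous convex functional to
its unique minimizer over `K`. -/
theorem prox_iterates_weak_convergence (K : Set H) (hKne : K.Nonempty)
    (hKcl : IsClosed K) (hKconv : Convex ℝ K)
    (F : H → ℝ) (hlsc : LowerSemicontinuous F) (hconv : LambdaConvexOn 0 K F)
    (Tstar : H) (hTstar : Tstar ∈ K) (hmin : ∀ U ∈ K, F Tstar ≤ F U)
    (huniq : ∀ m : H, m ∈ K → (∀ U ∈ K, F m ≤ F U) → m = Tstar)
    (τ : ℝ) (hτ : 0 < τ) (T₀ : H) (hT₀ : T₀ ∈ K)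
    (Tseq : ℕ → H) (h0 : Tseq 0 = T₀)
    (hstep : ∀ k : ℕ, Tseq (k + 1) ∈ K ∧
      ∀ U ∈ K, F (Tseq (k + 1)) + ‖Tseq (k + 1) - Tseq k‖ ^ 2 / (2 * τ) ≤
        F U + ‖U - Tseq k‖ ^ 2 / (2 * τ)) :
    ∀ y : H, Tendsto (fun k => ⟪Tseq k, y⟫) atTop (nhds ⟪Tstar, y⟫) := by
  have key : ∀ k, 2 * τ * (F (Tseq (k+1)) - F Tstar) ≤
      ‖Tseq k - Tstar‖ ^ 2 - ‖Tseq (k+1) - Tstar‖ ^ 2 := by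
    intro k
    obtain ⟨hK, hopt⟩ := hstep k
    set P := Tseq (k+1) with hP
    set Q := Tseq k with hQ
    have hs : ∀ s : ℝ, 0 < s → s ≤ 1 →
        2 * τ * (F P - F Tstar) ≤ 2 * ⟪P - Q, Tstar - P⟫ + s * ‖Tstar - P‖ ^ 2 := by
      intro s hs0 hs1
      have h1 := hconv P hK Tstar hTstar s hs0.le hs1
      have h2 := hopt ((1 - s) • P + s • Tstar)
        (hKconv hK hTstar (by linarith) hs0.le (by ring))
      have h3 : (1 - s) • P + s • Tstar - Q = (P - Q) + s • (Tstar - P) := by module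
      rw [h3, norm_add_sq_real, inner_smul_right, norm_smul, mul_pow, Real.norm_eq_abs,
        sq_abs] at h2
      have h4 : F P * (2 * τ) + ‖P - Q‖ ^ 2 ≤ F ((1 - s) • P + s • Tstar) * (2 * τ) +
          (‖P - Q‖ ^ 2 + 2 * (s * ⟪P - Q, Tstar - P⟫) + s ^ 2 * ‖Tstar - P‖ ^ 2) := by
        have := mul_le_mul_of_nonneg_right h2 (by positivity : 0 ≤ 2 * τ)
        rwa [add_mul, add_mul, div_mul_cancel₀ _ (by positivity),
          div_mul_cancel₀ _ (by positivity)] at this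
      have h5 := mul_le_mul_of_nonneg_right h1 (by positivity : 0 ≤ 2 * τ)
      refine le_of_mul_le_mul_left ?_ hs0
      linarith
    have hlim : 2 * τ * (F P - F Tstar) ≤ 2 * ⟪P - Q, Tstar - P⟫ := by
      have ht : Tendsto (fun s : ℝ => 2 * ⟪P - Q, Tstar - P⟫ + s * ‖Tstar - P‖ ^ 2)
          (nhdsWithin 0 (Set.Ioi 0)) (nhds (2 * ⟪P - Q, Tstar - P⟫)) := by
        have : Continuous (fun s : ℝ => 2 * ⟪P - Q, Tstar - P⟫ + s * ‖Tstar - P‖ ^ 2) := by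
          fun_prop
        have h := (this.tendsto 0).mono_left (nhdsWithin_le_nhds (s := Set.Ioi 0))
        simpa using h
      refine ge_of_tendsto ht ?_
      filter_upwards [Ioc_mem_nhdsGT (zero_lt_one' ℝ)] with s hs'
      exact hs s hs'.1 hs'.2
    have h6 : ‖Q - Tstar‖ ^ 2 = ‖P - Q‖ ^ 2 + 2 * ⟪P - Q, Tstar - P⟫ + ‖P - Tstar‖ ^ 2 := by
      have : Q - Tstar = -((P - Q) + (Tstar - P)) := by abel
      rw [this, norm_neg, norm_add_sq_real, norm_sub_rev Tstar P]
    nlinarith [sq_nonneg ‖P - Q‖]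
  have hanti : Antitone (fun k => ‖Tseq k - Tstar‖ ^ 2) := by
    refine antitone_nat_of_succ_le fun k => ?_
    have h1 := key k
    have h2 : 0 ≤ 2 * τ * (F (Tseq (k+1)) - F Tstar) :=
      mul_nonneg (by positivity) (sub_nonneg.2 (hmin _ (hstep k).1))
    linarith
  have hdiff : Tendsto (fun k => ‖Tseq k - Tstar‖ ^ 2 - ‖Tseq (k+1) - Tstar‖ ^ 2)
      atTop (nhds 0) := by
    have hl := tendsto_atTop_ciInf hanti ⟨0, by rintro _ ⟨k, rfl⟩; positivity⟩
    have := hl.sub (hl.comp (tendsto_add_atTop_nat 1))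
    simpa using this
  have hev : ∀ c, F Tstar < c → ∀ᶠ k in atTop, Tseq k ∈ K ∧ F (Tseq k) ≤ c := by
    intro c hc
    have hpos : 0 < 2 * τ * (c - F Tstar) := mul_pos (by positivity) (by linarith)
    have h := hdiff.eventually (gt_mem_nhds hpos)
    obtain ⟨N, hN⟩ := eventually_atTop.1 h
    refine eventually_atTop.2 ⟨N + 1, fun k hk => ?_⟩
    obtain ⟨j, rfl⟩ : ∃ j, k = j + 1 := ⟨k - 1, by omega⟩
    refine ⟨(hstep j).1, ?_⟩
    have h1 := (key j).trans_lt (hN j (by omega))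
    have h2 := lt_of_mul_lt_mul_left h1 (by positivity)
    linarith
  have hbdd : ∀ k, ‖Tseq k‖ ≤ ‖Tseq 0 - Tstar‖ + ‖Tstar‖ := by
    intro k
    have h1 : ‖Tseq k - Tstar‖ ≤ ‖Tseq 0 - Tstar‖ :=
      (sq_le_sq₀ (norm_nonneg _) (norm_nonneg _)).1 (hanti (Nat.zero_le k))
    have h2 : ‖Tseq k‖ ≤ ‖Tseq k - Tstar‖ + ‖Tstar‖ := by
      simpa using norm_add_le (Tseq k - Tstar) Tstar
    linarith
  intro y
  rw [tendsto_iff_ultrafilter]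
  intro G hG
  -- weak cluster point via Banach–Alaoglu
  obtain ⟨m, hm⟩ : ∃ m : H, ∀ z, Tendsto (fun k => ⟪Tseq k, z⟫) G (nhds ⟪m, z⟫) := by
    have hcomp := WeakDual.isCompact_closedBall (𝕜 := ℝ) (0 : StrongDual ℝ H)
      (‖Tseq 0 - Tstar‖ + ‖Tstar‖)
    let φ : ℕ → WeakDual ℝ H := fun k =>
      StrongDual.toWeakDual (InnerProductSpace.toDual ℝ H (Tseq k))
    obtain ⟨x, -, hx⟩ := hcomp.ultrafilter_le_nhds (G.map φ) (by
      rw [le_principal_iff]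
      refine Ultrafilter.mem_map.2 (Filter.univ_mem' fun k => ?_)
      simpa [φ] using hbdd k)
    refine ⟨(InnerProductSpace.toDual ℝ H).symm (WeakDual.toStrongDual x), fun z => ?_⟩
    have h1 : Tendsto φ G (nhds x) := hx
    have h2 := ((WeakDual.eval_continuous z).tendsto x).comp h1
    rw [InnerProductSpace.toDual_symm_apply]
    exact h2
  have hmem : ∀ c, F Tstar < c → m ∈ K ∧ F m ≤ c := by
    intro c hc
    have hSconv : Convex ℝ {U | U ∈ K ∧ F U ≤ c} := by
      intro a ha b hb p q hp hq hpq
      refine ⟨hKconv ha.1 hb.1 hp hq hpq, ?_⟩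
      have h1 := hconv a ha.1 b hb.1 q hq (by linarith)
      have h2 : 1 - q = p := by linarith
      rw [h2] at h1
      have h3 := mul_le_mul_of_nonneg_left ha.2 hp
      have h4 := mul_le_mul_of_nonneg_left hb.2 hq
      have h5 : p * c + q * c = c := by rw [← add_mul, hpq, one_mul]
      have h6 : F (p • a + q • b) ≤ p * F a + q * F b := by simpa using h1
      linarith
    have hScl : IsClosed {U | U ∈ K ∧ F U ≤ c} :=
      hKcl.inter (hlsc.isClosed_preimage c)
    by_contra hcon
    obtain ⟨f, u, hfu, hum⟩ := geometric_hahn_banach_closed_point hSconv hScl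
      (x := m) hcon
    have hz : ∀ v, f v = ⟪v, (InnerProductSpace.toDual ℝ H).symm f⟫ := fun v => by
      rw [real_inner_comm, InnerProductSpace.toDual_symm_apply]
    have hle : ⟪m, (InnerProductSpace.toDual ℝ H).symm f⟫ ≤ u := by
      refine le_of_tendsto (hm _) ?_
      filter_upwards [hG (hev c hc)] with k hk
      rw [← hz]
      exact (hfu _ hk).le
    rw [← hz] at hle
    linarith
  have hmT : m = Tstar := by
    refine huniq m (hmem (F Tstar + 1) (by linarith)).1 fun U hU => ?_
    exact (le_of_forall_gt_imp_ge_of_dense fun c hc => (hmem c hc).2).trans (hmin U hU)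
  rw [← hmT]
  exact hm y
end
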